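/- Let G = ⟨X; Rⁿ⟩ be a freely indecomposable one-relator group with torsion, let T be the normal closure in G of the image of R, and suppose G is isomorphic to an HNN-extension of a group H with associated subgroups A and B of H (identified via an isomorphism φ : A ≃ B), where A and B are virtually-ℤ. Then, identifying A and B with their images in G under the canonical embedding of H, neither A nor B is contained in T, and consequently each of A and B is contained in a malnormal infinite cyclic subgroup of G. -/

import Mathlib

/-- A group is *virtually-ℤ* if it has a finite-index subgroup isomorphic to `ℤ`. -/
def VirtuallyZ (G : Type*) [Group G] : Prop :=
  ∃ H : Subgroup G, H.FiniteIndex ∧ Nonempty (H ≃* Multiplicative ℤ)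

/-- A subgroup `M` of `G` is *malnormal* if `g M g⁻¹ ∩ M ≠ 1` implies `g ∈ M`. -/
def Subgroup.IsMalnormal {G : Type*} [Group G] (M : Subgroup G) : Prop :=
  ∀ g : G, (∃ x : G, x ≠ 1 ∧ x ∈ M ∧ g * x * g⁻¹ ∈ M) → g ∈ M

/-- A group is a *free product of cyclic groups* if it is isomorphic to the free product
(`Monoid.CoprodI`) of a family of cyclic groups; every cyclic group is isomorphic to
`Multiplicative (ZMod m)` for some `m : ℕ` (with `m = 0` giving the infinite cyclic group). -/
def IsFreeProductOfCyclics (G : Type*) [Group G] : Prop :=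
  ∃ (ι : Type) (m : ι → ℕ),
    Nonempty (G ≃* Monoid.CoprodI fun i => Multiplicative (ZMod (m i)))

/-- A group is *freely decomposable* if it is isomorphic to a free product of two
nontrivial groups. -/
def FreelyDecomposable (G : Type*) [Group G] : Prop :=
  ∃ (H K : Type) (gH : Group H) (gK : Group K),
    Nontrivial H ∧ Nontrivial K ∧
      Nonempty (G ≃* (letI := gH; letI := gK; Monoid.Coprod H K))

/-- A group is *freely indecomposable* if it is not isomorphic to a free product of two
nontrivial groups. -/
def FreelyIndecomposable (G : Type*) [Group G] : Prop := ¬ FreelyDecomposable G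

namespace OneRel

open HNNExtension HNNExtension.NormalWord

section HNN
variable {G : Type*} [Group G] {A B : Subgroup G} (φ : A ≃* B)

/-- value of a list of letters `t^u g` -/
def ev (L : List (ℤˣ × G)) : HNNExtension G A B φ :=
  (L.map (fun x => t ^ (x.1 : ℤ) * of x.2)).prod

lemma ev_append (L M : List (ℤˣ × G)) : ev φ (L ++ M) = ev φ L * ev φ M := by
  simp [ev]

lemma ev_cons (x : ℤˣ × G) (M : List (ℤˣ × G)) :
    ev φ (x :: M) = t ^ (x.1 : ℤ) * of x.2 * ev φ M := by
  simp [ev]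

lemma exists_ev (g : HNNExtension G A B φ) : ∃ h L, g = of h * ev φ L := by
  induction g using HNNExtension.induction_on with
  | of g => exact ⟨g, [], by simp [ev]⟩
  | t => exact ⟨1, [(1, 1)], by simp [ev]⟩
  | mul x y hx hy =>
    obtain ⟨h, L, rfl⟩ := hx
    obtain ⟨h', L', rfl⟩ := hy
    rcases List.eq_nil_or_concat L with rfl | ⟨L0, x, rfl⟩
    · exact ⟨h * h', L', by simp [ev, mul_assoc]⟩
    · refine ⟨h, L0 ++ [(x.1, x.2 * h')] ++ L', ?_⟩
      simp [ev, mul_assoc]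
  | inv x hx =>
    obtain ⟨h, L, rfl⟩ := hx
    induction L generalizing h with
    | nil => exact ⟨h⁻¹, [], by simp [ev]⟩
    | cons x L ih =>
      obtain ⟨h', L', e'⟩ := ih x.2
      refine ⟨h', L' ++ [(-x.1, h⁻¹)], ?_⟩
      rw [ev_append, ← mul_assoc, ← e', ev_cons]
      simp [ev, mul_assoc]

lemma pinch (u v : ℤˣ) (g g' : G) (hg : g ∈ toSubgroup A B u) (huv : u ≠ v) :
    ∃ k : G, (t ^ (u : ℤ) * of g * (t ^ (v : ℤ) * of g') : HNNExtension G A B φ) = of k := by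
  have hv : v = -u := by
    rcases Int.units_eq_one_or u with rfl | rfl <;>
      rcases Int.units_eq_one_or v with rfl | rfl <;> simp_all
  subst hv
  rcases Int.units_eq_one_or u with rfl | rfl
  · refine ⟨φ ⟨g, hg⟩ * g', ?_⟩
    have := HNNExtension.t_mul_of (φ := φ) ⟨g, hg⟩
    simp only [Units.val_one, zpow_one, Units.val_neg, map_mul, zpow_neg] at *
    rw [this]; group
  · refine ⟨φ.symm ⟨g, hg⟩ * g', ?_⟩
    have := HNNExtension.inv_t_mul_of (φ := φ) ⟨g, hg⟩
    simp only [Units.val_one, zpow_one, Units.val_neg, map_mul, zpow_neg, neg_neg] at *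
    rw [this]; group

/-- Every element of an HNN extension is conjugate into the base or to a cyclically
reduced word. -/
lemma exists_cyc (g : HNNExtension G A B φ) :
    (∃ h, IsConj g (of h)) ∨ ∃ L : List (ℤˣ × G), L ≠ [] ∧ IsConj g (ev φ L) ∧
      (L ++ L).IsChain (fun a b => a.2 ∈ toSubgroup A B a.1 → a.1 = b.1) := by
  classical
  have hex : ∃ k, ∃ h L, L.length = k ∧ IsConj g (of h * ev φ L) := by
    obtain ⟨h, L, e⟩ := exists_ev φ g
    exact ⟨_, h, L, rfl, e ▸ IsConj.refl _⟩
  obtain ⟨h, L, hL, hc⟩ := Nat.find_spec hex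
  have hmin : ∀ h' L', IsConj g (of h' * ev φ L') → L.length ≤ L'.length := by
    intro h' L' hc'
    rw [hL]
    exact Nat.find_min' hex ⟨h', L', rfl, hc'⟩
  rcases List.eq_nil_or_concat L with rfl | ⟨L0, x, rfl⟩
  · left; exact ⟨h, by simpa [ev] using hc⟩
  right
  set L := L0 ++ [(x.1, x.2 * h)] with hLdef
  have hlen : L.length = (L0 ++ [x]).length := by simp [hLdef]
  have hc2 : IsConj g (ev φ L) := by
    refine hc.trans ?_
    rw [isConj_iff]
    refine ⟨(of h)⁻¹, ?_⟩
    simp [hLdef, ev, mul_assoc]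
  rw [List.concat_eq_append, ← hlen] at hmin
  have hrot : ∀ L1 L2, IsConj g (ev φ (L1 ++ L2)) → IsConj g (ev φ (L2 ++ L1)) := by
    intro L1 L2 hh
    refine hh.trans ?_
    rw [isConj_iff]
    refine ⟨(ev φ L1)⁻¹, ?_⟩
    simp [ev_append]
  have key : ∀ a b M, IsConj g (ev φ (a :: b :: M)) → (a :: b :: M).length = L.length →
      a.2 ∈ toSubgroup A B a.1 → a.1 = b.1 := by
    intro a b M hM hl ha
    by_contra hne
    obtain ⟨k, hk⟩ := pinch φ a.1 b.1 a.2 b.2 ha hne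
    have := hmin k M (by
      rw [ev_cons, ev_cons, ← mul_assoc, hk] at hM
      exact hM)
    simp only [List.length_cons] at hl
    omega
  have hLne : L ≠ [] := by simp [hLdef]
  have hLch : L.IsChain (fun a b => a.2 ∈ toSubgroup A B a.1 → a.1 = b.1) := by
    rw [List.isChain_iff_forall_rel_of_append_cons_cons]
    intro a b l1 l2 e
    refine key a b (l2 ++ l1) ?_ ?_
    · have := hrot l1 (a :: b :: l2) (e ▸ hc2)
      simpa using this
    · rw [e]; simp; omega
  refine ⟨L, hLne, hc2, ?_⟩
  rw [List.isChain_append]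
  refine ⟨hLch, hLch, ?_⟩
  intro a ha b hb
  obtain ⟨b', M, hbM⟩ : ∃ b' M, L = b' :: M := List.exists_cons_of_ne_nil hLne
  rw [hbM] at hb ha
  simp only [List.head?_cons, Option.mem_def, Option.some.injEq] at hb
  subst hb
  rcases List.eq_nil_or_concat M with rfl | ⟨M0, a', rfl⟩
  · simp at ha; subst ha; intro _; rfl
  · rw [List.concat_eq_append] at *
    have : a' = a := by
      rw [← List.cons_append, List.getLast?_append] at ha
      simpa using ha
    subst this
    refine key a' b' M0 ?_ ?_
    · have := hrot (b' :: M0) [a'] (by simpa [hbM] using hc2)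
      simpa using this
    · rw [hbM]; simp

/-- Torsion elements of an HNN extension are conjugate into the base. -/
lemma torsion_elliptic (g : HNNExtension G A B φ) (m : ℕ) (hm : 1 ≤ m) (hg : g ^ m = 1) :
    ∃ h, IsConj g (of h) := by
  rcases exists_cyc φ g with h | ⟨L, hL, hc, hch⟩
  · exact h
  exfalso
  have h1 : ev φ L ^ m = 1 := by
    obtain ⟨c, hc⟩ := isConj_iff.1 hc
    rw [← hc, conj_pow, hg]; simp
  have hev : ∀ k, ev φ (List.replicate k L).flatten = ev φ L ^ k := by
    intro k
    induction k with
    | zero => simp [ev]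
    | succ k ih => rw [List.replicate_succ, List.flatten_cons, ev_append, ih, pow_succ']
  have hchain : (List.replicate m L).flatten.IsChain
      (fun a b => a.2 ∈ toSubgroup A B a.1 → a.1 = b.1) := by
    rw [List.isChain_flatten]
    · rw [List.isChain_append] at hch
      refine ⟨?_, ?_⟩
      · intro l hl; rw [List.eq_of_mem_replicate hl]; exact hch.1
      · exact List.isChain_replicate_of_rel m hch.2.2
    · intro h
      exact hL (List.eq_of_mem_replicate h).symm
  have := HNNExtension.ReducedWord.toList_eq_nil_of_mem_of_range φ
    ⟨1, (List.replicate m L).flatten, hchain⟩ (by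
      refine ⟨1, ?_⟩
      have h2 := hev m
      rw [h1] at h2
      simpa [ReducedWord.prod, ev] using h2.symm)
  simp only [List.flatten_eq_nil_iff, List.mem_replicate] at this
  exact hL (this L ⟨by omega, rfl⟩)

end HNN
end OneRel

namespace OneRel

/-- The separation property of `π : G → Q`, `r ∈ ker π`. -/
def SProp {G Q : Type*} [Group G] [Group Q] (π : G →* Q) (r : G) : Prop :=
  ∀ a, π a = 1 → a ≠ 1 → ∃ Φ : Set Q, Φ.Finite ∧
    a ∉ Subgroup.closure {x | ∃ g, π g ∉ Φ ∧ x = g * r * g⁻¹}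

/-- Wreath-like group of pairs. -/
@[ext] structure Cyc (Q W : Type*) where
  q : Q
  f : Q → W

namespace Cyc
variable {Q W : Type*} [Group Q] [Group W]
instance : Mul (Cyc Q W) := ⟨fun a b => ⟨a.q * b.q, fun x => a.f (b.q * x) * b.f x⟩⟩
instance : One (Cyc Q W) := ⟨⟨1, fun _ => 1⟩⟩
instance : Inv (Cyc Q W) := ⟨fun a => ⟨a.q⁻¹, fun x => (a.f (a.q⁻¹ * x))⁻¹⟩⟩
lemma mul_q (a b : Cyc Q W) : (a * b).q = a.q * b.q := rfl
lemma mul_f (a b : Cyc Q W) (x : Q) : (a * b).f x = a.f (b.q * x) * b.f x := rfl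
lemma one_q : (1 : Cyc Q W).q = 1 := rfl
lemma one_f (x : Q) : (1 : Cyc Q W).f x = 1 := rfl
lemma inv_q (a : Cyc Q W) : (a⁻¹).q = a.q⁻¹ := rfl
lemma inv_f (a : Cyc Q W) (x : Q) : (a⁻¹).f x = (a.f (a.q⁻¹ * x))⁻¹ := rfl
instance : Group (Cyc Q W) := Group.ofLeftAxioms
  (by intro a b c; ext x <;> simp [mul_q, mul_f, mul_assoc])
  (by intro a; ext x <;> simp [mul_q, mul_f, one_q, one_f])
  (by intro a; ext x <;> simp [mul_q, mul_f, one_q, one_f, inv_q, inv_f])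
end Cyc

section words
open Monoid.CoprodI
variable {ι : Type*} {M M' : ι → Type*} [∀ i, Group (M i)] [∀ i, Group (M' i)]

lemma word_map_ne_one (f : ∀ i, M i →* M' i) (w : Word M) (hw : w.toList ≠ [])
    (h : ∀ l ∈ w.toList, f l.1 l.2 ≠ 1) :
    lift (fun i => (of (M := M')).comp (f i)) w.prod ≠ 1 := by
  classical
  let w' : Word M' := ⟨w.toList.map (fun l => ⟨l.1, f l.1 l.2⟩), by
      intro l hl
      obtain ⟨l0, h0, rfl⟩ := List.mem_map.1 hl
      exact h l0 h0, by
      rw [List.isChain_map]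
      exact w.chain_ne⟩
  have h1 : lift (fun i => (of (M := M')).comp (f i)) w.prod = w'.prod := by
    simp [Word.prod, w', map_list_prod, Function.comp_def]
  rw [h1]
  intro h2
  have h3 : w' = Word.empty := by
    apply (Word.equiv (M := M')).symm.injective
    change w'.prod = (Word.empty).prod
    rw [h2, Word.prod_empty]
  have : w'.toList = [] := by rw [h3]; rfl
  simp only [w', List.map_eq_nil_iff] at this
  exact hw this
end words

section frame
open Monoid.CoprodI
variable {Gs Q : Type*} [Group Gs] [Group Q]

/-- transversal data -/
structure Frame (π : Gs →* Q) (Hs : Subgroup Gs) where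
  J : Type*
  j : Q → J
  η : Q → Gs
  sJ : J → Gs
  hη : ∀ q, η q ∈ Hs
  hj : ∀ h ∈ Hs, ∀ q, j (π h * q) = j q
  hs : ∀ q, π (η q) * π (sJ (j q)) = q

variable {π : Gs →* Q} {Hs : Subgroup Gs}

noncomputable def mkFrame (π : Gs →* Q) (Hs : Subgroup Gs) (hπ : Function.Surjective π) :
    Frame π Hs :=
  have h1 : ∀ q : Q, ∃ h ∈ Hs,
      π h = q * (Quotient.mk (QuotientGroup.rightRel (Hs.map π)) q).out⁻¹ := by
    intro q
    have := Quotient.exact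
      (Quotient.out_eq (Quotient.mk (QuotientGroup.rightRel (Hs.map π)) q))
    have h2 := QuotientGroup.rightRel_apply.1 this
    exact Subgroup.mem_map.1 h2
  { J := Quotient (QuotientGroup.rightRel (Hs.map π))
    j := Quotient.mk _
    η := fun q => (h1 q).choose
    sJ := fun j => Function.surjInv hπ j.out
    hη := fun q => (h1 q).choose_spec.1
    hj := fun h hh q => by
      apply Quotient.sound
      change QuotientGroup.rightRel _ _ _
      rw [QuotientGroup.rightRel_apply]
      refine ⟨h⁻¹, Hs.inv_mem hh, by simp⟩
    hs := fun q => by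
      rw [(h1 q).choose_spec.2, Function.surjInv_eq hπ]; simp }

namespace Frame
variable (fr : Frame π Hs)

def M (i : Option fr.J) : Subgroup Gs := i.elim π.ker (fun _ => Hs ⊓ π.ker)

abbrev W : Type _ := Monoid.CoprodI (fun i => fr.M i)

def s (q : Q) : Gs := fr.η q * fr.sJ (fr.j q)

lemma π_s (q : Q) : π (fr.s q) = q := by simp [s, fr.hs]

lemma memM (h : Gs) (hh : h ∈ Hs) (q : Q) :
    (fr.η (π h * q))⁻¹ * h * fr.η q ∈ fr.M (some (fr.j q)) := by
  refine Subgroup.mem_inf.2 ⟨Hs.mul_mem (Hs.mul_mem (Hs.inv_mem (fr.hη _)) hh) (fr.hη _), ?_⟩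
  have h1 := fr.hs q
  have h2 := fr.hs (π h * q)
  rw [fr.hj h hh] at h2
  rw [MonoidHom.mem_ker, map_mul, map_mul, map_inv]
  rw [eq_mul_inv_of_mul_eq h1, eq_mul_inv_of_mul_eq h2]
  group

/-- cocycle on `Hs` -/
def k0 (h : Hs) (q : Q) : fr.W := of (M := fun i => fr.M i) (i := some (fr.j q))
  ⟨_, fr.memM h h.2 q⟩

lemma of_congr {i i' : Option fr.J} (hi : i = i') (x : fr.M i) (y : fr.M i')
    (h : (x : Gs) = y) : (of (M := fun i => fr.M i) x : fr.W) = of (M := fun i => fr.M i) y := by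
  subst hi
  congr 1
  exact Subtype.ext h

def hat : fr.W →* Gs := lift (fun i => (MulAut.conj ((i.elim 1 fr.sJ)⁻¹)).toMonoidHom.comp
  (fr.M i).subtype)

lemma k0_mul (h h' : Hs) (q : Q) : fr.k0 (h * h') q = fr.k0 h (π h' * q) * fr.k0 h' q := by
  unfold k0
  have h1 : (of (M := fun i => fr.M i) (i := some (fr.j (π h' * q)))
      ⟨_, fr.memM h h.2 (π h' * q)⟩ : fr.W) = of (M := fun i => fr.M i) (i := some (fr.j q))
        ⟨(fr.η (π h * (π h' * q)))⁻¹ * h * fr.η (π h' * q), by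
          rw [← fr.hj h' h'.2]; exact fr.memM h h.2 (π h' * q)⟩ :=
    fr.of_congr (by rw [fr.hj h' h'.2]) _ _ rfl
  rw [h1, ← map_mul]
  congr 1
  apply Subtype.ext
  simp [mul_assoc]

lemma hat_k0 (h : Hs) (q : Q) : fr.hat (fr.k0 h q) = (fr.s (π h * q))⁻¹ * h * fr.s q := by
  simp [hat, k0, s, fr.hj h h.2, mul_assoc]

/-- The hom on `Hs`. -/
def f0 : Hs →* Cyc Q fr.W where
  toFun h := ⟨π h, fr.k0 h⟩
  map_one' := by
    have : ∀ q, fr.k0 1 q = 1 := by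
      intro q
      have := fr.k0_mul 1 1 q
      simpa using this
    ext q
    · simp [Cyc.one_q]
    · simp only [this, Cyc.one_f]
  map_mul' h h' := by
    ext q
    · simp [Cyc.mul_q]
    · simp only [Cyc.mul_f, k0_mul]

lemma main (Ξ : Gs →* Cyc Q fr.W) (hq : ∀ g, (Ξ g).q = π g)
    (hΞ : ∀ h : Hs, Ξ h = fr.f0 h)
    (compat : ∀ g q, fr.hat ((Ξ g).f q) = (fr.s (π g * q))⁻¹ * g * fr.s q)
    (r : Gs) (hr : r ∈ Hs) (hr1 : π r = 1)
    (hS : SProp (π.comp Hs.subtype) ⟨r, hr⟩) : SProp π r := by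
  classical
  intro a ha ha1
  have hτne : (Ξ a).f 1 ≠ 1 := by
    intro h
    have := compat a 1
    rw [h, ha, one_mul, map_one, mul_assoc] at this
    apply ha1
    have h2 : fr.s 1 = a * fr.s 1 := by
      rw [eq_comm, inv_mul_eq_iff_eq_mul, mul_one] at this
      exact this.symm
    simpa using h2
  obtain ⟨w, hw⟩ : ∃ w : Word (fun i => fr.M i), w.prod = (Ξ a).f 1 :=
    ⟨Word.equiv _, (Word.equiv (M := fun i => fr.M i)).symm_apply_apply _⟩
  have hwne : w.toList ≠ [] := by
    intro h
    apply hτne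
    rw [← hw, Word.prod, h]; rfl
  -- finite sets for letters
  have hletter : ∀ l : Σ i, fr.M i, ∃ Φ : Set Q, Φ.Finite ∧ (l ∈ w.toList → ∀ j, l.1 = some j →
      (l.2 : Gs) ∉ Subgroup.closure {x | ∃ h ∈ Hs, π h ∉ Φ ∧ x = h * r * h⁻¹}) := by
    rintro ⟨i, m⟩
    by_cases hl : (⟨i, m⟩ : Σ i, fr.M i) ∈ w.toList
    swap
    · exact ⟨∅, Set.finite_empty, fun h => absurd h hl⟩
    rcases i with _ | j
    · exact ⟨∅, Set.finite_empty, fun _ j h => by simp at h⟩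
    have hm := m.2
    have hm1 : (m : Gs) ∈ Hs := (Subgroup.mem_inf.1 hm).1
    have hm2 : π (m : Gs) = 1 := (Subgroup.mem_inf.1 hm).2
    obtain ⟨Φ, hΦ, hn⟩ := hS ⟨m, hm1⟩ (by simpa using hm2) (by
      intro h
      apply w.ne_one _ hl
      have := congrArg Subtype.val h
      exact Subtype.ext this)
    refine ⟨Φ, hΦ, fun _ j' _ hcl => hn ?_⟩
    have hsub : Subgroup.closure {x | ∃ h ∈ Hs, π h ∉ Φ ∧ x = h * r * h⁻¹} ≤
      (Subgroup.closure {x : Hs | ∃ g, (π.comp Hs.subtype) g ∉ Φ ∧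
        x = g * ⟨r, hr⟩ * g⁻¹}).map Hs.subtype := by
      rw [Subgroup.closure_le]
      rintro x ⟨h, hh, hΦ', rfl⟩
      exact ⟨⟨h, hh⟩ * ⟨r, hr⟩ * ⟨h, hh⟩⁻¹, Subgroup.subset_closure ⟨⟨h, hh⟩, hΦ', rfl⟩, rfl⟩
    obtain ⟨y, hy, hye⟩ := hsub hcl
    have : y = ⟨m, hm1⟩ := Subtype.ext hye
    rwa [← this]
  choose Φl hΦl hΦl2 using hletter
  let J0 : Set fr.J := {j | ∃ l ∈ w.toList, l.1 = some j}
  have hJ0 : J0.Finite := by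
    have h1 : (some '' J0 : Set (Option fr.J)).Finite := by
      apply Set.Finite.subset ((w.toList.map Sigma.fst).toFinset.finite_toSet)
      rintro _ ⟨j, ⟨l, hl, e⟩, rfl⟩
      simp only [List.coe_toFinset, List.mem_map, Set.mem_ofPred_eq]
      exact ⟨l, hl, e⟩
    exact Set.Finite.of_finite_image h1 (Option.some_injective _).injOn
  let Φ0 : Set Q := ⋃ l ∈ {l | l ∈ w.toList}, Φl l
  have hΦ0 : Φ0.Finite := by
    apply Set.Finite.biUnion (List.finite_toSet _)
    intro l _
    exact hΦl l
  let bad : fr.J → Set Q := fun j => {q | j ∈ J0 ∧ q ∈ Φ0}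
  let N : ∀ i, Subgroup (fr.M i) := fun i => Subgroup.closure
    {x | ∃ j, i = some j ∧ ∃ h ∈ Hs, π h ∉ bad j ∧ (x : Gs) = h * r * h⁻¹}
  have hN : ∀ i, (N i).Normal := by
    intro i
    refine ⟨fun x hx g => ?_⟩
    have : (N i).map (MulAut.conj g).toMonoidHom ≤ N i := by
      simp only [N]
      rw [MonoidHom.map_closure, Subgroup.closure_le]
      rintro _ ⟨y, ⟨j, rfl, h, hh, hb, he⟩, rfl⟩
      have hg := Subgroup.mem_inf.1 g.2
      apply Subgroup.subset_closure
      refine ⟨j, rfl, g * h, Hs.mul_mem hg.1 hh, ?_, ?_⟩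
      · rw [map_mul, show π (g : Gs) = 1 from hg.2, one_mul]; exact hb
      · simp [he, mul_assoc]
    exact this ⟨x, hx, rfl⟩
  let P : fr.W →* Monoid.CoprodI (fun i => fr.M i ⧸ N i) :=
    lift (fun i => (of (M := fun i => fr.M i ⧸ N i)).comp (QuotientGroup.mk' (N i)))
  have hPne : P ((Ξ a).f 1) ≠ 1 := by
    rw [← hw]
    apply word_map_ne_one (M' := fun i => fr.M i ⧸ N i) (fun i => QuotientGroup.mk' (N i)) w hwne
    rintro ⟨i, m⟩ hl h1
    have h2 : m ∈ N i := by simpa using h1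
    rcases i with _ | j
    · have : N none = ⊥ := by
        simp [N]
      rw [this, Subgroup.mem_bot] at h2
      exact w.ne_one _ hl h2
    · apply hΦl2 _ hl j rfl
      have hsub : (N (some j)).map (fr.M (some j)).subtype ≤
          Subgroup.closure {x | ∃ h ∈ Hs, π h ∉ Φl ⟨some j, m⟩ ∧ x = h * r * h⁻¹} := by
        simp only [N]
        rw [MonoidHom.map_closure, Subgroup.closure_le]
        rintro _ ⟨y, ⟨j', e, h, hh, hb, he⟩, rfl⟩
        simp only [Option.some.injEq] at e
        subst e
        apply Subgroup.subset_closure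
        refine ⟨h, hh, fun hm => hb ⟨⟨_, hl, rfl⟩, ?_⟩, he⟩
        exact Set.mem_biUnion hl hm
      exact hsub ⟨m, h2, rfl⟩
  refine ⟨⋃ j ∈ J0, (fun q => (π (fr.sJ j))⁻¹ * q) '' Φ0,
    hJ0.biUnion fun j _ => hΦ0.image _, fun hcl => hPne ?_⟩
  -- the hom on ker
  let τ : π.ker →* fr.W :=
    { toFun := fun x => (Ξ x).f 1
      map_one' := by simp [Cyc.one_f]
      map_mul' := fun x y => by
        simp only [Subgroup.coe_mul, map_mul, Cyc.mul_f, hq, show π (y : Gs) = 1 from y.2, one_mul] }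
  have hle : Subgroup.closure {x | ∃ g, π g ∉ ⋃ j ∈ J0, (fun q => (π (fr.sJ j))⁻¹ * q) '' Φ0 ∧
      x = g * r * g⁻¹} ≤ ((P.comp τ).ker).map π.ker.subtype := by
    rw [Subgroup.closure_le]
    rintro x ⟨g, hg, rfl⟩
    refine ⟨⟨g * r * g⁻¹, by simp [MonoidHom.mem_ker, hr1]⟩, ?_, rfl⟩
    simp only [SetLike.mem_coe, MonoidHom.mem_ker, MonoidHom.comp_apply, τ, MonoidHom.coe_mk,
      OneHom.coe_mk, map_mul, map_inv, Cyc.mul_f, Cyc.inv_f, Cyc.inv_q, hq, mul_one, hr1, one_mul]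
    have hrr : (Ξ r).f (π g)⁻¹ = fr.k0 ⟨r, hr⟩ (π g)⁻¹ := by
      have := hΞ ⟨r, hr⟩
      simp only at this
      rw [this]; rfl
    have hP1 : P (fr.k0 ⟨r, hr⟩ (π g)⁻¹) = 1 := by
      simp only [P, k0, lift_of, MonoidHom.comp_apply, QuotientGroup.mk'_apply]
      refine (congrArg _ ((QuotientGroup.eq_one_iff _).2 ?_)).trans (map_one _)
      apply Subgroup.subset_closure
      refine ⟨_, rfl, (fr.η (π g)⁻¹)⁻¹, Hs.inv_mem (fr.hη _), ?_, by simp [hr1]⟩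
      rintro ⟨hj0, hφ⟩
      apply hg
      refine Set.mem_biUnion hj0 ⟨_, hφ, ?_⟩
      have := fr.hs (π g)⁻¹
      simp only [map_inv]
      rw [← mul_inv_rev, this, inv_inv]
    rw [hrr, hP1]; simp
  obtain ⟨y, hy, hye⟩ := hle hcl
  have : y = ⟨a, ha⟩ := Subtype.ext hye
  rw [this] at hy
  exact hy
end Frame
end frame

end OneRel

namespace OneRel

lemma SProp_transfer {G Q G' Q' : Type*} [Group G] [Group Q] [Group G'] [Group Q']
    (π : G →* Q) (π' : G' →* Q') (i : G →* G') (j : Q →* Q') (hi : Function.Injective i)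
    (hj : Function.Injective j) (hc : ∀ g, π' (i g) = j (π g)) (r : G) (r' : G')
    (hr : IsConj (i r) r') (hS : SProp π' r') : SProp π r := by
  intro a ha ha1
  obtain ⟨Φ', hΦ', hn⟩ := hS (i a) (by rw [hc, ha, map_one])
    (fun h => ha1 (hi (by rw [h, map_one])))
  obtain ⟨c, hcr⟩ := isConj_iff.1 hr
  refine ⟨j ⁻¹' ((fun x => x * π' c) '' Φ'),
    (hΦ'.image _).preimage hj.injOn, fun hcl => hn ?_⟩
  have hle : (Subgroup.closure {x | ∃ g, π g ∉ j ⁻¹' ((fun x => x * π' c) '' Φ') ∧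
      x = g * r * g⁻¹}).map i ≤ Subgroup.closure {x | ∃ g, π' g ∉ Φ' ∧ x = g * r' * g⁻¹} := by
    rw [MonoidHom.map_closure, Subgroup.closure_le]
    rintro _ ⟨y, ⟨g, hg, rfl⟩, rfl⟩
    apply Subgroup.subset_closure
    refine ⟨i g * c⁻¹, fun h => hg ⟨_, h, by simp [hc]⟩, ?_⟩
    rw [← hcr]; simp [mul_assoc]
  exact hle ⟨a, hcl, rfl⟩

open Monoid.CoprodI in
lemma SProp_HNN {H Q : Type*} [Group H] [Group Q] {A B : Subgroup H} (φ : A ≃* B)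
    (π : HNNExtension H A B φ →* Q) (hπ : Function.Surjective π)
    (hinj : ∀ a ∈ A, π (HNNExtension.of a) = 1 → a = 1) (r : H)
    (hr : π (HNNExtension.of r) = 1) (hS : SProp (π.comp HNNExtension.of) r) :
    SProp π (HNNExtension.of r) := by
  classical
  set o : H →* HNNExtension H A B φ := HNNExtension.of with ho
  have hoi : Function.Injective o := HNNExtension.of_injective φ
  let Hs : Subgroup (HNNExtension H A B φ) := o.range
  let fr := mkFrame π Hs hπ
  let p : H →* Q := π.comp o
  let tq : Q := π HNNExtension.t
  let oo : H →* Hs := o.rangeRestrict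
  have hA : ∀ a b : A, p a = p b → a = b := by
    intro a b h
    have := hinj (a⁻¹ * b) (A.mul_mem (A.inv_mem a.2) b.2) (by
      change p ((a : H)⁻¹ * b) = 1
      rw [map_mul, map_inv, h, inv_mul_cancel])
    exact Subtype.ext (inv_mul_eq_one.1 this)
  have htq : ∀ (a : A) q, tq * (p a * q) = p (φ a) * (tq * q) := by
    intro a q
    have := congrArg π (HNNExtension.t_mul_of (φ := φ) a)
    rw [map_mul, map_mul] at this
    rw [← mul_assoc, ← mul_assoc]; exact congrArg (· * q) this
  -- representatives
  let cl : Q → Quotient (QuotientGroup.rightRel (A.map p)) := Quotient.mk _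
  have hcl : ∀ (a : A) q, cl (p a * q) = cl q := by
    intro a q
    apply Quotient.sound
    change QuotientGroup.rightRel _ _ _
    rw [QuotientGroup.rightRel_apply]
    exact ⟨(a⁻¹ : A), (a⁻¹ : A).2, by simp⟩
  have h1 : ∀ q : Q, ∃ a : A, q = p a * (cl q).out := by
    intro q
    have := Quotient.exact (Quotient.out_eq (cl q))
    obtain ⟨a, ha, e⟩ := Subgroup.mem_map.1 (QuotientGroup.rightRel_apply.1 this)
    exact ⟨⟨a, ha⟩, by rw [e]; simp⟩
  choose a1 ha1 using h1
  have ha1m : ∀ (a : A) q, a1 (p a * q) = a * a1 q := by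
    intro a q
    apply hA
    have e1 := ha1 (p a * q)
    have e2 := ha1 q
    rw [hcl] at e1
    rw [Subgroup.coe_mul, map_mul]
    apply mul_right_cancel (b := (cl q).out)
    rw [← e1, mul_assoc, ← e2]
  let e0 : Q → fr.W := fun q => of (M := fun i => fr.M i) (i := none)
    ⟨(fr.s (tq * q))⁻¹ * HNNExtension.t * fr.s q, by
      change _ ∈ π.ker
      rw [MonoidHom.mem_ker]
      simp [fr.π_s, tq]⟩
  let kt : Q → fr.W := fun q => fr.k0 (oo (φ (a1 q))) (tq * (cl q).out) * e0 (cl q).out *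
    (fr.k0 (oo (a1 q)) (cl q).out)⁻¹
  have hkt : ∀ (a : A) q, kt (p a * q) * fr.k0 (oo a) q = fr.k0 (oo (φ a)) (tq * q) * kt q := by
    intro a q
    have hp : ∀ h, π (oo h : HNNExtension H A B φ) = p h := fun h => rfl
    simp only [kt, hcl, ha1m, map_mul, Subgroup.coe_mul, fr.k0_mul, hp]
    rw [← htq, ← ha1]
    simp [mul_assoc]
  let Ξ : HNNExtension H A B φ →* Cyc Q fr.W := HNNExtension.lift (fr.f0.comp oo) ⟨tq, kt⟩ (by
    intro a
    ext q
    · have := htq a 1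
      simp only [mul_one] at this
      exact this
    · exact hkt a q)
  have hq : ∀ g, (Ξ g).q = π g := by
    intro g
    induction g using HNNExtension.induction_on with
    | of g => simp only [Ξ, HNNExtension.lift_of]; rfl
    | t => simp only [Ξ, HNNExtension.lift_t]; rfl
    | mul x y hx hy => rw [map_mul, map_mul, Cyc.mul_q, hx, hy]
    | inv x hx => rw [map_inv, map_inv, Cyc.inv_q, hx]
  have compat : ∀ g q, fr.hat ((Ξ g).f q) = (fr.s (π g * q))⁻¹ * g * fr.s q := by
    intro g
    induction g using HNNExtension.induction_on with
    | of g =>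
      intro q
      simp only [Ξ, HNNExtension.lift_of]
      exact fr.hat_k0 (oo g) q
    | t =>
      intro q
      simp only [Ξ, HNNExtension.lift_t]
      have e3 : fr.hat (e0 (cl q).out) =
          (fr.s (tq * (cl q).out))⁻¹ * HNNExtension.t * fr.s (cl q).out := by
        simp [Frame.hat, e0]
      simp only [kt, map_mul, map_inv, fr.hat_k0, e3]
      have hp : ∀ h, π (oo h : HNNExtension H A B φ) = p h := fun h => rfl
      rw [hp, hp, ← htq, ← ha1]
      have h5 := HNNExtension.equiv_eq_conj (φ := φ) (a1 q)
      have h6 : ∀ h, (oo h : HNNExtension H A B φ) = HNNExtension.of h := fun h => rfl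
      rw [h6, h6, h5]
      simp [tq, mul_assoc]
    | mul x y hx hy =>
      intro q
      rw [map_mul, Cyc.mul_f, map_mul, hx, hy, hq, map_mul]
      simp [mul_assoc]
    | inv x hx =>
      intro q
      rw [map_inv, Cyc.inv_f, map_inv, hx, hq, map_inv]
      simp [mul_assoc]
  refine fr.main Ξ hq ?_ compat (o r) ⟨r, rfl⟩ hr ?_
  · rintro ⟨_, h, rfl⟩
    simp only [Ξ]
    exact HNNExtension.lift_of _ _ _ _
  · let eq := (MonoidHom.ofInjective hoi)
    refine SProp_transfer (π.comp Hs.subtype) (π.comp o) eq.symm.toMonoidHom (MonoidHom.id Q)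
      eq.symm.injective Function.injective_id ?_ _ r ?_ hS
    · rintro ⟨_, h, rfl⟩
      have : eq.symm ⟨o h, ⟨h, rfl⟩⟩ = h := eq.symm_apply_apply h
      simp [this]
    · have : eq.symm ⟨o r, ⟨r, rfl⟩⟩ = r := eq.symm_apply_apply r
      change IsConj (eq.symm ⟨o r, ⟨r, rfl⟩⟩) r
      rw [this]

open Monoid.CoprodI in
/-- Free product version with a free group. -/
lemma SProp_Coprod {H Q Y : Type*} [Group H] [Group Q]
    (π : Monoid.Coprod H (FreeGroup Y) →* Q) (hπ : Function.Surjective π) (r : H)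
    (hr : π (Monoid.Coprod.inl r) = 1) (hS : SProp (π.comp Monoid.Coprod.inl) r) :
    SProp π (Monoid.Coprod.inl r) := by
  classical
  set o : H →* Monoid.Coprod H (FreeGroup Y) := Monoid.Coprod.inl with ho
  have hoi : Function.Injective o := Monoid.Coprod.inl_injective
  let Hs : Subgroup (Monoid.Coprod H (FreeGroup Y)) := o.range
  let fr := mkFrame π Hs hπ
  let oo : H →* Hs := o.rangeRestrict
  let ty : Y → Monoid.Coprod H (FreeGroup Y) := fun y => Monoid.Coprod.inr (FreeGroup.of y)
  let e0 : Y → Q → fr.W := fun y q => of (M := fun i => fr.M i) (i := none)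
    ⟨(fr.s (π (ty y) * q))⁻¹ * ty y * fr.s q, by
      change _ ∈ π.ker
      rw [MonoidHom.mem_ker]
      simp [fr.π_s]⟩
  let Ξ : Monoid.Coprod H (FreeGroup Y) →* Cyc Q fr.W := Monoid.Coprod.lift (fr.f0.comp oo)
    (FreeGroup.lift fun y => ⟨π (ty y), e0 y⟩)
  have hind : ∀ P : Monoid.Coprod H (FreeGroup Y) → Prop, (∀ h, P (o h)) → (∀ y, P (ty y)) →
      (∀ x y, P x → P y → P (x * y)) → (∀ x, P x → P x⁻¹) → ∀ g, P g := by
    intro P h1 h2 h3 h4 g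
    induction g using Monoid.Coprod.induction_on with
    | inl x => exact h1 x
    | inr x =>
      induction x using FreeGroup.induction_on with
      | C1 => simpa using h1 1
      | of y => exact h2 y
      | inv_of y hy => rw [map_inv]; exact h4 _ hy
      | mul x y hx hy => rw [map_mul]; exact h3 _ _ hx hy
    | mul x y hx hy => exact h3 _ _ hx hy
  have hΞo : ∀ h, Ξ (o h) = fr.f0 (oo h) := by intro h; simp [Ξ, ho]
  have hΞt : ∀ y, Ξ (ty y) = ⟨π (ty y), e0 y⟩ := by intro h; simp [Ξ, ty]
  have hq : ∀ g, (Ξ g).q = π g := by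
    apply hind
    · intro h; rw [hΞo]; rfl
    · intro y; rw [hΞt]
    · intro x y hx hy
      rw [map_mul, map_mul, Cyc.mul_q, hx, hy]
    · intro x hx; rw [map_inv, map_inv, Cyc.inv_q, hx]
  have compat : ∀ g q, fr.hat ((Ξ g).f q) = (fr.s (π g * q))⁻¹ * g * fr.s q := by
    apply hind
    · intro g q
      rw [hΞo]
      exact fr.hat_k0 (oo g) q
    · intro y q
      rw [hΞt]
      simp [Frame.hat, e0]
    · intro x y hx hy q
      rw [map_mul, Cyc.mul_f, map_mul, hx, hy, hq, map_mul]
      simp [mul_assoc]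
    · intro x hx q
      rw [map_inv, Cyc.inv_f, map_inv, hx, hq, map_inv]
      simp [mul_assoc]
  refine fr.main Ξ hq ?_ compat (o r) ⟨r, rfl⟩ hr ?_
  · rintro ⟨_, h, rfl⟩
    exact hΞo h
  · let eq := (MonoidHom.ofInjective hoi)
    refine SProp_transfer (π.comp Hs.subtype) (π.comp o) eq.symm.toMonoidHom (MonoidHom.id Q)
      eq.symm.injective Function.injective_id ?_ _ r ?_ hS
    · rintro ⟨_, h, rfl⟩
      have : eq.symm ⟨o h, ⟨h, rfl⟩⟩ = h := eq.symm_apply_apply h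
      simp [this]
    · have : eq.symm ⟨o r, ⟨r, rfl⟩⟩ = r := eq.symm_apply_apply r
      change IsConj (eq.symm ⟨o r, ⟨r, rfl⟩⟩) r
      rw [this]

end OneRel

namespace OneRel

open FreeGroup (of)

section words
variable {X Y : Type}

noncomputable def wd (R : FreeGroup X) : List (X × Bool) := @FreeGroup.toWord X (Classical.decEq X) R

noncomputable def nrm (R : FreeGroup X) : ℕ := (wd R).length

lemma mk_wd (R : FreeGroup X) : FreeGroup.mk (wd R) = R :=
  @FreeGroup.mk_toWord X (Classical.decEq X) R

lemma nrm_mk_le (L : List (X × Bool)) : nrm (FreeGroup.mk L) ≤ L.length :=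
  @FreeGroup.norm_mk_le X L (Classical.decEq X)

lemma nrm_mul_le (a b : FreeGroup X) : nrm (a * b) ≤ nrm a + nrm b :=
  @FreeGroup.norm_mul_le X (Classical.decEq X) a b

lemma nrm_eq_zero (a : FreeGroup X) : nrm a = 0 ↔ a = 1 :=
  @FreeGroup.norm_eq_zero X (Classical.decEq X) a

lemma nrm_map_le (f : X → Y) (R : FreeGroup X) : nrm (FreeGroup.map f R) ≤ nrm R := by
  conv_lhs => rw [← mk_wd R, FreeGroup.map.mk]
  exact (nrm_mk_le _).trans (by simp [nrm])

/-- subgroup generated by a set of letters -/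
def gen (s : Set X) : Subgroup (FreeGroup X) := Subgroup.closure (FreeGroup.of '' s)

lemma gen_mono {s t : Set X} (h : s ⊆ t) : gen s ≤ gen t :=
  Subgroup.closure_mono (Set.image_mono h)

lemma of_mem_gen {s : Set X} {x : X} (h : x ∈ s) : of x ∈ gen s :=
  Subgroup.subset_closure ⟨x, h, rfl⟩

lemma mk_mem_gen (s : Set X) (L : List (X × Bool)) (h : ∀ l ∈ L, l.1 ∈ s) :
    FreeGroup.mk L ∈ gen s := by
  induction L with
  | nil => exact (gen s).one_mem
  | cons a L ih =>
    have h1 : FreeGroup.mk (a :: L) = FreeGroup.mk [a] * FreeGroup.mk L := by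
      rw [FreeGroup.mul_mk]; rfl
    rw [h1]
    refine (gen s).mul_mem ?_ (ih fun l hl => h l (List.mem_cons_of_mem _ hl))
    have ha := of_mem_gen (h a List.mem_cons_self)
    rcases a with ⟨x, _ | _⟩
    · have : FreeGroup.mk [(x, false)] = (of x)⁻¹ := by simp [FreeGroup.of, FreeGroup.invRev]
      rw [this]; exact (gen s).inv_mem ha
    · exact ha

lemma map_gen {G : Type*} [Group G] (f : FreeGroup X →* G) (s : Set X) (K : Subgroup G)
    (h : ∀ x ∈ s, f (of x) ∈ K) (w : FreeGroup X) (hw : w ∈ gen s) : f w ∈ K := by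
  have : gen s ≤ K.comap f := by
    rw [gen, Subgroup.closure_le]
    rintro _ ⟨x, hx, rfl⟩
    exact h x hx
  exact this hw

lemma mem_gen_wd (s : Set X) (R : FreeGroup X) (h : ∀ l ∈ wd R, l.1 ∈ s) : R ∈ gen s := by
  rw [← mk_wd R]; exact mk_mem_gen s _ h

open Classical in
/-- projection to letters in `s` -/
noncomputable def proj (s : Set X) : FreeGroup X →* FreeGroup s :=
  FreeGroup.lift fun x => if h : x ∈ s then of ⟨x, h⟩ else 1

noncomputable def incl (s : Set X) : FreeGroup s →* FreeGroup X := FreeGroup.map Subtype.val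

lemma incl_of (s : Set X) (x : s) : incl s (of x) = of (x : X) := by simp [incl]

lemma incl_inj (s : Set X) : Function.Injective (incl s) :=
  FreeGroup.map_injective Subtype.val_injective

lemma incl_mem (s : Set X) (w : FreeGroup s) : incl s w ∈ gen s := by
  refine map_gen (incl s) Set.univ (gen s) ?_ w ?_
  · intro x _; rw [incl_of]; exact of_mem_gen x.2
  · exact mem_gen_wd _ _ (fun _ _ => trivial)

lemma proj_incl (s : Set X) (w : FreeGroup s) : proj s (incl s w) = w := by
  have : (proj s).comp (incl s) = MonoidHom.id _ := by
    ext x; simp [proj, incl]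
  exact DFunLike.congr_fun this w

lemma gen_eq_range (s : Set X) : gen s = (incl s).range := by
  apply le_antisymm
  · rw [gen, Subgroup.closure_le]
    rintro _ ⟨x, hx, rfl⟩
    exact ⟨of ⟨x, hx⟩, by simp [incl]⟩
  · rintro _ ⟨w, rfl⟩; exact incl_mem s w

lemma incl_proj_of_mem (s : Set X) (w : FreeGroup X) (hw : w ∈ gen s) :
    incl s (proj s w) = w := by
  rw [gen_eq_range] at hw
  obtain ⟨u, rfl⟩ := hw
  rw [proj_incl]

lemma proj_mk (s : Set X) (L : List (X × Bool)) : ∃ L' : List (s × Bool),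
    proj s (FreeGroup.mk L) = FreeGroup.mk L' ∧ L'.length ≤ L.length ∧
      ((∃ l ∈ L, l.1 ∉ s) → L'.length < L.length) := by
  classical
  induction L with
  | nil => exact ⟨[], by rw [← FreeGroup.one_eq_mk, map_one, ← FreeGroup.one_eq_mk], le_rfl, by simp⟩
  | cons a L ih =>
    obtain ⟨L', e, h1, h2⟩ := ih
    have h3 : FreeGroup.mk (a :: L) = FreeGroup.mk [a] * FreeGroup.mk L := by
      rw [FreeGroup.mul_mk]; rfl
    by_cases ha : a.1 ∈ s
    · refine ⟨(⟨a.1, ha⟩, a.2) :: L', ?_, by simpa using h1, ?_⟩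
      · rw [h3, map_mul, e]
        have : proj s (FreeGroup.mk [a]) = FreeGroup.mk [(⟨a.1, ha⟩, a.2)] := by
          rcases a with ⟨x, _ | _⟩ <;> simp [proj, ha] <;> rfl
        rw [this, FreeGroup.mul_mk]; rfl
      · rintro ⟨l, hl, hls⟩
        rcases List.mem_cons.1 hl with rfl | hl
        · exact absurd ha hls
        · simpa using h2 ⟨l, hl, hls⟩
    · refine ⟨L', ?_, by simp; omega, fun _ => by simp; omega⟩
      rw [h3, map_mul, e]
      have : proj s (FreeGroup.mk [a]) = 1 := by
        rcases a with ⟨x, _ | _⟩ <;> simp [proj, ha]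
      rw [this, one_mul]

lemma nrm_proj_le (s : Set X) (R : FreeGroup X) : nrm (proj s R) ≤ nrm R := by
  obtain ⟨L', e, h1, _⟩ := proj_mk s (wd R)
  rw [mk_wd] at e
  rw [e]
  exact (nrm_mk_le _).trans h1

lemma nrm_proj_lt (s : Set X) (R : FreeGroup X) (h : ∃ l ∈ wd R, l.1 ∉ s) :
    nrm (proj s R) < nrm R := by
  obtain ⟨L', e, _, h2⟩ := proj_mk s (wd R)
  rw [mk_wd] at e
  rw [e]
  exact (nrm_mk_le _).trans_lt (h2 h)

/-- `R` is conjugate into the subgroup generated by `s`. -/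
def CI (s : Set X) (R : FreeGroup X) : Prop := ∃ u ∈ gen s, IsConj R u

lemma CI.mono {s t : Set X} (h : s ⊆ t) {R : FreeGroup X} (hR : CI s R) : CI t R := by
  obtain ⟨u, hu, hc⟩ := hR
  exact ⟨u, gen_mono h hu, hc⟩

lemma CI.conj {s : Set X} {R R' : FreeGroup X} (h : IsConj R R') (hR : CI s R) : CI s R' := by
  obtain ⟨u, hu, hc⟩ := hR
  exact ⟨u, hu, h.symm.trans hc⟩

lemma CI.isConj_proj {s : Set X} {R : FreeGroup X} (h : CI s R) :
    IsConj R (incl s (proj s R)) := by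
  obtain ⟨u, hu, hc⟩ := h
  have h1 : IsConj (incl s (proj s R)) (incl s (proj s u)) :=
    ((incl s).comp (proj s)).map_isConj hc
  rw [incl_proj_of_mem s u hu] at h1
  exact hc.trans h1.symm

def MinC (R : FreeGroup X) : Prop := ∀ R', IsConj R R' → nrm R ≤ nrm R'

lemma exists_minC (R : FreeGroup X) : ∃ R', IsConj R R' ∧ MinC R' := by
  classical
  have hex : ∃ k, ∃ R', IsConj R R' ∧ nrm R' = k := ⟨_, R, IsConj.refl _, rfl⟩
  obtain ⟨R', hc, hk⟩ := Nat.find_spec hex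
  refine ⟨R', hc, fun R'' h => ?_⟩
  rw [hk]
  exact Nat.find_min' hex ⟨R'', hc.trans h, rfl⟩

lemma MinC.not_CI {R : FreeGroup X} (h : MinC R) (s : Set X) (hs : ∃ l ∈ wd R, l.1 ∉ s) :
    ¬ CI s R := by
  intro hc
  have h1 := h _ hc.isConj_proj
  have h2 := nrm_proj_lt s R hs
  have h3 := nrm_map_le (Subtype.val : s → X) (proj s R)
  change nrm (incl s (proj s R)) ≤ _ at h3
  omega

lemma MinC.mem_of_CI {R : FreeGroup X} (h : MinC R) (s : Set X) (hs : CI s R) :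
    ∀ l ∈ wd R, l.1 ∈ s := by
  by_contra hc
  push Not at hc
  exact h.not_CI s hc hs

end words

section main
variable {X Y : Type}

/-- normal closure of `R^n` -/
abbrev NN (R : FreeGroup X) (n : ℕ) : Subgroup (FreeGroup X) := Subgroup.normalClosure {R ^ n}

abbrev Gq (R : FreeGroup X) (n : ℕ) : Type := FreeGroup X ⧸ NN R n

lemma pow_mem_NN (R : FreeGroup X) (n : ℕ) : R ^ n ∈ NN R n :=
  Subgroup.subset_normalClosure (Set.mem_singleton (R ^ n))

lemma mem_NN1 (R : FreeGroup X) : R ∈ NN R 1 := by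
  have := pow_mem_NN R 1
  rwa [pow_one] at this

lemma NN_le (R : FreeGroup X) (n : ℕ) : NN R n ≤ NN R 1 := by
  apply Subgroup.normalClosure_le_normal
  rw [Set.singleton_subset_iff]
  exact Subgroup.pow_mem _ (mem_NN1 R) n

def pq (R : FreeGroup X) (n : ℕ) : Gq R n →* Gq R 1 :=
  QuotientGroup.map _ _ (MonoidHom.id _) (NN_le R n)

def NonPow (R : FreeGroup X) : Prop := ∀ (S : FreeGroup X) (k : ℕ), 1 ≤ k → R = S ^ k → k = 1

structure Main (R : FreeGroup X) : Prop where
  frei : ∀ x, ¬ CI {x}ᶜ R → ∀ w ∈ gen {x}ᶜ, w ∈ NN R 1 → w = 1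
  tf : NonPow R → ∀ (w : FreeGroup X) (m : ℕ), 1 ≤ m → w ^ m ∈ NN R 1 → w ∈ NN R 1
  sep : ∀ n, 1 ≤ n → SProp (pq R n) (QuotientGroup.mk R)

lemma NN_conj {R R' : FreeGroup X} (h : IsConj R R') (n : ℕ) : NN R n = NN R' n := by
  have key : ∀ R R' : FreeGroup X, IsConj R R' → NN R n ≤ NN R' n := by
    intro R R' h
    apply Subgroup.normalClosure_le_normal
    rw [Set.singleton_subset_iff]
    obtain ⟨c, hc⟩ := isConj_iff.1 h.symm
    rw [← hc, conj_pow]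
    exact Subgroup.Normal.conj_mem inferInstance _ (pow_mem_NN R' n) c
  exact le_antisymm (key _ _ h) (key _ _ h.symm)

lemma NonPow.conj {R R' : FreeGroup X} (h : IsConj R R') (hR : NonPow R) : NonPow R' := by
  intro S k hk e
  obtain ⟨c, hc⟩ := isConj_iff.1 h.symm
  refine hR (c * S * c⁻¹) k hk ?_
  rw [conj_pow, ← e, hc]

lemma SProp_of_hom {G' Q' : Type*} [Group G'] [Group Q'] (π' : G' →* Q') (r' : G')
    (R : FreeGroup X) (n : ℕ) (f : FreeGroup X →* G') (f1 : FreeGroup X →* Q')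
    (hf : ∀ w, π' (f w) = f1 w) (hk : f.ker = NN R n) (hk1 : f1.ker = NN R 1)
    (hr : IsConj (f R) r') (hS : SProp π' r') : SProp (pq R n) (QuotientGroup.mk R) := by
  let i : Gq R n →* G' := QuotientGroup.lift _ f (fun w hw => by
    rw [← hk] at hw; exact hw)
  let j : Gq R 1 →* Q' := QuotientGroup.lift _ f1 (fun w hw => by
    rw [← hk1] at hw; exact hw)
  refine SProp_transfer (pq R n) π' i j ?_ ?_ ?_ _ r' hr hS
  · rw [injective_iff_map_eq_one]
    intro a
    induction a using QuotientGroup.induction_on with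
    | H a =>
      intro h
      rw [QuotientGroup.eq_one_iff, ← hk]
      exact h
  · rw [injective_iff_map_eq_one]
    intro a
    induction a using QuotientGroup.induction_on with
    | H a =>
      intro h
      rw [QuotientGroup.eq_one_iff, ← hk1]
      exact h
  · intro a
    induction a using QuotientGroup.induction_on with
    | H a => exact hf a

lemma sep_pull {R : FreeGroup X} {R' : FreeGroup Y} (θ : FreeGroup X →* FreeGroup Y)
    (h : ∀ n, 1 ≤ n → (NN R' n).comap θ = NN R n) (hc : IsConj (θ R) R') (n : ℕ) (hn : 1 ≤ n)
    (hS : SProp (pq R' n) (QuotientGroup.mk R')) : SProp (pq R n) (QuotientGroup.mk R) := by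
  refine SProp_of_hom (pq R' n) _ R n ((QuotientGroup.mk' _).comp θ)
    ((QuotientGroup.mk' _).comp θ) (fun w => rfl) ?_ ?_ ?_ hS
  · rw [← h n hn]; ext w; simp [MonoidHom.mem_ker]
  · rw [← h 1 le_rfl]; ext w; simp [MonoidHom.mem_ker]
  · exact (QuotientGroup.mk' (NN R' n)).map_isConj hc

lemma Main.conj {R R' : FreeGroup X} (h : IsConj R R') (hM : Main R) : Main R' where
  frei x hx w hw hN := hM.frei x (fun hc => hx (hc.conj h)) w hw (by rwa [NN_conj h])
  tf hR w m hm hw := by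
    rw [← NN_conj h] at *
    exact hM.tf (hR.conj h.symm) w m hm hw
  sep n hn := by
    refine sep_pull (R' := R) (MonoidHom.id _) ?_ h.symm n hn (hM.sep n hn)
    intro n _; rw [NN_conj h]; rfl

lemma NN_map_equiv (e : X ≃ Y) (R : FreeGroup X) (n : ℕ) :
    (NN (FreeGroup.map e R) n).comap (FreeGroup.map e) = NN R n := by
  apply le_antisymm
  · intro w hw
    have h1 : ∀ v ∈ NN (FreeGroup.map e R) n, FreeGroup.map e.symm v ∈ NN R n := by
      intro v hv
      have : NN (FreeGroup.map e R) n ≤ (NN R n).comap (FreeGroup.map e.symm) := by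
        apply Subgroup.normalClosure_le_normal
        rw [Set.singleton_subset_iff]
        rw [SetLike.mem_coe, Subgroup.mem_comap]
        rw [map_pow, FreeGroup.map.comp]
        simpa [FreeGroup.map.id] using pow_mem_NN R n
      exact this hv
    have := h1 _ hw
    rw [FreeGroup.map.comp] at this
    simpa [FreeGroup.map.id] using this
  · apply Subgroup.normalClosure_le_normal
    rw [Set.singleton_subset_iff]
    rw [SetLike.mem_coe, Subgroup.mem_comap]
    rw [map_pow]
    exact pow_mem_NN _ n

lemma map_gen_equiv (e : X ≃ Y) (x : X) (w : FreeGroup X) (hw : w ∈ gen {x}ᶜ) :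
    FreeGroup.map e w ∈ gen {e x}ᶜ := by
  refine map_gen (FreeGroup.map e) {x}ᶜ _ ?_ w hw
  intro y hy
  rw [FreeGroup.map.of]
  apply of_mem_gen
  simpa using hy

lemma CI_equiv (e : X ≃ Y) (x : X) (R : FreeGroup X) (h : CI {x}ᶜ R) :
    CI {e x}ᶜ (FreeGroup.map e R) := by
  obtain ⟨u, hu, hc⟩ := h
  exact ⟨_, map_gen_equiv e x u hu, (FreeGroup.map e).map_isConj hc⟩

lemma map_symm_map (e : X ≃ Y) (w : FreeGroup Y) :
    FreeGroup.map e (FreeGroup.map e.symm w) = w := by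
  rw [FreeGroup.map.comp]; simp [FreeGroup.map.id]

lemma map_map_symm (e : X ≃ Y) (w : FreeGroup X) :
    FreeGroup.map e.symm (FreeGroup.map e w) = w := by
  rw [FreeGroup.map.comp]; simp [FreeGroup.map.id]

lemma NonPow.map {R : FreeGroup X} (e : X ≃ Y) (h : NonPow R) : NonPow (FreeGroup.map e R) := by
  intro S k hk hS
  refine h (FreeGroup.map e.symm S) k hk ?_
  rw [← map_pow, ← hS, map_map_symm]

lemma CI_equiv_iff (e : X ≃ Y) (x : X) (R : FreeGroup X) :
    CI {e x}ᶜ (FreeGroup.map e R) ↔ CI {x}ᶜ R := by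
  refine ⟨fun h => ?_, CI_equiv e x R⟩
  have := CI_equiv e.symm _ _ h
  rwa [map_map_symm, e.symm_apply_apply] at this

lemma Main.of_map (e : X ≃ Y) {R : FreeGroup X} (hM : Main (FreeGroup.map e R)) : Main R where
  frei x hx w hw hN := by
    have := hM.frei (e x) (fun h => hx ((CI_equiv_iff e x R).1 h)) _ (map_gen_equiv e x w hw) (by
      rw [← NN_map_equiv e] at hN; exact hN)
    have h2 := congrArg (FreeGroup.map e.symm) this
    rwa [map_map_symm, map_one] at h2
  tf hR w m hm hw := by
    rw [← NN_map_equiv e] at *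
    refine hM.tf (hR.map e) (FreeGroup.map e w) m hm ?_
    rw [← map_pow]; exact hw
  sep n hn := sep_pull (FreeGroup.map e) (fun n _ => NN_map_equiv e R n) (IsConj.refl _) n hn
    (hM.sep n hn)

end main
end OneRel

namespace OneRel

open FreeGroup (of)
variable {X : Type}

lemma free_pow_eq_one {Y : Type} (a : FreeGroup Y) (k : ℕ) (hk : 1 ≤ k) (h : a ^ k = 1) :
    a = 1 := by
  have := IsMulTorsionFree.pow_left_injective (M := FreeGroup Y) (n := k) (by omega)
  exact this (by simpa using h)

lemma NN_le_ker {G : Type*} [Group G] (f : FreeGroup X →* G) (R : FreeGroup X) (n : ℕ)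
    (h : f R ^ n = 1) : NN R n ≤ f.ker := by
  apply Subgroup.normalClosure_le_normal
  rw [Set.singleton_subset_iff, SetLike.mem_coe, MonoidHom.mem_ker, map_pow, h]

lemma mk_pow_eq_one (R : FreeGroup X) (n : ℕ) : (QuotientGroup.mk R : Gq R n) ^ n = 1 := by
  rw [← QuotientGroup.mk_pow, QuotientGroup.eq_one_iff]
  exact pow_mem_NN R n

lemma main_base (x : X) (m : ℤ) (hm : m ≠ 0) : Main (of x ^ m) := by
  classical
  set R : FreeGroup X := of x ^ m with hR
  have hpx : proj ({x}ᶜ : Set X) (of x) = 1 := by simp [proj]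
  refine ⟨?_, ?_, ?_⟩
  · intro z hz w hw hN
    have hzx : z = x := by
      by_contra hne
      refine hz ⟨R, Subgroup.zpow_mem _ (of_mem_gen ?_) m, IsConj.refl _⟩
      simpa using fun h => hne h.symm
    subst hzx
    have h1 : w ∈ (proj ({z}ᶜ : Set X)).ker := NN_le_ker _ R 1 (by simp [hR, hpx]) hN
    rw [← incl_proj_of_mem _ w hw, MonoidHom.mem_ker.1 h1, map_one]
  · intro hnp w k hk hw
    have hm1 : m.natAbs = 1 := by
      apply hnp (of x ^ m.sign) m.natAbs (by omega)
      rw [← zpow_natCast, ← zpow_mul, Int.sign_mul_natAbs]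
    have hx : of x ∈ NN R 1 := by
      have h1 := mem_NN1 R
      rcases Int.natAbs_eq_iff.1 hm1 with h | h
      · have : R = of x := by rw [hR, h]; simp
        rw [this] at h1; rw [this]; exact h1
      · have : R = (of x)⁻¹ := by rw [hR, h]; simp
        have h2 := (NN R 1).inv_mem h1
        nth_rewrite 2 [this] at h2
        rwa [inv_inv] at h2
    have h1 : w ^ k ∈ (proj ({x}ᶜ : Set X)).ker := NN_le_ker _ R 1 (by simp [hR, hpx]) hw
    rw [MonoidHom.mem_ker, map_pow] at h1
    have h2 := free_pow_eq_one _ k hk h1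
    have h3 : ((QuotientGroup.mk' (NN R 1)).comp ((incl ({x}ᶜ : Set X)).comp (proj _))) =
        QuotientGroup.mk' (NN R 1) := by
      ext y
      by_cases hy : y = x
      · subst hy
        simp only [MonoidHom.comp_apply, hpx, map_one]
        exact ((QuotientGroup.eq_one_iff _).2 hx).symm
      · simp [proj, hy, incl_of]
    have h4 := DFunLike.congr_fun h3 w
    simp only [MonoidHom.comp_apply, h2, map_one] at h4
    exact (QuotientGroup.eq_one_iff w).1 h4.symm
  · intro n hn
    let u : FreeGroup Unit := of ()
    let Ru : FreeGroup Unit := u ^ m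
    let Gs : ℕ → Type := fun n => Monoid.Coprod (Gq Ru n) (FreeGroup ({x}ᶜ : Set X))
    let π : Monoid.Coprod (Gq Ru n) (FreeGroup ({x}ᶜ : Set X)) →*
      Monoid.Coprod (Gq Ru 1) (FreeGroup ({x}ᶜ : Set X)) :=
        Monoid.Coprod.map (pq Ru n) (MonoidHom.id _)
    let f : ∀ n, FreeGroup X →* Monoid.Coprod (Gq Ru n) (FreeGroup ({x}ᶜ : Set X)) := fun n =>
      FreeGroup.lift fun y => if h : y ∈ ({x}ᶜ : Set X) then Monoid.Coprod.inr (of ⟨y, h⟩)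
        else Monoid.Coprod.inl (QuotientGroup.mk u)
    let g : ∀ n, Monoid.Coprod (Gq Ru n) (FreeGroup ({x}ᶜ : Set X)) →* Gq R n := fun n =>
      Monoid.Coprod.lift (QuotientGroup.lift _
        ((QuotientGroup.mk' (NN R n)).comp (FreeGroup.lift fun _ => of x)) (by
          intro w hw
          refine NN_le_ker _ Ru n ?_ hw
          simp only [MonoidHom.comp_apply, Ru, u, map_zpow, FreeGroup.lift_apply_of]
          rw [← map_zpow]
          exact mk_pow_eq_one R n))
        ((QuotientGroup.mk' (NN R n)).comp (incl _))
    have hfx : ∀ n, f n (of x) = Monoid.Coprod.inl (QuotientGroup.mk u) := by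
      intro n; simp [f]
    have hgf : ∀ n, (g n).comp (f n) = QuotientGroup.mk' (NN R n) := by
      intro n
      ext y
      by_cases hy : y = x
      · subst hy
        simp only [MonoidHom.comp_apply, hfx]
        simp [g, u]
      · simp [f, g, hy, incl_of]
    have hfR : ∀ n, f n R = Monoid.Coprod.inl (QuotientGroup.mk Ru) := by
      intro n
      rw [hR, map_zpow, hfx, ← map_zpow]; rfl
    have hker : ∀ n, (f n).ker = NN R n := by
      intro n
      apply le_antisymm
      · intro w hw
        have := DFunLike.congr_fun (hgf n) w
        rw [MonoidHom.comp_apply, MonoidHom.mem_ker.1 hw, map_one] at this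
        exact (QuotientGroup.eq_one_iff w).1 this.symm
      · apply NN_le_ker
        rw [hfR, ← map_pow, mk_pow_eq_one, map_one]
    have hfin : Finite (Gq Ru n) := by
      have hfo : IsOfFinOrder (QuotientGroup.mk u : Gq Ru n) := by
        rw [isOfFinOrder_iff_zpow_eq_one]
        refine ⟨m * n, mul_ne_zero hm (by omega), ?_⟩
        rw [zpow_mul, zpow_natCast, ← QuotientGroup.mk_zpow]
        exact mk_pow_eq_one Ru n
      have hfz : Finite (Subgroup.zpowers (QuotientGroup.mk u : Gq Ru n)) :=
        hfo.finite_zpowers.to_subtype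
      have htop : Subgroup.zpowers (QuotientGroup.mk u : Gq Ru n) = ⊤ := by
        rw [eq_top_iff]
        intro a _
        induction a using QuotientGroup.induction_on with
        | H a =>
          refine map_gen (QuotientGroup.mk' (NN Ru n)) Set.univ _ ?_ a
            (mem_gen_wd _ _ fun _ _ => trivial)
          intro y _
          exact Subgroup.mem_zpowers _
      rw [htop] at hfz
      exact Finite.of_equiv _ (Subgroup.topEquiv (G := Gq Ru n)).toEquiv
    refine SProp_of_hom π (Monoid.Coprod.inl (QuotientGroup.mk Ru)) R n (f n) (f 1) ?_ (hker n)
      (hker 1) (by rw [hfR]; exact IsConj.refl _) ?_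
    · intro w
      have : π.comp (f n) = f 1 := by
        ext y
        by_cases hy : y = x
        · subst hy
          simp only [MonoidHom.comp_apply, hfx]
          simp only [π, Monoid.Coprod.map_apply_inl]; rfl
        · simp [f, π, hy]
      exact DFunLike.congr_fun this w
    · apply SProp_Coprod
      · intro y
        have : Function.Surjective (pq Ru n) := by
          intro a
          induction a using QuotientGroup.induction_on with
          | H a => exact ⟨QuotientGroup.mk a, rfl⟩
        induction y using Monoid.Coprod.induction_on with
        | inl a =>
          obtain ⟨b, rfl⟩ := this a
          exact ⟨Monoid.Coprod.inl b, by simp [π]⟩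
        | inr a => exact ⟨Monoid.Coprod.inr a, by simp [π]⟩
        | mul a b ha hb =>
          obtain ⟨a', rfl⟩ := ha
          obtain ⟨b', rfl⟩ := hb
          exact ⟨a' * b', by simp⟩
      · simp only [π, Monoid.Coprod.map_apply_inl]
        have : pq Ru n (QuotientGroup.mk Ru) = 1 := (QuotientGroup.eq_one_iff _).2 (mem_NN1 Ru)
        rw [this, map_one]
      · intro a _ ha
        refine ⟨Set.range (π.comp Monoid.Coprod.inl), Set.finite_range _, ?_⟩
        have : {y | ∃ g, (π.comp Monoid.Coprod.inl) g ∉ Set.range (π.comp Monoid.Coprod.inl) ∧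
            y = g * (QuotientGroup.mk Ru : Gq Ru n) * g⁻¹} = ∅ := by
          ext y
          simp
        rw [this]
        simpa using ha

end OneRel

namespace OneRel

open FreeGroup (of)

lemma SProp_comp_inj {G Q Q' : Type*} [Group G] [Group Q] [Group Q'] (π : G →* Q) (j : Q →* Q')
    (hj : Function.Injective j) (r : G) (hS : SProp π r) : SProp (j.comp π) r := by
  intro a ha ha1
  obtain ⟨Φ, hΦ, h⟩ := hS a (hj (by simpa using ha)) ha1
  refine ⟨j '' Φ, hΦ.image j, fun hm => h (Subgroup.closure_mono ?_ hm)⟩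
  rintro x ⟨g, hg, rfl⟩
  exact ⟨g, fun hc => hg ⟨_, hc, rfl⟩, rfl⟩

lemma exists_list_of_mem_gen {X : Type} (s : Set X) (w : FreeGroup X) (hw : w ∈ gen s) :
    ∃ L : List (X × Bool), FreeGroup.mk L = w ∧ ∀ l ∈ L, l.1 ∈ s := by
  refine ⟨(wd (proj s w)).map fun p => (p.1.1, p.2), ?_, ?_⟩
  · have h := incl_proj_of_mem s w hw
    have h2 : incl s (FreeGroup.mk (wd (proj s w))) = w := by rw [mk_wd, h]
    rwa [incl, FreeGroup.map.mk] at h2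
  · intro l hl
    obtain ⟨p, _, rfl⟩ := List.mem_map.1 hl
    exact p.1.2

open Classical in
/-- exponent sum -/
noncomputable def ex {X : Type} (x : X) : FreeGroup X →* Multiplicative ℤ :=
  FreeGroup.lift fun y => if y = x then Multiplicative.ofAdd 1 else 1

section lam
variable {Y : Type}

abbrev tt (Y : Type) : FreeGroup (Option Y) := of none

noncomputable def lam (Y : Type) : FreeGroup (Y × ℤ) →* FreeGroup (Option Y) :=
  FreeGroup.lift fun p => tt Y ^ p.2 * of (some p.1) * (tt Y ^ p.2)⁻¹

lemma lam_of (p : Y × ℤ) : lam Y (of p) = tt Y ^ p.2 * of (some p.1) * (tt Y ^ p.2)⁻¹ := by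
  simp [lam]

lemma ex_tt : ex none (tt Y) = Multiplicative.ofAdd 1 := by simp [ex]

lemma ex_lam (u : FreeGroup (Y × ℤ)) : ex none (lam Y u) = 1 := by
  have : (ex none).comp (lam Y) = 1 := by
    ext p; simp [lam, ex]
  exact DFunLike.congr_fun this u

/-- shift of the index -/
noncomputable def shf (k : ℤ) : FreeGroup (Y × ℤ) →* FreeGroup (Y × ℤ) :=
  FreeGroup.map fun p => (p.1, p.2 + k)

lemma lam_shf (k : ℤ) (u : FreeGroup (Y × ℤ)) :
    lam Y (shf k u) = tt Y ^ k * lam Y u * (tt Y ^ k)⁻¹ := by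
  have : (lam Y).comp (shf k) = (MulAut.conj (tt Y ^ k)).toMonoidHom.comp (lam Y) := by
    ext p
    simp only [MonoidHom.comp_apply, shf, FreeGroup.map.of, lam_of]
    simp only [MulEquiv.toMonoidHom_eq_coe, MonoidHom.coe_coe, MulAut.conj_apply]
    rw [add_comm, zpow_add]; group
  exact DFunLike.congr_fun this u

def cnt (L : List (Option Y × Bool)) : ℕ := (L.filter fun l => l.1.isSome).length

lemma lam_decomp (L : List (Option Y × Bool)) : ∃ (u : FreeGroup (Y × ℤ)) (k : ℤ),
    FreeGroup.mk L = lam Y u * tt Y ^ k ∧ nrm u ≤ cnt L ∧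
      u ∈ gen {p : Y × ℤ | ∃ b, (some p.1, b) ∈ L} := by
  induction L with
  | nil => exact ⟨1, 0, by rw [← FreeGroup.one_eq_mk]; simp, by simp [(nrm_eq_zero _).2],
      Subgroup.one_mem _⟩
  | cons a L ih =>
    obtain ⟨u, k, e, h1, h2⟩ := ih
    have h3 : FreeGroup.mk (a :: L) = FreeGroup.mk [a] * FreeGroup.mk L := by
      rw [FreeGroup.mul_mk]; rfl
    have hm : gen {p : Y × ℤ | ∃ b, (some p.1, b) ∈ L} ≤
        gen {p : Y × ℤ | ∃ b, (some p.1, b) ∈ a :: L} := by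
      apply gen_mono
      rintro p ⟨b, hb⟩
      exact ⟨b, List.mem_cons_of_mem _ hb⟩
    rcases a with ⟨_ | z, b⟩
    · obtain ⟨s, hs⟩ : ∃ s : ℤ, FreeGroup.mk [((none : Option Y), b)] = tt Y ^ s := by
        cases b
        · exact ⟨-1, by simp [FreeGroup.of, FreeGroup.invRev]⟩
        · exact ⟨1, by simp [FreeGroup.of]⟩
      refine ⟨shf s u, s + k, ?_, ?_, ?_⟩
      · rw [h3, e, lam_shf, hs, zpow_add]; group
      · refine (nrm_map_le _ _).trans ?_
        simpa [cnt] using h1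
      · refine map_gen (shf s) _ _ ?_ u h2
        rintro p ⟨b, hb⟩
        rw [shf, FreeGroup.map.of]
        exact of_mem_gen ⟨b, List.mem_cons_of_mem _ hb⟩
    · have hz : lam Y (FreeGroup.mk [((z, 0), b)]) = FreeGroup.mk [(some z, b)] := by
        cases b
        · have e1 : FreeGroup.mk [((z, (0:ℤ)), false)] = (of (z, 0))⁻¹ := by
            simp [FreeGroup.of, FreeGroup.invRev]
          have e2 : FreeGroup.mk [(some z, false)] = (of (some z))⁻¹ := by
            simp [FreeGroup.of, FreeGroup.invRev]
          rw [e1, e2, map_inv, lam_of]; simp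
        · have e1 : FreeGroup.mk [((z, (0:ℤ)), true)] = of (z, 0) := rfl
          rw [e1, lam_of]; simp [FreeGroup.of]
      refine ⟨FreeGroup.mk [((z, 0), b)] * u, k, ?_, ?_, ?_⟩
      · rw [h3, e, map_mul, hz, mul_assoc]
      · refine (nrm_mul_le _ _).trans ?_
        have := nrm_mk_le [((z, (0:ℤ)), b)]
        simp only [List.length_singleton] at this
        simp only [cnt, List.filter_cons, Option.isSome_some, if_true, List.length_cons]
        simp only [cnt] at h1
        omega
      · refine Subgroup.mul_mem _ (mk_mem_gen _ _ ?_) (hm h2)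
        intro l hl
        simp only [List.mem_singleton] at hl
        subst hl
        exact ⟨b, List.mem_cons_self⟩

lemma lam_inj_of_gen {w : FreeGroup (Option Y)} {s : Set Y} (hw : w ∈ gen {o | ∀ z, o = some z → z ∈ s}) :
    ∃ (u : FreeGroup (Y × ℤ)) (k : ℤ), w = lam Y u * tt Y ^ k ∧ u ∈ gen {p : Y × ℤ | p.1 ∈ s} := by
  obtain ⟨L, rfl, hL⟩ := exists_list_of_mem_gen _ _ hw
  obtain ⟨u, k, e, _, h⟩ := lam_decomp L
  refine ⟨u, k, e, gen_mono ?_ h⟩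
  rintro p ⟨b, hb⟩
  exact hL _ hb _ rfl

end lam

section core
variable {Y : Type} (x0 : Y) (lo : ℤ) (d : ℕ)

def L0 : Set (Y × ℤ) := {p | p.1 ≠ x0 ∨ (lo ≤ p.2 ∧ p.2 ≤ lo + d)}
def LA : Set (Y × ℤ) := {p | p.1 ≠ x0 ∨ (lo ≤ p.2 ∧ p.2 < lo + d)}

lemma lo_mem (z : Y) : (z, lo) ∈ L0 x0 lo d := Or.inr ⟨le_rfl, by simp⟩

def hiL : L0 x0 lo d := ⟨(x0, lo + d), Or.inr ⟨by simp, le_rfl⟩⟩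
def loL : L0 x0 lo d := ⟨(x0, lo), lo_mem x0 lo d x0⟩

def iA (p : LA x0 lo d) : L0 x0 lo d := ⟨p.1, p.2.imp id fun h => ⟨h.1, h.2.le⟩⟩
def iB (p : LA x0 lo d) : L0 x0 lo d :=
  ⟨(p.1.1, p.1.2 + 1), p.2.imp id fun h => ⟨by have := h.1; dsimp only; omega, by have := h.2; dsimp only; omega⟩⟩

lemma iA_inj : Function.Injective (iA x0 lo d) := by
  intro p q h
  simpa [iA, Subtype.ext_iff] using h

lemma iB_inj : Function.Injective (iB x0 lo d) := by
  intro p q h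
  have h2 := congrArg Subtype.val h
  simp only [iB, Prod.mk.injEq, add_left_inj] at h2
  exact Subtype.ext (Prod.ext h2.1 h2.2)

variable (R : FreeGroup (L0 x0 lo d)) (n : ℕ)

noncomputable def al : FreeGroup (LA x0 lo d) →* Gq R n :=
  (QuotientGroup.mk' _).comp (FreeGroup.map (iA x0 lo d))
noncomputable def be : FreeGroup (LA x0 lo d) →* Gq R n :=
  (QuotientGroup.mk' _).comp (FreeGroup.map (iB x0 lo d))

structure Hyp : Prop where
  main : Main R
  hi : ¬ CI {hiL x0 lo d}ᶜ R
  lo : ¬ CI {loL x0 lo d}ᶜ R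

variable {x0 lo d R}

lemma univ_gen {X : Type} (w : FreeGroup X) : w ∈ gen Set.univ := mem_gen_wd _ _ fun _ _ => trivial

lemma Hyp.al_inj (h : Hyp x0 lo d R) : Function.Injective (al x0 lo d R n) := by
  rw [injective_iff_map_eq_one]
  intro w hw
  have h1 : FreeGroup.map (iA x0 lo d) w ∈ NN R n := (QuotientGroup.eq_one_iff _).1 hw
  have h2 := h.main.frei _ h.hi _ ?_ (NN_le R n h1)
  · exact FreeGroup.map_injective (iA_inj x0 lo d) (by simpa using h2)
  · refine map_gen _ Set.univ _ ?_ w (univ_gen w)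
    intro p _
    rw [FreeGroup.map.of]
    apply of_mem_gen
    intro hc
    have h3 := congrArg Subtype.val (Set.mem_singleton_iff.1 hc)
    simp only [iA, hiL] at h3
    rcases p.2 with h4 | h4
    · exact h4 (by rw [h3])
    · rw [h3] at h4; simp at h4

lemma Hyp.be_inj (h : Hyp x0 lo d R) : Function.Injective (be x0 lo d R n) := by
  rw [injective_iff_map_eq_one]
  intro w hw
  have h1 : FreeGroup.map (iB x0 lo d) w ∈ NN R n := (QuotientGroup.eq_one_iff _).1 hw
  have h2 := h.main.frei _ h.lo _ ?_ (NN_le R n h1)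
  · exact FreeGroup.map_injective (iB_inj x0 lo d) (by simpa using h2)
  · refine map_gen _ Set.univ _ ?_ w (univ_gen w)
    intro p _
    rw [FreeGroup.map.of]
    apply of_mem_gen
    intro hc
    have h3 := congrArg Subtype.val (Set.mem_singleton_iff.1 hc)
    simp only [iB, loL, Prod.mk.injEq] at h3
    rcases p.2 with h4 | h4
    · exact h4 h3.1
    · have := h4.1; omega

noncomputable def Hyp.phi (h : Hyp x0 lo d R) (n : ℕ) :
    (al x0 lo d R n).range ≃* (be x0 lo d R n).range :=
  (MonoidHom.ofInjective (h.al_inj n)).symm.trans (MonoidHom.ofInjective (h.be_inj n))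

abbrev Hyp.HN (h : Hyp x0 lo d R) (n : ℕ) : Type := HNNExtension (Gq R n) _ _ (h.phi n)

noncomputable def Hyp.oo (h : Hyp x0 lo d R) (n : ℕ) : FreeGroup (L0 x0 lo d) →* h.HN n :=
  HNNExtension.of.comp (QuotientGroup.mk' _)

noncomputable def Hyp.t (h : Hyp x0 lo d R) (n : ℕ) : h.HN n := HNNExtension.t

lemma Hyp.t_rel (h : Hyp x0 lo d R) (n : ℕ) (p : LA x0 lo d) :
    h.t n * h.oo n (of (iA x0 lo d p)) = h.oo n (of (iB x0 lo d p)) * h.t n := by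
  have h1 := HNNExtension.t_mul_of (φ := h.phi n) ⟨al x0 lo d R n (of p), ⟨_, rfl⟩⟩
  have h2 : h.phi n ⟨al x0 lo d R n (of p), ⟨_, rfl⟩⟩ = ⟨be x0 lo d R n (of p), ⟨_, rfl⟩⟩ := by
    have h3 : (⟨al x0 lo d R n (of p), ⟨_, rfl⟩⟩ : (al x0 lo d R n).range) =
      MonoidHom.ofInjective (h.al_inj n) (of p) := rfl
    rw [h3, Hyp.phi, MulEquiv.trans_apply, MulEquiv.symm_apply_apply]; rfl
  rw [h2] at h1
  exact h1

noncomputable def Hyp.f (h : Hyp x0 lo d R) (n : ℕ) : FreeGroup (Option Y) →* h.HN n :=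
  FreeGroup.lift fun o => match o with
    | none => h.t n
    | some z => (h.t n ^ lo)⁻¹ * h.oo n (of ⟨(z, lo), lo_mem x0 lo d z⟩) * h.t n ^ lo

lemma Hyp.f_tt (h : Hyp x0 lo d R) (n : ℕ) : h.f n (tt Y) = h.t n := by simp [Hyp.f]
lemma Hyp.f_some (h : Hyp x0 lo d R) (n : ℕ) (z : Y) : h.f n (of (some z)) =
    (h.t n ^ lo)⁻¹ * h.oo n (of ⟨(z, lo), lo_mem x0 lo d z⟩) * h.t n ^ lo := by simp [Hyp.f]

lemma Hyp.step (h : Hyp x0 lo d R) (n : ℕ) (z : Y) (j : ℤ) (hj : (z, j) ∈ L0 x0 lo d)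
    (hj1 : (z, j + 1) ∈ L0 x0 lo d) :
    (h.t n ^ (j + 1))⁻¹ * h.oo n (of ⟨(z, j + 1), hj1⟩) * h.t n ^ (j + 1) =
    (h.t n ^ j)⁻¹ * h.oo n (of ⟨(z, j), hj⟩) * h.t n ^ j := by
  have hA : (z, j) ∈ LA x0 lo d := by
    rcases hj with h1 | h1
    · exact Or.inl h1
    · rcases hj1 with h2 | h2
      · exact Or.inl h2
      · exact Or.inr ⟨h1.1, by have := h2.2; dsimp only at *; omega⟩
  have h1 := h.t_rel n ⟨(z, j), hA⟩
  have h2 : h.oo n (of ⟨(z, j + 1), hj1⟩) = h.t n * h.oo n (of ⟨(z, j), hj⟩) * (h.t n)⁻¹ := by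
    rw [eq_mul_inv_iff_mul_eq]; exact h1.symm
  rw [h2, zpow_add_one]; group

lemma Hyp.const (h : Hyp x0 lo d R) (n : ℕ) (p : L0 x0 lo d) :
    h.f n (of (some p.1.1)) = (h.t n ^ p.1.2)⁻¹ * h.oo n (of p) * h.t n ^ p.1.2 := by
  obtain ⟨⟨z, j⟩, hp⟩ := p
  have up : ∀ (k : ℕ) (hk : (z, lo + k) ∈ L0 x0 lo d), h.f n (of (some z)) =
      (h.t n ^ (lo + k))⁻¹ * h.oo n (of ⟨(z, lo + k), hk⟩) * h.t n ^ (lo + k) := by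
    intro k
    induction k with
    | zero => intro hk; rw [h.f_some]; simp
    | succ k ih =>
      intro hk
      have hk' : (z, lo + (k : ℤ)) ∈ L0 x0 lo d := by
        rcases hk with h1 | h1
        · exact Or.inl h1
        · exact Or.inr ⟨by dsimp only; omega, by have := h1.2; dsimp only at *; push_cast at this; omega⟩
      have hk1 : (z, lo + (k : ℤ) + 1) ∈ L0 x0 lo d := by
        convert hk using 2; push_cast; ring
      rw [ih hk', ← h.step n z _ hk' hk1]
      simp only [Nat.cast_succ, add_assoc]
  have dn : ∀ (hz : z ≠ x0) (k : ℕ), h.f n (of (some z)) =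
      (h.t n ^ (lo - k))⁻¹ * h.oo n (of ⟨(z, lo - k), Or.inl hz⟩) * h.t n ^ (lo - k) := by
    intro hz k
    induction k with
    | zero => rw [h.f_some]; simp
    | succ k ih =>
      have := h.step n z (lo - (k + 1 : ℕ)) (Or.inl hz) (Or.inl hz)
      rw [← this, ih]
      have e : lo - ((k + 1 : ℕ) : ℤ) + 1 = lo - k := by push_cast; ring
      simp only [e]
  by_cases hj : lo ≤ j
  · obtain ⟨k, hk⟩ := Int.eq_ofNat_of_zero_le (sub_nonneg.2 hj)
    obtain rfl : j = lo + k := by omega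
    exact up k hp
  · have hz : z ≠ x0 := by
      rcases hp with h1 | h1
      · exact h1
      · exact absurd h1.1 hj
    obtain ⟨k, hk⟩ := Int.eq_ofNat_of_zero_le (sub_nonneg.2 (not_le.1 hj).le)
    obtain rfl : j = lo - k := by omega
    exact dn hz k

lemma Hyp.f_lam (h : Hyp x0 lo d R) (n : ℕ) (w : FreeGroup (L0 x0 lo d)) :
    h.f n (lam Y (incl _ w)) = h.oo n w := by
  have : (h.f n).comp ((lam Y).comp (incl _)) = h.oo n := by
    ext p
    simp only [MonoidHom.comp_apply, incl_of, lam_of, map_mul, map_inv, map_zpow, h.f_tt, h.const]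
    group
  exact DFunLike.congr_fun this w

variable (R) in
noncomputable def R0 : FreeGroup (Option Y) := lam Y (incl _ R)

noncomputable def Hyp.g (h : Hyp x0 lo d R) (n : ℕ) : h.HN n →* Gq (R0 R) n :=
  HNNExtension.lift (QuotientGroup.lift _ ((QuotientGroup.mk' _).comp ((lam Y).comp (incl _)))
    (NN_le_ker _ R n (mk_pow_eq_one (R0 R) n))) (QuotientGroup.mk (tt Y)) (by
      rintro ⟨_, ⟨w, rfl⟩⟩
      have h2 : h.phi n ⟨al x0 lo d R n w, ⟨_, rfl⟩⟩ = ⟨be x0 lo d R n w, ⟨_, rfl⟩⟩ := by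
        have h3 : (⟨al x0 lo d R n w, ⟨_, rfl⟩⟩ : (al x0 lo d R n).range) =
          MonoidHom.ofInjective (h.al_inj n) w := rfl
        rw [h3, Hyp.phi, MulEquiv.trans_apply, MulEquiv.symm_apply_apply]; rfl
      rw [h2]
      simp only [al, be, MonoidHom.comp_apply, QuotientGroup.mk'_apply, QuotientGroup.lift_mk]
      rw [← QuotientGroup.mk_mul, ← QuotientGroup.mk_mul]
      congr 1
      have h4 : incl _ (FreeGroup.map (iB x0 lo d) w) = shf 1 (incl _ (FreeGroup.map (iA x0 lo d) w)) := by
        have : (incl _).comp (FreeGroup.map (iB x0 lo d)) = (shf 1).comp ((incl _).comp (FreeGroup.map (iA x0 lo d))) := by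
          ext p
          simp [incl, shf, iA, iB]
        exact DFunLike.congr_fun this w
      rw [h4, lam_shf]; group)

lemma Hyp.g_f (h : Hyp x0 lo d R) (n : ℕ) : (h.g n).comp (h.f n) = QuotientGroup.mk' _ := by
  ext o
  rcases o with _ | z
  · simp [h.f_tt, Hyp.g, Hyp.t]
  · simp only [MonoidHom.comp_apply, h.f_some, map_mul, map_inv, map_zpow]
    simp only [Hyp.g, Hyp.t, Hyp.oo, MonoidHom.comp_apply, HNNExtension.lift_t, HNNExtension.lift_of,
      QuotientGroup.mk'_apply, QuotientGroup.lift_mk, incl_of, lam_of]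
    rw [← QuotientGroup.mk_zpow, ← QuotientGroup.mk_inv, ← QuotientGroup.mk_mul, ← QuotientGroup.mk_mul]
    congr 1
    group

lemma Hyp.ker_f (h : Hyp x0 lo d R) (n : ℕ) : (h.f n).ker = NN (R0 R) n := by
  apply le_antisymm
  · intro w hw
    have := DFunLike.congr_fun (h.g_f n) w
    rw [MonoidHom.comp_apply, MonoidHom.mem_ker.1 hw, map_one] at this
    exact (QuotientGroup.eq_one_iff w).1 this.symm
  · apply NN_le_ker
    rw [R0, h.f_lam, Hyp.oo, MonoidHom.comp_apply, ← map_pow]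
    rw [QuotientGroup.mk'_apply, mk_pow_eq_one, map_one]

lemma Hyp.oo_eq_one (h : Hyp x0 lo d R) (n : ℕ) (w : FreeGroup (L0 x0 lo d)) (hw : h.oo n w = 1) :
    w ∈ NN R n := by
  have := HNNExtension.of_injective (φ := h.phi n) (a₁ := QuotientGroup.mk w) (a₂ := 1)
    (by rw [map_one]; exact hw)
  exact (QuotientGroup.eq_one_iff w).1 this

lemma Hyp.lam_mem (h : Hyp x0 lo d R) (n : ℕ) (w : FreeGroup (L0 x0 lo d))
    (hw : lam Y (incl _ w) ∈ NN (R0 R) n) : w ∈ NN R n := by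
  rw [← h.ker_f, MonoidHom.mem_ker, h.f_lam] at hw
  exact h.oo_eq_one n w hw

lemma Hyp.concl_a (h : Hyp x0 lo d R) (w : FreeGroup (Option Y)) (hw : w ∈ gen {some x0}ᶜ)
    (hN : w ∈ NN (R0 R) 1) : w = 1 := by
  obtain ⟨u, k, rfl, hu⟩ := lam_inj_of_gen (s := {x0}ᶜ) (gen_mono (by
    intro o ho z hz hc
    rw [Set.mem_singleton_iff] at hc
    exact ho (by rw [hz, hc]; rfl)) hw)
  have hk : NN (R0 R) 1 ≤ (ex none).ker := by
    apply NN_le_ker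
    rw [R0, ex_lam, one_pow]
  have hk1 := hk hN
  rw [MonoidHom.mem_ker, map_mul, ex_lam, one_mul, map_zpow, ex_tt, ← ofAdd_zsmul] at hk1
  obtain rfl : k = 0 := by simpa using hk1
  rw [zpow_zero, mul_one] at *
  have hsub : {p : Y × ℤ | p.1 ∈ ({x0}ᶜ : Set Y)} ⊆ L0 x0 lo d := fun p hp => Or.inl hp
  rw [← incl_proj_of_mem _ u (gen_mono hsub hu)] at hN ⊢
  have h1 := h.lam_mem 1 _ hN
  have h2 := h.main.frei _ h.hi _ ?_ h1
  · rw [h2, map_one, map_one]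
  · refine map_gen _ _ _ ?_ u hu
    intro p hp
    have : proj (L0 x0 lo d) (of p) = of ⟨p, hsub hp⟩ := by
      have := proj_incl (L0 x0 lo d) (of ⟨p, hsub hp⟩)
      rwa [incl_of] at this
    rw [this]
    apply of_mem_gen
    intro hc
    have h3 := congrArg Subtype.val (Set.mem_singleton_iff.1 hc)
    simp only [hiL] at h3
    exact hp (by rw [h3]; rfl)

lemma gen_none (w : FreeGroup (Option Y)) (hw : w ∈ gen {none}ᶜ) :
    ∃ v : FreeGroup Y, w = FreeGroup.map some v := by
  have : gen ({none}ᶜ : Set (Option Y)) ≤ (FreeGroup.map (some : Y → Option Y)).range := by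
    rw [gen, Subgroup.closure_le]
    rintro _ ⟨o, ho, rfl⟩
    rcases o with _ | z
    · exact absurd rfl ho
    · exact ⟨of z, by simp⟩
  obtain ⟨v, hv⟩ := this hw
  exact ⟨v, hv.symm⟩

lemma Hyp.concl_d (h : Hyp x0 lo d R) (hC : ¬ CI {none}ᶜ (R0 R)) (w : FreeGroup (Option Y))
    (hw : w ∈ gen {none}ᶜ) (hN : w ∈ NN (R0 R) 1) : w = 1 := by
  obtain ⟨v, rfl⟩ := gen_none w hw
  let q : Y → L0 x0 lo d := fun z => ⟨(z, lo), lo_mem x0 lo d z⟩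
  have hq : ∀ v : FreeGroup Y, lam Y (incl _ (FreeGroup.map q v)) =
      tt Y ^ lo * FreeGroup.map some v * (tt Y ^ lo)⁻¹ := by
    intro v
    have : (lam Y).comp ((incl _).comp (FreeGroup.map q)) =
        (MulAut.conj (tt Y ^ lo)).toMonoidHom.comp (FreeGroup.map some) := by
      ext z
      simp only [MonoidHom.comp_apply, FreeGroup.map.of, incl_of, lam_of, q]
      rfl
    exact DFunLike.congr_fun this v
  have h1 : FreeGroup.map q v ∈ NN R 1 := by
    apply h.lam_mem
    rw [hq]
    exact Subgroup.Normal.conj_mem inferInstance _ hN _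
  have hnc : ¬ CI {p : L0 x0 lo d | p.1.2 = lo} R := by
    rintro ⟨u, hu, hc⟩
    apply hC
    have : gen {p : L0 x0 lo d | p.1.2 = lo} ≤ (FreeGroup.map q).range := by
      rw [gen, Subgroup.closure_le]
      rintro _ ⟨⟨⟨z, j⟩, hp⟩, hj, rfl⟩
      obtain rfl : j = lo := hj
      exact ⟨of z, by simp [q]⟩
    obtain ⟨v', rfl⟩ := this hu
    refine ⟨FreeGroup.map some v', ?_, ?_⟩
    · refine map_gen _ Set.univ _ ?_ v' (univ_gen _)
      intro z _
      rw [FreeGroup.map.of]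
      exact of_mem_gen (by simp)
    · have h2 := ((lam Y).comp (incl _)).map_isConj hc
      refine IsConj.trans h2 ?_
      rw [MonoidHom.comp_apply, hq]
      exact (isConj_iff.2 ⟨tt Y ^ lo, rfl⟩).symm
  obtain ⟨R', hc, hmin⟩ := exists_minC R
  have h3 : ∃ l ∈ wd R', l.1.1.2 ≠ lo := by
    by_contra hcon
    push Not at hcon
    exact hnc ⟨R', mem_gen_wd _ _ hcon, hc⟩
  obtain ⟨l, hl, hlo⟩ := h3
  have h4 : ¬ CI {l.1}ᶜ R := fun hh => hmin.not_CI {l.1}ᶜ ⟨l, hl, by simp⟩ (hh.conj hc)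
  have h5 := h.main.frei _ h4 _ ?_ h1
  · have hqi : Function.Injective q := by
      intro a b hab
      have := congrArg Subtype.val hab
      simpa [q] using this
    have := FreeGroup.map_injective hqi (a₁ := v) (a₂ := 1) (by simpa using h5)
    rw [this, map_one]
  · refine map_gen _ Set.univ _ ?_ v (univ_gen _)
    intro z _
    rw [FreeGroup.map.of]
    apply of_mem_gen
    intro hcc
    rw [Set.mem_singleton_iff] at hcc
    exact hlo (by rw [← hcc])

lemma Hyp.concl_tf (h : Hyp x0 lo d R) (hR : NonPow (R0 R)) (w : FreeGroup (Option Y)) (m : ℕ)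
    (hm : 1 ≤ m) (hw : w ^ m ∈ NN (R0 R) 1) : w ∈ NN (R0 R) 1 := by
  have hR' : NonPow R := by
    intro S k hk e
    refine hR (lam Y (incl _ S)) k hk ?_
    rw [R0, ← map_pow, ← map_pow, ← e]
  rw [← h.ker_f, MonoidHom.mem_ker, map_pow] at hw
  obtain ⟨a, ha⟩ := torsion_elliptic _ _ m hm hw
  induction a using QuotientGroup.induction_on with
  | H v =>
    obtain ⟨c, hc⟩ := isConj_iff.1 ha
    have h1 : h.oo 1 (v ^ m) = 1 := by
      rw [map_pow]
      change (HNNExtension.of (QuotientGroup.mk v)) ^ m = 1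
      rw [← hc, conj_pow, hw]; simp
    have h2 := h.main.tf hR' v m hm (h.oo_eq_one 1 _ h1)
    rw [(QuotientGroup.eq_one_iff v).2 h2, map_one] at hc
    rw [← h.ker_f, MonoidHom.mem_ker]
    have := congrArg (fun z => c⁻¹ * z * c) hc
    simpa [mul_assoc] using this

lemma Hyp.concl_sep (h : Hyp x0 lo d R) (n : ℕ) (hn : 1 ≤ n) :
    SProp (pq (R0 R) n) (QuotientGroup.mk (R0 R)) := by
  have hpq : ∀ w, pq R n (al x0 lo d R n w) = al x0 lo d R 1 w := fun w => rfl
  have hpq' : ∀ w, pq R n (be x0 lo d R n w) = be x0 lo d R 1 w := fun w => rfl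
  have hphi : ∀ (n : ℕ) (w), h.phi n ⟨al x0 lo d R n w, ⟨_, rfl⟩⟩ = ⟨be x0 lo d R n w, ⟨_, rfl⟩⟩ := by
    intro n w
    have h3 : (⟨al x0 lo d R n w, ⟨_, rfl⟩⟩ : (al x0 lo d R n).range) =
      MonoidHom.ofInjective (h.al_inj n) w := rfl
    rw [h3, Hyp.phi, MulEquiv.trans_apply, MulEquiv.symm_apply_apply]; rfl
  let π : h.HN n →* h.HN 1 := HNNExtension.lift (HNNExtension.of.comp (pq R n)) HNNExtension.t (by
    rintro ⟨_, ⟨w, rfl⟩⟩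
    rw [hphi]
    simp only [MonoidHom.comp_apply, hpq, hpq']
    have := HNNExtension.t_mul_of (φ := h.phi 1) ⟨al x0 lo d R 1 w, ⟨_, rfl⟩⟩
    rw [hphi] at this
    exact this)
  have hπof : ∀ a, π (HNNExtension.of a) = HNNExtension.of (pq R n a) := by
    intro a; simp [π]
  have hπf : ∀ w, π (h.f n w) = h.f 1 w := by
    intro w
    have : π.comp (h.f n) = h.f 1 := by
      have ht : π (h.t n) = h.t 1 := by simp [π, Hyp.t]
      ext o
      rcases o with _ | z
      · simp [h.f_tt, ht]
      · simp only [MonoidHom.comp_apply, h.f_some, map_mul, map_inv, map_zpow, ht]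
        simp only [Hyp.oo, MonoidHom.comp_apply, hπof]
        rfl
    exact DFunLike.congr_fun this w
  have hpqs : Function.Surjective (pq R n) := by
    intro a
    induction a using QuotientGroup.induction_on with
    | H a => exact ⟨QuotientGroup.mk a, rfl⟩
  refine SProp_of_hom π (HNNExtension.of (QuotientGroup.mk R)) (R0 R) n (h.f n) (h.f 1) hπf
    (h.ker_f n) (h.ker_f 1) (by rw [R0, h.f_lam]; exact IsConj.refl _) ?_
  have hR1 : pq R n (QuotientGroup.mk R) = 1 := by
    change (QuotientGroup.mk R : Gq R 1) = 1
    rw [QuotientGroup.eq_one_iff]; exact mem_NN1 R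
  apply SProp_HNN
  · intro y
    induction y using HNNExtension.induction_on with
    | of a => obtain ⟨b, rfl⟩ := hpqs a; exact ⟨HNNExtension.of b, hπof b⟩
    | t => exact ⟨HNNExtension.t, by simp [π]⟩
    | mul a b ha hb =>
      obtain ⟨a, rfl⟩ := ha; obtain ⟨b, rfl⟩ := hb
      exact ⟨a * b, map_mul _ _ _⟩
    | inv a ha => obtain ⟨a, rfl⟩ := ha; exact ⟨a⁻¹, map_inv _ _⟩
  · rintro _ ⟨w, rfl⟩ hw
    rw [hπof, hpq] at hw
    have h1 := HNNExtension.of_injective (φ := h.phi 1) (a₁ := al x0 lo d R 1 w)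
      (a₂ := 1) (by rw [map_one]; exact hw)
    have h2 := h.al_inj 1 (a₁ := w) (a₂ := 1) (by rw [map_one]; exact h1)
    rw [h2, map_one]
  · rw [hπof, hR1, map_one]
  · have : π.comp HNNExtension.of = HNNExtension.of.comp (pq R n) := by
      exact MonoidHom.ext hπof
    rw [this]
    exact SProp_comp_inj _ _ (HNNExtension.of_injective (φ := h.phi 1)) _ (h.main.sep n hn)

end core
end OneRel

namespace OneRel

open FreeGroup (of)

lemma incl_gen {X : Type} (s : Set X) (r : Set s) (w : FreeGroup s) (hw : w ∈ gen r) :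
    incl s w ∈ gen (Subtype.val '' r) := by
  refine map_gen (incl s) r _ ?_ w hw
  intro x hx
  rw [incl_of]
  exact of_mem_gen ⟨x, hx, rfl⟩

lemma sep_conj {X : Type} {R R' : FreeGroup X} (h : IsConj R R') (n : ℕ) (hn : 1 ≤ n)
    (hS : SProp (pq R n) (QuotientGroup.mk R)) : SProp (pq R' n) (QuotientGroup.mk R') :=
  sep_pull (R' := R) (MonoidHom.id _) (fun n _ => by rw [NN_conj h]; rfl) h.symm n hn hS

structure StepC {X : Type} (R : FreeGroup X) : Prop where
  tf : NonPow R → ∀ (w : FreeGroup X) (m : ℕ), 1 ≤ m → w ^ m ∈ NN R 1 → w ∈ NN R 1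
  sep : ∀ n, 1 ≤ n → SProp (pq R n) (QuotientGroup.mk R)

def Frei {X : Type} (x : X) (R : FreeGroup X) : Prop := ∀ w ∈ gen {x}ᶜ, w ∈ NN R 1 → w = 1

lemma step {Y : Type} (L : List (Option Y × Bool)) (x0 : Y) (hex : ex none (FreeGroup.mk L) = 1)
    (hC : ¬ CI {some x0}ᶜ (FreeGroup.mk L))
    (IH : ∀ (X' : Type) (R' : FreeGroup X'), R' ≠ 1 → nrm R' ≤ cnt L → Main R') :
    StepC (FreeGroup.mk L) ∧ Frei (some x0) (FreeGroup.mk L) ∧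
      (¬ CI {none}ᶜ (FreeGroup.mk L) → Frei none (FreeGroup.mk L)) := by
  classical
  obtain ⟨u, k, e, hnu, -⟩ := lam_decomp L
  have hk : k = 0 := by
    rw [e, map_mul, ex_lam, one_mul, map_zpow, ex_tt, ← ofAdd_zsmul] at hex
    simpa using hex
  subst hk
  rw [zpow_zero, mul_one] at e
  have hlamC : ∀ (s : Set (Y × ℤ)), (∀ p ∈ s, p.1 ≠ x0) → ¬ CI s u := by
    rintro s hs ⟨v, hv, hc⟩
    apply hC
    rw [e]
    refine ⟨lam Y v, ?_, (lam Y).map_isConj hc⟩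
    refine map_gen _ _ _ ?_ v hv
    intro p hp
    rw [lam_of]
    have ht : tt Y ^ p.2 ∈ gen ({some x0}ᶜ : Set (Option Y)) :=
      Subgroup.zpow_mem _ (of_mem_gen (by simp)) _
    exact Subgroup.mul_mem _ (Subgroup.mul_mem _ ht (of_mem_gen (by simpa using hs p hp)))
      (Subgroup.inv_mem _ ht)
  have hd : ∃ d : ℕ, ∃ lo : ℤ, CI (L0 x0 lo d) u := by
    obtain ⟨N, hN⟩ : ∃ N : ℕ, ∀ l ∈ wd u, l.1.2.natAbs ≤ N := by
      refine ⟨((wd u).map fun l => l.1.2.natAbs).sum, fun l hl => ?_⟩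
      exact List.single_le_sum (by simp) _ (List.mem_map_of_mem hl)
    refine ⟨2 * N, -N, u, mem_gen_wd _ _ ?_, IsConj.refl _⟩
    intro l hl
    have := hN l hl
    exact Or.inr ⟨by omega, by push_cast; omega⟩
  obtain ⟨lo, hlo⟩ := Nat.find_spec hd
  set d := Nat.find hd with hdd
  have hmin : ∀ d' < d, ∀ lo, ¬ CI (L0 x0 lo d') u := fun d' h lo hc => Nat.find_min hd h ⟨lo, hc⟩
  let R := proj (L0 x0 lo d) u
  have hRc : IsConj u (incl _ R) := hlo.isConj_proj
  have hred : ∀ (p : L0 x0 lo d), CI {p}ᶜ R → CI (L0 x0 lo d \ {p.1}) u := by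
    rintro p ⟨v, hv, hc⟩
    refine ⟨incl _ v, gen_mono ?_ (incl_gen _ _ v hv), hRc.trans ((incl _).map_isConj hc)⟩
    rintro _ ⟨q, hq, rfl⟩
    exact ⟨q.2, fun hh => hq (Subtype.ext hh)⟩
  have hyp : Hyp x0 lo d R := by
    refine ⟨?_, ?_, ?_⟩
    · apply IH
      · intro h1
        rw [h1, map_one] at hRc
        exact hlamC ∅ (by simp) ⟨1, Subgroup.one_mem _, hRc⟩
      · exact (nrm_proj_le _ _).trans hnu
    · intro hc
      have h1 := hred _ hc
      by_cases h0 : d = 0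
      · refine hlamC _ ?_ h1
        rintro p ⟨hp, hp'⟩ hx
        rcases hp with h | h
        · exact h hx
        · apply hp'
          rw [Set.mem_singleton_iff, hiL]
          rw [h0] at h
          exact Prod.ext hx (by rw [h0]; have := h.1; have := h.2; push_cast at *; omega)
      · refine hmin (d - 1) (by omega) lo (h1.mono ?_)
        rintro p ⟨hp, hp'⟩
        by_cases hx : p.1 = x0
        · rcases hp with h | h
          · exact Or.inl h
          · refine Or.inr ⟨h.1, ?_⟩
            have h2 : p.2 ≠ lo + d := fun hh => hp' (Prod.ext hx hh)
            have := h.2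
            omega
        · exact Or.inl hx
    · intro hc
      have h1 := hred _ hc
      by_cases h0 : d = 0
      · refine hlamC _ ?_ h1
        rintro p ⟨hp, hp'⟩ hx
        rcases hp with h | h
        · exact h hx
        · apply hp'
          rw [Set.mem_singleton_iff, loL]
          rw [h0] at h
          exact Prod.ext hx (by have := h.1; have := h.2; push_cast at *; omega)
      · refine hmin (d - 1) (by omega) (lo + 1) (h1.mono ?_)
        rintro p ⟨hp, hp'⟩
        by_cases hx : p.1 = x0
        · rcases hp with h | h
          · exact Or.inl h
          · have h2 : p.2 ≠ lo := fun hh => hp' (Prod.ext hx hh)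
            have := h.1
            have := h.2
            exact Or.inr ⟨by omega, by omega⟩
        · exact Or.inl hx
  have hc0 : IsConj (R0 R) (FreeGroup.mk L) := by
    rw [e]; exact (lam Y).map_isConj hRc.symm
  refine ⟨⟨?_, ?_⟩, ?_, ?_⟩
  · intro hnp w m hm hw
    rw [← NN_conj hc0] at hw ⊢
    exact hyp.concl_tf (hnp.conj hc0.symm) w m hm hw
  · intro n hn
    exact sep_conj hc0 n hn (hyp.concl_sep n hn)
  · intro w hw hN
    rw [← NN_conj hc0] at hN
    exact hyp.concl_a w hw hN
  · intro hnc w hw hN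
    rw [← NN_conj hc0] at hN
    exact hyp.concl_d (fun h => hnc (h.conj hc0)) w hw hN

end OneRel

namespace OneRel

open FreeGroup (of IsReduced IsCyclicallyReduced)

section blow
variable {X : Type}

lemma wd_mk_of_reduced {L : List (X × Bool)} (h : IsReduced L) : wd (FreeGroup.mk L) = L := by
  classical
  have : wd (FreeGroup.mk L) = FreeGroup.reduce L := by
    unfold wd; convert FreeGroup.toWord_mk (L₁ := L)
  rw [this, h.reduce_eq]

lemma wd_reduced (w : FreeGroup X) : IsReduced (wd w) :=
  @FreeGroup.isReduced_toWord X (Classical.decEq X) w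

lemma wd_sublist (L : List (X × Bool)) : (wd (FreeGroup.mk L)).Sublist L := by
  classical
  have : wd (FreeGroup.mk L) = FreeGroup.reduce L := by
    unfold wd; convert FreeGroup.toWord_mk (L₁ := L)
  rw [this]
  exact FreeGroup.Red.sublist FreeGroup.reduce.red

lemma mk_flatten_replicate (L : List (X × Bool)) (m : ℕ) :
    FreeGroup.mk (List.replicate m L).flatten = FreeGroup.mk L ^ m := by
  induction m with
  | zero => simp [FreeGroup.one_eq_mk]
  | succ m ih =>
    rw [List.replicate_succ, List.flatten_cons, ← FreeGroup.mul_mk, ih, pow_succ']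

lemma exists_cycred (R : FreeGroup X) : ∃ L : List (X × Bool), IsCyclicallyReduced L ∧
    L.length ≤ nrm R ∧ IsConj R (FreeGroup.mk L) := by
  classical
  refine ⟨FreeGroup.reduceCyclically (wd R),
    FreeGroup.reduceCyclically.isCyclicallyReduced (wd_reduced R), ?_, ?_⟩
  · have := congrArg List.length (FreeGroup.reduceCyclically.conj_conjugator_reduceCyclically (wd R))
    simp only [List.length_append] at this
    rw [nrm]; omega
  · have := congrArg FreeGroup.mk (FreeGroup.reduceCyclically.conj_conjugator_reduceCyclically (wd R))
    rw [mk_wd, ← FreeGroup.mul_mk, ← FreeGroup.mul_mk, ← FreeGroup.inv_mk] at this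
    exact (isConj_iff.2 ⟨_, this⟩).symm

lemma not_CI_of_cycred {L : List (X × Bool)} (h : IsCyclicallyReduced L) (s : Set X)
    (hl : ∃ l ∈ L, l.1 ∉ s) : ¬ CI s (FreeGroup.mk L) := by
  classical
  rintro ⟨u, hu, hc⟩
  obtain ⟨c, hc⟩ := isConj_iff.1 hc.symm
  let P : X × Bool → Bool := fun l => decide (l.1 ∉ s)
  set m := (wd c).countP P + ((FreeGroup.invRev (wd c)).countP P) + 1 with hm
  obtain ⟨Lu, hLu, hLs⟩ := exists_list_of_mem_gen s (u ^ m) (Subgroup.pow_mem _ hu m)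
  have h1 : FreeGroup.mk (wd c ++ Lu ++ FreeGroup.invRev (wd c)) =
      FreeGroup.mk (List.replicate m L).flatten := by
    rw [mk_flatten_replicate, ← hc, conj_pow, ← FreeGroup.mul_mk, ← FreeGroup.mul_mk,
      ← FreeGroup.inv_mk, hLu, mk_wd]
  have h2 := wd_sublist (wd c ++ Lu ++ FreeGroup.invRev (wd c))
  rw [h1, wd_mk_of_reduced (h.flatten_replicate m).isReduced] at h2
  have h3 := h2.countP_le (p := P)
  rw [List.countP_append, List.countP_append] at h3
  have h4 : Lu.countP P = 0 := by
    rw [List.countP_eq_zero]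
    intro l hl; simpa [P] using hLs l hl
  have h5 : ∀ m : ℕ, (List.replicate m L).flatten.countP P = m * L.countP P := by
    intro m
    induction m with
    | zero => simp
    | succ m ih => rw [List.replicate_succ, List.flatten_cons, List.countP_append, ih]; ring
  have h6 : 0 < L.countP P := by
    rw [List.countP_pos_iff]
    obtain ⟨l, hl, hls⟩ := hl
    exact ⟨l, hl, by simpa [P] using hls⟩
  rw [h5] at h3
  nlinarith

variable (m : X → ℕ)

def blow (L : List (X × Bool)) : List (X × Bool) := L.flatMap fun l => List.replicate (m l.1) l

def blowH : FreeGroup X →* FreeGroup X := FreeGroup.lift fun x => of x ^ m x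

lemma blow_cons (l) (L : List (X × Bool)) : blow m (l :: L) = List.replicate (m l.1) l ++ blow m L := rfl

lemma mk_replicate (l : X × Bool) (k : ℕ) : FreeGroup.mk (List.replicate k l) = FreeGroup.mk [l] ^ k := by
  have := mk_flatten_replicate [l] k
  rwa [List.flatten_replicate_singleton] at this

lemma mk_blow (L : List (X × Bool)) : FreeGroup.mk (blow m L) = blowH m (FreeGroup.mk L) := by
  induction L with
  | nil => rw [← FreeGroup.one_eq_mk, map_one]; rfl
  | cons l L ih =>
    have h1 : FreeGroup.mk (l :: L) = FreeGroup.mk [l] * FreeGroup.mk L := by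
      rw [FreeGroup.mul_mk]; rfl
    rw [blow_cons, ← FreeGroup.mul_mk, ih, h1, map_mul, mk_replicate]
    congr 1
    rcases l with ⟨x, _ | _⟩
    · have : FreeGroup.mk [(x, false)] = (of x)⁻¹ := by simp [FreeGroup.of, FreeGroup.invRev]
      rw [this, map_inv, blowH, FreeGroup.lift_apply_of, inv_pow]
    · change of x ^ m x = blowH m (of x)
      rw [blowH, FreeGroup.lift_apply_of]

variable {m}

lemma blow_head (hm : ∀ x, 1 ≤ m x) (L : List (X × Bool)) : (blow m L).head? = L.head? := by
  cases L with
  | nil => rfl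
  | cons l L =>
    obtain ⟨k, hk⟩ := Nat.exists_eq_add_of_le' (hm l.1)
    rw [blow_cons, hk, List.replicate_succ]; rfl

lemma blow_last (hm : ∀ x, 1 ≤ m x) (L : List (X × Bool)) : (blow m L).getLast? = L.getLast? := by
  induction L using List.reverseRecOn with
  | nil => rfl
  | append_singleton L l ih =>
    obtain ⟨k, hk⟩ := Nat.exists_eq_add_of_le' (hm l.1)
    rw [blow, List.flatMap_append, List.flatMap_singleton, hk, List.replicate_succ',
      ← List.append_assoc, List.getLast?_concat, List.getLast?_concat]

lemma blow_reduced (hm : ∀ x, 1 ≤ m x) {L : List (X × Bool)} (h : IsReduced L) : IsReduced (blow m L) := by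
  induction L with
  | nil => exact h
  | cons l L ih =>
    have h1 : IsReduced ([l] ++ L) := h
    rw [FreeGroup.IsReduced, List.isChain_append] at h1
    rw [blow_cons, FreeGroup.IsReduced, List.isChain_append]
    refine ⟨List.isChain_replicate_of_rel _ fun _ => rfl, ih h1.2.1, ?_⟩
    intro a ha b hb
    rw [blow_head hm] at hb
    have : a = l := List.eq_of_mem_replicate (List.mem_of_mem_getLast? ha)
    subst this
    exact h1.2.2 _ (by simp) b hb

lemma blow_cycred (hm : ∀ x, 1 ≤ m x) {L : List (X × Bool)} (h : IsCyclicallyReduced L) :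
    IsCyclicallyReduced (blow m L) := by
  refine ⟨blow_reduced hm h.1, ?_⟩
  rw [blow_last hm, blow_head hm]
  exact h.2

lemma blow_inj (hm : ∀ x, 1 ≤ m x) : Function.Injective (blowH m) := by
  rw [injective_iff_map_eq_one]
  intro w hw
  rw [← mk_wd w, ← mk_blow] at hw
  have h1 := wd_mk_of_reduced (blow_reduced hm (wd_reduced w))
  rw [hw] at h1
  have h2 : wd (1 : FreeGroup X) = [] := List.length_eq_zero_iff.1 ((nrm_eq_zero (1 : FreeGroup X)).2 rfl)
  rw [h2] at h1
  have h3 := blow_head hm (wd w)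
  rw [← h1] at h3
  have h4 : wd w = [] := List.head?_eq_none_iff.1 h3.symm
  rw [← mk_wd w, h4]; rfl

lemma mem_blow (hm : ∀ x, 1 ≤ m x) {L : List (X × Bool)} {l} (h : l ∈ L) : l ∈ blow m L := by
  rw [blow, List.mem_flatMap]
  exact ⟨l, h, List.mem_replicate.2 ⟨by have := hm l.1; omega, rfl⟩⟩

lemma blow_parse (w u v : List (X × Bool)) (h : blow m w = u ++ v)
    (hv : ∀ a ∈ v.head?, m a.1 = 1) : ∃ w1, blow m w1 = u := by
  induction w generalizing u with
  | nil =>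
    have : u = [] := (List.append_eq_nil_iff.1 h.symm).1
    exact ⟨[], this.symm⟩
  | cons l w ih =>
    rw [blow_cons, List.append_eq_append_iff] at h
    rcases h with ⟨a, rfl, h⟩ | ⟨c, h1, h2⟩
    · obtain ⟨w1, hw1⟩ := ih a h
      exact ⟨l :: w1, by rw [blow_cons, hw1]⟩
    · rcases c with _ | ⟨c, c'⟩
      · refine ⟨[l], ?_⟩
        rw [blow_cons, h1]; simp [blow]
      · have hc : c = l := List.eq_of_mem_replicate (n := m l.1) (by rw [h1]; simp)
        have h3 : m l.1 = 1 := by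
          rw [← hc]; apply hv; rw [h2]; rfl
        rw [h3] at h1
        have h4 := congrArg List.length h1
        simp only [List.length_replicate, List.length_append, List.length_cons] at h4
        have : u = [] := List.length_eq_zero_iff.1 (by omega)
        exact ⟨[], this.symm⟩

lemma blow_nonpow_aux (hm : ∀ x, 1 ≤ m x) {L : List (X × Bool)} (h : IsCyclicallyReduced L) (l : X × Bool)
    (hl : L.head? = some l) (hml : m l.1 = 1) (hR : NonPow (FreeGroup.mk L)) :
    NonPow (blowH m (FreeGroup.mk L)) := by
  classical
  intro S k hk e
  obtain ⟨k, rfl⟩ := Nat.exists_eq_add_of_le' hk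
  set c := FreeGroup.reduceCyclically.conjugator (wd S) with hc
  set s := FreeGroup.reduceCyclically (wd S) with hs
  have h1 : blow m L = c ++ (List.replicate (k + 1) s).flatten ++ FreeGroup.invRev c := by
    rw [← FreeGroup.reduceCyclically.reduce_flatten_replicate_succ (wd_reduced S) k]
    rw [← FreeGroup.toWord_mk, mk_flatten_replicate, mk_wd, ← e, ← mk_blow, FreeGroup.toWord_mk,
      (blow_reduced hm h.1).reduce_eq]
  have h2 := blow_cycred hm h
  have hcn : c = [] := by
    rcases hcc : c with _ | ⟨a, c'⟩
    · rfl
    · rw [hcc] at h1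
      rw [h1] at h2
      have := h2.2 (a.1, !a.2) (by
        have e2 : FreeGroup.invRev (a :: c') = FreeGroup.invRev c' ++ [(a.1, !a.2)] := by
          simp [FreeGroup.invRev]
        rw [e2, ← List.append_assoc, List.getLast?_concat]; rfl) a (by simp) rfl
      simp at this
  have hS : S = FreeGroup.mk s := by
    have := FreeGroup.reduceCyclically.conj_conjugator_reduceCyclically (wd S)
    rw [← hc, ← hs, hcn] at this
    rw [← mk_wd S, ← this]; simp [FreeGroup.invRev]
  rw [hcn] at h1
  simp only [List.nil_append, FreeGroup.invRev_empty, List.append_nil] at h1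
  have hhd : s.head? = some l := by
    have h3 := blow_head hm L
    rw [h1, hl, List.replicate_succ, List.flatten_cons] at h3
    rcases hss : s with _ | ⟨a, s'⟩
    · rw [hss] at h3
      simp at h3
    · rw [hss] at h3
      exact h3
  rw [List.replicate_succ, List.flatten_cons] at h1
  obtain ⟨w1, hw1⟩ := blow_parse L s _ h1 (by
    intro a ha
    rcases k with _ | k
    · simp at ha
    · rw [List.replicate_succ, List.flatten_cons] at ha
      rcases hss : s with _ | ⟨b, s'⟩
      · rw [hss] at hhd; simp at hhd
      · rw [hss] at ha hhd
        simp at ha hhd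
        rw [← ha, hhd, hml])
  refine hR (FreeGroup.mk w1) _ hk ?_
  apply blow_inj hm
  rw [e, map_pow, ← mk_blow, hw1, hS]

lemma cycred_rotate {L1 L2 : List (X × Bool)} (h : IsCyclicallyReduced (L1 ++ L2)) :
    IsCyclicallyReduced (L2 ++ L1) := by
  have h3 := (h.flatten_replicate 3).isReduced
  simp only [List.replicate_succ, List.replicate_zero, List.flatten_cons, List.flatten_nil,
    List.append_nil] at h3
  have h4 : IsReduced ((L2 ++ L1) ++ (L2 ++ L1)) := by
    have h6 : IsReduced (L1 ++ (((L2 ++ L1) ++ (L2 ++ L1)) ++ L2)) := by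
      simpa only [List.append_assoc] using h3
    exact (List.isChain_append.1 (List.isChain_append.1 h6).2.1).1
  have h5 := h4
  rw [FreeGroup.IsReduced, List.isChain_append] at h4
  exact ⟨h4.1, h4.2.2⟩

lemma blow_nonpow (hm : ∀ x, 1 ≤ m x) {L : List (X × Bool)} (h : IsCyclicallyReduced L) (l : X × Bool)
    (hl : l ∈ L) (hml : m l.1 = 1) (hR : NonPow (FreeGroup.mk L)) :
    NonPow (blowH m (FreeGroup.mk L)) := by
  obtain ⟨L1, L2, rfl⟩ := List.append_of_mem hl
  have hc : IsConj (FreeGroup.mk (L1 ++ l :: L2)) (FreeGroup.mk (l :: L2 ++ L1)) := by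
    rw [← FreeGroup.mul_mk, ← FreeGroup.mul_mk]
    exact isConj_iff.2 ⟨(FreeGroup.mk L1)⁻¹, by group⟩
  have := blow_nonpow_aux hm (cycred_rotate h) l rfl hml (hR.conj hc)
  exact this.conj ((blowH m).map_isConj hc.symm)

end blow
end OneRel

namespace OneRel

open FreeGroup (of IsCyclicallyReduced)

section root
variable {Y : Type} (x0 : Y)

open Classical in
noncomputable def th1 (c : ℤ) : FreeGroup (Option Y) →* FreeGroup (Option Y) :=
  FreeGroup.lift fun o => if o = some x0 then of (some x0) * tt Y ^ c else of o

lemma th1_none (c : ℤ) : th1 x0 c (tt Y) = tt Y := by simp [th1]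
lemma th1_x0 (c : ℤ) : th1 x0 c (of (some x0)) = of (some x0) * tt Y ^ c := by simp [th1]
lemma th1_some (c : ℤ) (z : Y) (hz : z ≠ x0) : th1 x0 c (of (some z)) = of (some z) := by
  simp [th1, hz]

lemma th1_inv (c : ℤ) (w : FreeGroup (Option Y)) : th1 x0 (-c) (th1 x0 c w) = w := by
  have : (th1 x0 (-c)).comp (th1 x0 c) = MonoidHom.id _ := by
    ext o
    rcases o with _ | z
    · simp [th1_none]
    · by_cases hz : z = x0
      · subst hz; simp [th1_none, th1_x0]
      · simp [th1_some _ _ _ hz]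
  exact DFunLike.congr_fun this w

lemma th1_gen (c : ℤ) (w : FreeGroup (Option Y)) (hw : w ∈ gen {some x0}ᶜ) :
    th1 x0 c w ∈ gen {some x0}ᶜ := by
  refine map_gen _ _ _ ?_ w hw
  rintro (_ | z) hz
  · rw [th1_none]; exact of_mem_gen hz
  · rw [th1_some]
    · exact of_mem_gen hz
    · simpa using hz

def mm (a : ℕ) : Option Y → ℕ := fun o => if o.isNone then a else 1

lemma mm_pos (a : ℕ) (ha : 1 ≤ a) (o : Option Y) : 1 ≤ mm a o := by
  rcases o with _ | z <;> simp [mm, ha]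

noncomputable def th (a : ℕ) (c : ℤ) : FreeGroup (Option Y) →* FreeGroup (Option Y) :=
  (th1 x0 c).comp (blowH (mm a))

lemma th_none (a : ℕ) (c : ℤ) : th x0 a c (tt Y) = tt Y ^ a := by
  simp [th, blowH, mm, th1_none]
lemma th_x0 (a : ℕ) (c : ℤ) : th x0 a c (of (some x0)) = of (some x0) * tt Y ^ c := by
  simp [th, blowH, mm, th1_x0]
lemma th_some (a : ℕ) (c : ℤ) (z : Y) (hz : z ≠ x0) : th x0 a c (of (some z)) = of (some z) := by
  simp [th, blowH, mm, th1_some _ _ _ hz]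

lemma th_inj (a : ℕ) (ha : 1 ≤ a) (c : ℤ) : Function.Injective (th x0 a c) :=
  (Function.LeftInverse.injective (th1_inv x0 c)).comp (blow_inj (mm_pos a ha))

lemma th_gen (a : ℕ) (c : ℤ) (w : FreeGroup (Option Y)) (hw : w ∈ gen {some x0}ᶜ) :
    th x0 a c w ∈ gen {some x0}ᶜ := by
  refine th1_gen x0 c _ (map_gen _ _ _ ?_ w hw)
  rintro z hz
  simp only [blowH, FreeGroup.lift_apply_of]
  exact Subgroup.pow_mem _ (of_mem_gen hz) _

lemma th_nonpow (a : ℕ) (ha : 1 ≤ a) (c : ℤ) (L : List (Option Y × Bool)) (h : IsCyclicallyReduced L)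
    (b : Bool) (hx : (some x0, b) ∈ L) (hR : NonPow (FreeGroup.mk L)) :
    NonPow (th x0 a c (FreeGroup.mk L)) := by
  have h1 := blow_nonpow (mm_pos a ha) h _ hx rfl hR
  intro S k hk e
  refine h1 (th1 x0 (-c) S) k hk ?_
  rw [← map_pow, ← e]
  exact (th1_inv x0 c _).symm

lemma th_not_CI (a : ℕ) (ha : 1 ≤ a) (c : ℤ) (L : List (Option Y × Bool)) (h : IsCyclicallyReduced L)
    (b : Bool) (hx : (some x0, b) ∈ L) : ¬ CI {some x0}ᶜ (th x0 a c (FreeGroup.mk L)) := by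
  rintro ⟨u, hu, hc⟩
  have h1 := blow_cycred (mm_pos (Y := Y) a ha) h
  refine not_CI_of_cycred h1 {some x0}ᶜ ⟨_, mem_blow (mm_pos a ha) hx, by simp⟩ ?_
  refine ⟨_, th1_gen x0 (-c) u hu, ?_⟩
  rw [mk_blow, ← th1_inv x0 c (blowH (mm a) (FreeGroup.mk L))]
  exact (th1 x0 (-c)).map_isConj hc

lemma NN_map_le {X X' : Type} (θ : FreeGroup X →* FreeGroup X') (R : FreeGroup X) (n : ℕ) :
    NN R n ≤ (NN (θ R) n).comap θ := by
  apply Subgroup.normalClosure_le_normal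
  rw [Set.singleton_subset_iff, SetLike.mem_coe, Subgroup.mem_comap, map_pow]
  exact pow_mem_NN _ n

lemma th_ker (a : ℕ) (ha : 1 ≤ a) (c : ℤ) (R : FreeGroup (Option Y))
    (hF : ∀ k : ℤ, tt Y ^ k ∈ NN R 1 → k = 0) (n : ℕ) :
    (NN (th x0 a c R) n).comap (th x0 a c) = NN R n := by
  classical
  refine le_antisymm ?_ (NN_map_le _ R n)
  let B := Gq R n × Multiplicative ℤ
  let p : B := (QuotientGroup.mk (tt Y), 1)
  let q : B := (1, Multiplicative.ofAdd (a : ℤ))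
  have hpi : Function.Injective (zpowersHom B p) := by
    rw [injective_iff_map_eq_one]
    intro k hk
    rw [zpowersHom_apply] at hk
    have h1 : (QuotientGroup.mk (tt Y) : Gq R n) ^ (Multiplicative.toAdd k) = 1 :=
      congrArg Prod.fst hk
    rw [← QuotientGroup.mk_zpow, QuotientGroup.eq_one_iff] at h1
    have := hF _ (NN_le R n h1)
    simpa using this
  have hqi : Function.Injective (zpowersHom B q) := by
    rw [injective_iff_map_eq_one]
    intro k hk
    rw [zpowersHom_apply] at hk
    have h1 : (Multiplicative.ofAdd (a : ℤ)) ^ (Multiplicative.toAdd k) = 1 :=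
      congrArg Prod.snd hk
    rw [← ofAdd_zsmul, ofAdd_eq_one, smul_eq_mul, mul_eq_zero] at h1
    rcases h1 with h1 | h1
    · simpa using h1
    · omega
  let ph := (MonoidHom.ofInjective hpi).symm.trans (MonoidHom.ofInjective hqi)
  let P := HNNExtension B _ _ ph
  let r : P := HNNExtension.t
  have hrel : r * HNNExtension.of p = HNNExtension.of q * r := by
    have h1 := HNNExtension.t_mul_of (φ := ph) (MonoidHom.ofInjective hpi (Multiplicative.ofAdd 1))
    have h2 : ph (MonoidHom.ofInjective hpi (Multiplicative.ofAdd 1)) =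
      MonoidHom.ofInjective hqi (Multiplicative.ofAdd 1) := by
      simp only [ph, MulEquiv.trans_apply, MulEquiv.symm_apply_apply]
    rw [h2] at h1
    simpa [MonoidHom.ofInjective_apply, zpowersHom_apply] using h1
  let ii : Gq R n →* P := HNNExtension.of.comp (MonoidHom.inl _ _)
  have hii : Function.Injective ii :=
    (HNNExtension.of_injective (φ := ph)).comp (fun x y h => congrArg Prod.fst h)
  let s : P := r⁻¹ * HNNExtension.of ((1, Multiplicative.ofAdd 1) : B) * r
  have hs : s ^ a = ii (QuotientGroup.mk (tt Y)) := by
    have h1 : s ^ a = r⁻¹ * HNNExtension.of q * r := by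
      have h2 : q = ((1, Multiplicative.ofAdd 1) : B) ^ a := by
        simp [q, ← ofAdd_nsmul]
      have h2' : (HNNExtension.of q : P) = HNNExtension.of ((1, Multiplicative.ofAdd 1) : B) ^ a :=
        (congrArg _ h2).trans (map_pow _ _ _)
      rw [h2']
      have := conj_pow (a := r⁻¹) (b := (HNNExtension.of ((1, Multiplicative.ofAdd 1) : B) : P)) (i := a)
      rw [inv_inv] at this
      exact this
    rw [h1, mul_assoc, ← hrel, inv_mul_cancel_left]; rfl
  let h : FreeGroup (Option Y) →* P := FreeGroup.lift fun o => match o with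
    | none => s
    | some z => if z = x0 then ii (QuotientGroup.mk (of (some z))) * (s ^ c)⁻¹
        else ii (QuotientGroup.mk (of (some z)))
  have h0 : h (tt Y) = s := by simp [h]
  have hh : ∀ w, h (th x0 a c w) = ii (QuotientGroup.mk w) := by
    intro w
    have : h.comp (th x0 a c) = ii.comp (QuotientGroup.mk' _) := by
      ext o
      rcases o with _ | z
      · simp only [MonoidHom.comp_apply, th_none, map_pow, h0, hs]; rfl
      · by_cases hz : z = x0
        · subst hz
          simp only [MonoidHom.comp_apply, th_x0, map_mul, map_zpow, h0]
          simp [h]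
        · simp only [MonoidHom.comp_apply, th_some _ _ _ _ hz]
          simp [h, hz]
    exact DFunLike.congr_fun this w
  intro w hw
  have hle : NN (th x0 a c R) n ≤ h.ker := by
    apply NN_le_ker
    rw [hh, ← map_pow, mk_pow_eq_one, map_one]
  have h3 := hle (Subgroup.mem_comap.1 hw)
  rw [MonoidHom.mem_ker, hh] at h3
  have h4 := hii (a₁ := QuotientGroup.mk w) (a₂ := 1) (by rw [map_one]; exact h3)
  exact (QuotientGroup.eq_one_iff w).1 h4

lemma cnt_append (L L' : List (Option Y × Bool)) : cnt (L ++ L') = cnt L + cnt L' := by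
  simp [cnt]

lemma cnt_invRev (L : List (Option Y × Bool)) : cnt (FreeGroup.invRev L) = cnt L := by
  simp [cnt, FreeGroup.invRev, List.filter_map, Function.comp_def]

lemma exists_cnt_zero (w : FreeGroup (Option Y)) (hw : w ∈ gen {none}) :
    ∃ L, FreeGroup.mk L = w ∧ cnt L = 0 := by
  obtain ⟨L, h1, h2⟩ := exists_list_of_mem_gen _ _ hw
  refine ⟨L, h1, ?_⟩
  rw [cnt, List.length_eq_zero_iff, List.filter_eq_nil_iff]
  intro l hl
  have := h2 l hl
  rw [Set.mem_singleton_iff] at this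
  simp [this]

lemma th_list (a : ℕ) (c : ℤ) (L : List (Option Y × Bool)) :
    ∃ L1, FreeGroup.mk L1 = th x0 a c (FreeGroup.mk L) ∧ cnt L1 ≤ cnt L := by
  have hlet : ∀ o : Option Y, ∃ L1, FreeGroup.mk L1 = th x0 a c (of o) ∧ cnt L1 ≤ cnt [(o, true)] := by
    rintro (_ | z)
    · obtain ⟨L1, h1, h2⟩ := exists_cnt_zero (tt Y ^ a) (Subgroup.pow_mem _ (of_mem_gen (Set.mem_singleton _)) _)
      exact ⟨L1, by rw [h1, th_none], by omega⟩
    · by_cases hz : z = x0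
      · subst hz
        obtain ⟨L1, h1, h2⟩ := exists_cnt_zero (tt Y ^ c) (Subgroup.zpow_mem _ (of_mem_gen (Set.mem_singleton _)) _)
        refine ⟨[(some z, true)] ++ L1, ?_, ?_⟩
        · rw [th_x0, ← FreeGroup.mul_mk, h1]; rfl
        · rw [cnt_append, h2, add_zero]
      · exact ⟨[(some z, true)], by rw [th_some _ _ _ _ hz]; rfl, le_rfl⟩
  have hlet' : ∀ l : Option Y × Bool, ∃ L1, FreeGroup.mk L1 = th x0 a c (FreeGroup.mk [l]) ∧
      cnt L1 ≤ cnt [l] := by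
    rintro ⟨o, b⟩
    obtain ⟨L1, h1, h2⟩ := hlet o
    have h3 : cnt [(o, b)] = cnt [(o, true)] := by rcases o with _ | z <;> rfl
    cases b
    · refine ⟨FreeGroup.invRev L1, ?_, by rw [cnt_invRev, h3]; exact h2⟩
      have : FreeGroup.mk [(o, false)] = (of o)⁻¹ := by simp [FreeGroup.of, FreeGroup.invRev]
      rw [this, map_inv, ← h1, FreeGroup.inv_mk]
    · exact ⟨L1, h1, h2⟩
  induction L with
  | nil => exact ⟨[], by rw [← FreeGroup.one_eq_mk, map_one], le_rfl⟩
  | cons l L ih =>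
    obtain ⟨L1, h1, h2⟩ := ih
    obtain ⟨L2, h3, h4⟩ := hlet' l
    have h5 : l :: L = [l] ++ L := rfl
    refine ⟨L2 ++ L1, ?_, ?_⟩
    · rw [← FreeGroup.mul_mk, h1, h3, h5, ← FreeGroup.mul_mk, map_mul]
    · rw [h5, cnt_append, cnt_append]; omega

lemma cnt_lt (L : List (Option Y × Bool)) (b : Bool) (h : (none, b) ∈ L) : cnt L < L.length := by
  rw [cnt, List.length_filter_lt_length_iff_exists]
  exact ⟨_, h, by simp⟩

lemma ex_th (a : ℕ) (c : ℤ) (R : FreeGroup (Option Y)) :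
    ex none (th x0 a c R) = ex none R ^ a * ex (some x0) R ^ c := by
  let f : FreeGroup (Option Y) →* Multiplicative ℤ :=
    { toFun := fun R => ex none R ^ a * ex (some x0) R ^ c
      map_one' := by simp
      map_mul' := fun u v => by
        rw [map_mul, map_mul, mul_pow, mul_zpow, mul_mul_mul_comm] }
  have : (ex none).comp (th x0 a c) = f := by
    ext o
    rcases o with _ | z
    · simp [f, th_none, ex]
    · by_cases hz : z = x0
      · subst hz; simp [f, th_x0, ex]
      · simp [f, th_some _ _ _ _ hz, ex, hz]
  exact DFunLike.congr_fun this R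

lemma case3 (L : List (Option Y × Bool)) (h : IsCyclicallyReduced L) (b b' : Bool)
    (hx : (some x0, b) ∈ L) (hy : (none, b') ∈ L) (hne : ex (some x0) (FreeGroup.mk L) ≠ 1)
    (IH : ∀ (X' : Type) (R' : FreeGroup X'), R' ≠ 1 → nrm R' < L.length → Main R') :
    StepC (FreeGroup.mk L) ∧ Frei (some x0) (FreeGroup.mk L) := by
  set R := FreeGroup.mk L with hRdef
  let al : ℤ := Multiplicative.toAdd (ex (some x0) R)
  let bt : ℤ := Multiplicative.toAdd (ex none R)
  have hal : al ≠ 0 := fun h0 => hne (by simpa [al] using h0)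
  obtain ⟨a, c, ha, hac⟩ : ∃ (a : ℕ) (c : ℤ), 1 ≤ a ∧ a * bt + c * al = 0 := by
    refine ⟨al.natAbs, -(bt * al.sign), by omega, ?_⟩
    have : al.sign * al = al.natAbs := Int.sign_mul_self_eq_natAbs al
    rw [neg_mul, mul_assoc, this]; ring
  obtain ⟨L1, h1, h2⟩ := th_list x0 a c L
  have hex : ex none (FreeGroup.mk L1) = 1 := by
    rw [h1, ex_th]
    apply Multiplicative.toAdd.injective
    simpa [al, bt] using hac
  have hC : ¬ CI {some x0}ᶜ (FreeGroup.mk L1) := by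
    rw [h1]; exact th_not_CI x0 a ha c L h b hx
  obtain ⟨hS, hFr, -⟩ := step L1 x0 hex hC
    (fun X' R' h0 hle => IH X' R' h0 (by have := cnt_lt L b' hy; omega))
  rw [h1] at hS hFr
  have hF : Frei (some x0) R := by
    intro w hw hN
    apply th_inj x0 a ha c
    rw [map_one]
    exact hFr _ (th_gen x0 a c w hw) (NN_map_le _ R 1 hN)
  have hker := th_ker x0 a ha c R (by
    intro k hk
    have h3 := hF _ (Subgroup.zpow_mem _ (of_mem_gen (by simp)) k) hk
    have h4 := congrArg (ex none) h3
    rw [map_zpow, ex_tt, ← ofAdd_zsmul, map_one] at h4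
    simpa using h4)
  refine ⟨⟨?_, ?_⟩, hF⟩
  · intro hR w m hm hw
    rw [← hker 1] at hw ⊢
    rw [Subgroup.mem_comap] at *
    rw [map_pow] at hw
    exact hS.tf (th_nonpow x0 a ha c L h b hx hR) _ m hm hw
  · intro n hn
    exact sep_pull (th x0 a c) (fun n _ => hker n) (IsConj.refl _) n hn (hS.sep n hn)

end root

section induct
variable {X Y : Type}

lemma StepC.of_map (e : X ≃ Y) {R : FreeGroup X} (hM : StepC (FreeGroup.map e R)) : StepC R where
  tf hR w m hm hw := by
    rw [← NN_map_equiv e] at *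
    refine hM.tf (hR.map e) (FreeGroup.map e w) m hm ?_
    rw [← map_pow]; exact hw
  sep n hn := sep_pull (FreeGroup.map e) (fun n _ => NN_map_equiv e R n) (IsConj.refl _) n hn
    (hM.sep n hn)

lemma Frei.of_map (e : X ≃ Y) {R : FreeGroup X} {x : X} (h : Frei (e x) (FreeGroup.map e R)) :
    Frei x R := by
  intro w hw hN
  have := h _ (map_gen_equiv e x w hw) (by
      rw [← NN_map_equiv e] at hN; exact hN)
  have h2 := congrArg (FreeGroup.map e.symm) this
  rwa [map_map_symm, map_one] at h2

lemma cycred_map (e : X ≃ Y) {L : List (X × Bool)} (h : IsCyclicallyReduced L) :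
    IsCyclicallyReduced (L.map fun p => (e p.1, p.2)) := by
  refine ⟨?_, ?_⟩
  · rw [FreeGroup.IsReduced, List.isChain_map]
    refine List.IsChain.imp ?_ h.1
    intro a b hab hh
    exact hab (e.injective hh)
  · intro a ha b hb
    rw [List.getLast?_map] at ha
    rw [List.head?_map] at hb
    obtain ⟨a', ha', rfl⟩ := Option.map_eq_some_iff.1 ha
    obtain ⟨b', hb', rfl⟩ := Option.map_eq_some_iff.1 hb
    intro hh
    exact h.2 a' ha' b' hb' (e.injective hh)

lemma ex_map (e : X ≃ Y) (x : X) (R : FreeGroup X) : ex (e x) (FreeGroup.map e R) = ex x R := by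
  have : (ex (e x)).comp (FreeGroup.map e) = ex x := by
    ext y
    by_cases h : y = x <;> simp [ex, h]
  exact DFunLike.congr_fun this R

theorem main_all : ∀ (N : ℕ) (X : Type) (R : FreeGroup X), R ≠ 1 → nrm R ≤ N → Main R := by
  intro N
  induction N with
  | zero =>
    intro X R h1 h2
    exact absurd ((nrm_eq_zero R).1 (by omega)) h1
  | succ N IH =>
    intro X R hR1 hRN
    classical
    obtain ⟨L, hL, hlen, hc⟩ := exists_cycred R
    suffices hM : Main (FreeGroup.mk L) from hM.conj hc.symm
    have hL1 : FreeGroup.mk L ≠ 1 := by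
      intro h
      rw [h] at hc
      exact hR1 (isConj_one_left.1 hc)
    have hLn : L ≠ [] := by
      rintro rfl; exact hL1 rfl
    by_cases hA : ∃ x, ∀ l ∈ L, l.1 = x
    · obtain ⟨x, hx⟩ := hA
      have h1 : FreeGroup.mk L ∈ gen {x} := mk_mem_gen _ _ (by simpa using hx)
      rw [gen, Set.image_singleton, ← Subgroup.zpowers_eq_closure] at h1
      obtain ⟨m, hm⟩ := Subgroup.mem_zpowers_iff.1 h1
      rw [← hm]
      apply main_base
      rintro rfl
      rw [zpow_zero] at hm
      exact hL1 hm.symm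
    push Not at hA
    have IH' : ∀ (X' : Type) (R' : FreeGroup X'), R' ≠ 1 → nrm R' < L.length → Main R' :=
      fun X' R' h0 hlt => IH X' R' h0 (by omega)
    have hocc : ∀ x, ¬ CI {x}ᶜ (FreeGroup.mk L) → ∃ l ∈ L, l.1 = x := by
      intro x hx
      by_contra hcon
      push Not at hcon
      exact hx ⟨_, mk_mem_gen _ _ (by simpa using hcon), IsConj.refl _⟩
    have hnci : ∀ l ∈ L, ¬ CI {l.1}ᶜ (FreeGroup.mk L) := fun l hl =>
      not_CI_of_cycred hL _ ⟨l, hl, by simp⟩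
    -- change of alphabet
    have key : ∀ t : X, ∃ (Y : Type) (e : X ≃ Option Y), e t = none := fun t =>
      ⟨{z // z ≠ t}, (Equiv.optionSubtypeNe t).symm, by simp⟩
    by_cases h1 : ∃ l ∈ L, ex l.1 (FreeGroup.mk L) = 1
    · obtain ⟨t, ht, hext⟩ := h1
      obtain ⟨Y, e, het⟩ := key t.1
      set L' : List (Option Y × Bool) := L.map fun p => (e p.1, p.2) with hL'
      have hmk : FreeGroup.mk L' = FreeGroup.map e (FreeGroup.mk L) := by
        rw [FreeGroup.map.mk]
      have hcnt : cnt L' < L.length := by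
        have := cnt_lt L' t.2 (by rw [← het]; exact List.mem_map.2 ⟨t, ht, rfl⟩)
        rwa [hL', List.length_map] at this
      have st : ∀ l ∈ L, l.1 ≠ t.1 → StepC (FreeGroup.mk L) ∧ Frei l.1 (FreeGroup.mk L) ∧
          Frei t.1 (FreeGroup.mk L) := by
        intro l hl hlt
        obtain ⟨x0, hx0⟩ : ∃ x0, e l.1 = some x0 := by
          rw [← Option.ne_none_iff_exists']
          intro hh
          exact hlt (e.injective (by rw [hh, het]))
        obtain ⟨h3, h4, h5⟩ := step L' x0 (by rw [hmk, ← het, ex_map]; exact hext)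
          (by rw [hmk, ← hx0, CI_equiv_iff]; exact hnci l hl)
          (fun X' R' h0 hle => IH' X' R' h0 (by omega))
        have h6 := h5 (by rw [hmk, ← het, CI_equiv_iff]; exact hnci t ht)
        rw [hmk] at h3 h4 h6
        rw [← hx0] at h4
        rw [← het] at h6
        exact ⟨h3.of_map, h4.of_map, h6.of_map⟩
      obtain ⟨l0, hl0, hl0t⟩ := hA t.1
      obtain ⟨s1, s2, s3⟩ := st l0 hl0 hl0t
      refine ⟨?_, s1.tf, s1.sep⟩
      intro x hx
      obtain ⟨l, hl, rfl⟩ := hocc x hx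
      by_cases hlt : l.1 = t.1
      · rw [hlt]; exact s3
      · exact (st l hl hlt).2.1
    · push Not at h1
      have st : ∀ l ∈ L, StepC (FreeGroup.mk L) ∧ Frei l.1 (FreeGroup.mk L) := by
        intro l hl
        obtain ⟨t, ht, hlt⟩ := hA l.1
        obtain ⟨Y, e, het⟩ := key t.1
        obtain ⟨x0, hx0⟩ : ∃ x0, e l.1 = some x0 := by
          rw [← Option.ne_none_iff_exists']
          intro hh
          exact hlt (e.injective (by rw [hh, het]))
        have hmk : FreeGroup.mk (L.map fun p => (e p.1, p.2)) = FreeGroup.map e (FreeGroup.mk L) := by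
          rw [FreeGroup.map.mk]
        obtain ⟨h3, h4⟩ := case3 x0 (L.map fun p => (e p.1, p.2)) (cycred_map e hL) l.2 t.2
          (by rw [← hx0]; exact List.mem_map.2 ⟨l, hl, rfl⟩)
          (by rw [← het]; exact List.mem_map.2 ⟨t, ht, rfl⟩)
          (by rw [hmk, ← hx0, ex_map]; exact h1 l hl)
          (fun X' R' h0 hle => IH' X' R' h0 (by simpa using hle))
        rw [hmk] at h3 h4
        rw [← hx0] at h4
        exact ⟨h3.of_map, h4.of_map⟩
      obtain ⟨l0, hl0⟩ := List.exists_mem_of_ne_nil L hLn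
      refine ⟨?_, (st l0 hl0).1.tf, (st l0 hl0).1.sep⟩
      intro x hx
      obtain ⟨l, hl, rfl⟩ := hocc x hx
      exact (st l hl).2

theorem main_thm {X : Type} (R : FreeGroup X) (h : R ≠ 1) : Main R := main_all _ X R h le_rfl

end induct
end OneRel

namespace OneRel

section fox
variable {X G Q M : Type} [Group G] [Group Q] [CommRing M]

/-- Fox-type integration of functions along elements of `G`. -/
structure FoxD (π : G →* Q) (ι : X → G) (D : (X × Q → M) → G → Q → M) : Prop where
  surj : Subgroup.closure (Set.range ι) = ⊤
  mul : ∀ f g h q, D f (g * h) q = D f h q + D f g (π h * q)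
  gen : ∀ f x q, D f (ι x) q = f (x, q)

variable {π : G →* Q} {ι : X → G} {D : (X × Q → M) → G → Q → M}

lemma FoxD.ind (hD : FoxD π ι D) (P : G → Prop) (h1 : P 1) (hx : ∀ x, P (ι x))
    (hm : ∀ g h, P g → P h → P (g * h)) (hi : ∀ g, P g → P g⁻¹) (g : G) : P g := by
  have hg : g ∈ Subgroup.closure (Set.range ι) := by rw [hD.surj]; trivial
  induction hg using Subgroup.closure_induction with
  | mem x hx' => obtain ⟨y, rfl⟩ := hx'; exact hx y
  | one => exact h1
  | mul x y _ _ ha hb => exact hm x y ha hb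
  | inv x _ ha => exact hi x ha

lemma FoxD.one (hD : FoxD π ι D) (f : X × Q → M) (q : Q) : D f 1 q = 0 := by
  have := hD.mul f 1 1 q
  simpa using this

lemma FoxD.inv (hD : FoxD π ι D) (f : X × Q → M) (g : G) (q : Q) :
    D f g⁻¹ q = - D f g (π g⁻¹ * q) := by
  have := hD.mul f g g⁻¹ q
  rw [mul_inv_cancel, hD.one] at this
  linear_combination -this

lemma FoxD.right (hD : FoxD π ι D) (f : X × Q → M) (c : Q) (g : G) :
    ∀ q, D f g (q * c) = D (fun p => f (p.1, p.2 * c)) g q := by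
  refine hD.ind (fun g => ∀ q, D f g (q * c) = D (fun p => f (p.1, p.2 * c)) g q) ?_ ?_ ?_ ?_ g
  · intro q; rw [hD.one, hD.one]
  · intro x q; rw [hD.gen, hD.gen]
  · intro g h hg hh q
    rw [hD.mul, hD.mul, hh, ← mul_assoc, hg]
  · intro g hg q
    rw [hD.inv, hD.inv, ← mul_assoc, hg]

lemma FoxD.add (hD : FoxD π ι D) (f f' : X × Q → M) (g : G) :
    ∀ q, D (f + f') g q = D f g q + D f' g q := by
  refine hD.ind (fun g => ∀ q, D (f + f') g q = D f g q + D f' g q) ?_ ?_ ?_ ?_ g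
  · intro q; simp [hD.one]
  · intro x q; simp [hD.gen]
  · intro g h hg hh q
    simp only [hD.mul, hg, hh]; ring
  · intro g hg q
    simp only [hD.inv, hg]; ring

lemma FoxD.smul (hD : FoxD π ι D) (f : X × Q → M) (c : M) (g : G) :
    ∀ q, D (c • f) g q = c * D f g q := by
  refine hD.ind (fun g => ∀ q, D (c • f) g q = c * D f g q) ?_ ?_ ?_ ?_ g
  · intro q; simp [hD.one]
  · intro x q; simp [hD.gen]
  · intro g h hg hh q
    simp only [hD.mul, hg, hh]; ring
  · intro g hg q
    simp only [hD.inv, hg]; ring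

lemma FoxD.sum (hD : FoxD π ι D) {I : Type*} (s : Finset I) (f : I → X × Q → M) (g : G) (q : Q) :
    D (∑ i ∈ s, f i) g q = ∑ i ∈ s, D (f i) g q := by
  classical
  induction s using Finset.induction_on with
  | empty =>
    have := hD.smul (0 : X × Q → M) 0 g q
    simpa using this
  | insert a s ha ih => rw [Finset.sum_insert ha, Finset.sum_insert ha, hD.add, ih]

lemma FoxD.fin (hD : FoxD π ι D) (g : G) : ∀ q, ∃ P : Finset (X × Q), ∀ f f' : X × Q → M,
    (∀ p ∈ P, f p = f' p) → D f g q = D f' g q := by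
  classical
  refine hD.ind (fun g => ∀ q, ∃ P : Finset (X × Q), ∀ f f' : X × Q → M,
    (∀ p ∈ P, f p = f' p) → D f g q = D f' g q) ?_ ?_ ?_ ?_ g
  · intro q; exact ⟨∅, fun f f' _ => by rw [hD.one, hD.one]⟩
  · intro x q; exact ⟨{(x, q)}, fun f f' h => by
      rw [hD.gen, hD.gen]; exact h _ (Finset.mem_singleton_self _)⟩
  · intro g h hg hh q
    obtain ⟨P1, h1⟩ := hh q
    obtain ⟨P2, h2⟩ := hg (π h * q)
    refine ⟨P1 ∪ P2, fun f f' hp => ?_⟩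
    rw [hD.mul, hD.mul, h1 f f' fun p hp' => hp p (Finset.mem_union_left _ hp'),
      h2 f f' fun p hp' => hp p (Finset.mem_union_right _ hp')]
  · intro g hg q
    obtain ⟨P, h1⟩ := hg (π g⁻¹ * q)
    exact ⟨P, fun f f' hp => by rw [hD.inv, hD.inv, h1 f f' hp]⟩

lemma FoxD.cob (hD : FoxD π ι D) (h : Q → M) (g : G) : ∀ q,
    D (fun p => h (π (ι p.1) * p.2) - h p.2) g q = h (π g * q) - h q := by
  refine hD.ind (fun g => ∀ q, D (fun p => h (π (ι p.1) * p.2) - h p.2) g q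
    = h (π g * q) - h q) ?_ ?_ ?_ ?_ g
  · intro q; simp [hD.one]
  · intro x q; rw [hD.gen]
  · intro g g' hg hh q
    rw [hD.mul, hg, hh, map_mul, mul_assoc]; ring
  · intro g hg q
    rw [hD.inv, hg]; simp

lemma FoxD.npow (hD : FoxD π ι D) (f : X × Q → M) (a : G) (k : ℕ) :
    ∀ q, D f (a ^ k) q = ∑ i ∈ Finset.range k, D f a (π a ^ i * q) := by
  induction k with
  | zero => intro q; simp [hD.one]
  | succ k ih =>
    intro q
    rw [pow_succ', hD.mul, ih, Finset.sum_range_succ, map_pow]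

open Classical in
/-- indicator of `{x} × q⟨b⟩` -/
noncomputable def indc (M : Type) [CommRing M] (x : X) (q b : Q) : X × Q → M :=
  fun p => if p.1 = x ∧ q⁻¹ * p.2 ∈ Subgroup.zpowers b then 1 else 0

lemma indc_congr {x : X} {q b : Q} {p p' : X × Q} {x' : X} {q' b' : Q}
    (h : (p.1 = x ∧ q⁻¹ * p.2 ∈ Subgroup.zpowers b) ↔
      (p'.1 = x' ∧ q'⁻¹ * p'.2 ∈ Subgroup.zpowers b')) :
    indc M x q b p = indc M x' q' b' p' := by
  unfold indc
  by_cases h1 : p.1 = x ∧ q⁻¹ * p.2 ∈ Subgroup.zpowers b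
  · rw [if_pos h1, if_pos (h.1 h1)]
  · rw [if_neg h1, if_neg fun h2 => h1 (h.2 h2)]

lemma indc_inv (x : X) (q b c : Q) (hc : c ∈ Subgroup.zpowers b) (p : X × Q) :
    indc M x q b (p.1, p.2 * c) = indc M x q b p := by
  have : q⁻¹ * (p.2 * c) ∈ Subgroup.zpowers b ↔ q⁻¹ * p.2 ∈ Subgroup.zpowers b := by
    rw [← mul_assoc]; exact Subgroup.mul_mem_cancel_right _ hc
  exact indc_congr (and_congr Iff.rfl this)

lemma indc_sum (x : X) (q b : Q) (hb : ∀ i : ℤ, b ^ i = 1 → i = 0) (k : ℕ) (hk : 1 ≤ k) :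
    ∑ i ∈ Finset.range k, (fun p : X × Q => indc M x q (b ^ k) (p.1, p.2 * b ^ i)) =
      indc M x q b := by
  classical
  ext p
  rw [Finset.sum_apply]
  unfold indc
  by_cases h1 : p.1 = x ∧ q⁻¹ * p.2 ∈ Subgroup.zpowers b
  · rw [if_pos h1]
    obtain ⟨h1, h2⟩ := h1
    obtain ⟨m, hm⟩ := Subgroup.mem_zpowers_iff.1 h2
    have hkey : ∀ i : ℕ, q⁻¹ * (p.2 * b ^ i) ∈ Subgroup.zpowers (b ^ k) ↔ (k : ℤ) ∣ m + i := by
      intro i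
      rw [← mul_assoc, ← hm, Subgroup.mem_zpowers_iff]
      constructor
      · rintro ⟨j, hj⟩
        refine ⟨j, ?_⟩
        have : b ^ (m + i - k * j) = 1 := by
          rw [zpow_sub, zpow_add, zpow_mul, zpow_natCast, zpow_natCast, hj, mul_inv_cancel]
        have := hb _ this
        omega
      · rintro ⟨j, hj⟩
        refine ⟨j, ?_⟩
        rw [← zpow_natCast b i, ← zpow_add, hj, zpow_mul, zpow_natCast]
    have hk0 : (0 : ℤ) < k := by exact_mod_cast hk
    have e1 : 0 ≤ (-m) % k := Int.emod_nonneg _ (by omega)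
    have e2 : (-m) % k < k := Int.emod_lt_of_pos _ hk0
    rw [Finset.sum_eq_single ((-m) % k).toNat]
    · rw [if_pos]
      refine ⟨h1, (hkey _).2 ?_⟩
      rw [Int.toNat_of_nonneg e1]
      have := Int.emod_add_mul_ediv (-m) k
      exact ⟨-((-m) / k), by linarith [mul_neg (k : ℤ) ((-m) / k)]⟩
    · intro i hi hne
      rw [if_neg]
      rintro ⟨_, h3⟩
      have h4 := (hkey i).1 h3
      apply hne
      rw [Finset.mem_range] at hi
      have : (-m) % k = i := by
        have h5 : (-m) % (k : ℤ) = (i : ℤ) % k := by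
          apply (Int.emod_eq_emod_iff_emod_sub_eq_zero).2
          apply Int.emod_eq_zero_of_dvd
          have : -m - (i : ℤ) = -(m + i) := by ring
          rw [this]; exact (dvd_neg).2 h4
        rw [h5]; exact Int.emod_eq_of_lt (by omega) (by omega)
      omega
    · intro h3
      exact absurd (Finset.mem_range.2 (by omega)) h3
  · rw [if_neg h1]
    apply Finset.sum_eq_zero
    intro i _
    rw [if_neg]
    rintro ⟨h2, h3⟩
    apply h1
    refine ⟨h2, ?_⟩
    have h4 : q⁻¹ * (p.2 * b ^ i) ∈ Subgroup.zpowers b :=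
      (Subgroup.zpowers_le.2 (Subgroup.pow_mem _ (Subgroup.mem_zpowers b) k)) h3
    rw [← mul_assoc] at h4
    exact (Subgroup.mul_mem_cancel_right _ (Subgroup.pow_mem _ (Subgroup.mem_zpowers b) i)).1 h4

lemma FoxD.key_nat (hD : FoxD π ι D) (a : G) (hb : ∀ i : ℤ, π a ^ i = 1 → i = 0) (x : X) (q : Q)
    (k : ℕ) (hk : 1 ≤ k) :
    D (indc M x q (π a ^ k)) (a ^ k) 1 = D (indc M x q (π a)) a 1 := by
  rw [hD.npow, ← indc_sum x q (π a) hb k hk, hD.sum]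
  refine Finset.sum_congr rfl fun i _ => ?_
  rw [mul_one]
  have := hD.right (indc M x q (π a ^ k)) (π a ^ i) a 1
  rw [one_mul] at this
  exact this

lemma FoxD.key (hD : FoxD π ι D) (a : G) (hb : ∀ i : ℤ, π a ^ i = 1 → i = 0) (x : X) (q : Q)
    (k : ℤ) (hk : k ≠ 0) :
    D (indc M x q (π a ^ k)) (a ^ k) 1 = 0 ↔ D (indc M x q (π a)) a 1 = 0 := by
  obtain ⟨m, rfl | rfl⟩ := k.eq_nat_or_neg
  · rw [zpow_natCast, zpow_natCast, hD.key_nat a hb x q m (by omega)]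
  · rw [← hD.key_nat a hb x q m (by omega)]
    have h1 : indc M x q (π a ^ (-(m : ℤ))) = indc M x q (π a ^ m) := by
      ext p
      apply indc_congr
      rw [zpow_neg, zpow_natCast, Subgroup.zpowers_inv]
    rw [h1, zpow_neg, zpow_natCast, hD.inv, neg_eq_zero]
    have h2 := hD.right (indc M x q (π a ^ m)) (π (a ^ m)⁻¹) (a ^ m) 1
    rw [mul_one]
    rw [one_mul] at h2
    rw [h2]
    have h3 : (fun p : X × Q => indc M x q (π a ^ m) (p.1, p.2 * π (a ^ m)⁻¹)) =
        indc M x q (π a ^ m) := by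
      ext p
      apply indc_inv
      rw [map_inv, map_pow]
      exact Subgroup.inv_mem _ (Subgroup.mem_zpowers _)
    rw [h3]

lemma FoxD.shift (hD : FoxD π ι D) (a : G) (hb : ∀ i : ℤ, π a ^ i = 1 → i = 0) (x : X) (q : Q)
    (g : G) (k l : ℤ) (hk : k ≠ 0) (hl : l ≠ 0) (h : g * a ^ k * g⁻¹ = a ^ l) :
    D (indc M x q (π a)) a 1 = 0 ↔ D (indc M x (q * (π g)⁻¹) (π a)) a 1 = 0 := by
  rw [← hD.key a hb x q k hk, ← hD.key a hb x _ l hl]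
  set f := indc M x q (π a ^ k) with hf
  have h0 : a ^ l * g = g * a ^ k := by rw [← h]; group
  have h1 : D f (a ^ l * g) 1 = D f (g * a ^ k) 1 := by rw [h0]
  rw [hD.mul, hD.mul, mul_one, mul_one] at h1
  have h2 : D f g (π (a ^ k)) = D f g 1 := by
    have := hD.right f (π (a ^ k)) g 1
    rw [one_mul] at this
    rw [this]
    congr 1
    ext p
    apply indc_inv
    rw [map_zpow]; exact Subgroup.mem_zpowers _
  have h3 : D f (a ^ l) (π g) = D (indc M x (q * (π g)⁻¹) (π a ^ l)) (a ^ l) 1 := by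
    have := hD.right f (π g) (a ^ l) 1
    rw [one_mul] at this
    rw [this]
    congr 1
    ext p
    rw [hf]
    have e : π a ^ l = π g * π a ^ k * (π g)⁻¹ := by
      rw [← map_zpow, ← h, map_mul, map_mul, map_inv, map_zpow]
    have : q⁻¹ * (p.2 * π g) ∈ Subgroup.zpowers (π a ^ k) ↔
        (q * (π g)⁻¹)⁻¹ * p.2 ∈ Subgroup.zpowers (π a ^ l) := by
      rw [Subgroup.mem_zpowers_iff, Subgroup.mem_zpowers_iff]
      apply exists_congr
      intro j
      rw [e, conj_zpow, mul_inv_eq_iff_eq_mul]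
      constructor
      · intro h; rw [h]; group
      · intro h
        have := congrArg (fun z => (π g)⁻¹ * z) h
        simp only [mul_assoc, inv_mul_cancel_left] at this
        rw [this]; group
    exact indc_congr (and_congr Iff.rfl this)
  rw [h2, h3] at h1
  have h4 : D f (a ^ k) 1 = D (indc M x (q * (π g)⁻¹) (π a ^ l)) (a ^ l) 1 := by
    linear_combination -h1
  rw [h4]

lemma FoxD.nonempty [Nontrivial M] (hD : FoxD π ι D) (a : G) (hb : ∀ i : ℤ, π a ^ i = 1 → i = 0) :
    ∃ x q, D (indc M x q (π a)) a 1 ≠ 0 := by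
  classical
  let mkq : Q → Q ⧸ Subgroup.zpowers (π a) := QuotientGroup.mk
  have hrep : ∀ q, ∃ m : ℤ, Quotient.out (mkq q) * π a ^ m = q := by
    intro q
    obtain ⟨⟨h, hh⟩, e⟩ := QuotientGroup.mk_out_eq_mul (Subgroup.zpowers (π a)) q
    obtain ⟨m, rfl⟩ := Subgroup.mem_zpowers_iff.1 hh
    refine ⟨-m, ?_⟩
    have e' : Quotient.out (mkq q) = q * π a ^ m := e
    rw [e', mul_assoc, ← zpow_add, add_neg_cancel, zpow_zero, mul_one]
  choose m hm using hrep
  have hmul : ∀ q (i : ℤ), mkq (q * π a ^ i) = mkq q := by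
    intro q i
    refine QuotientGroup.eq.2 ?_
    rw [mul_inv_rev, mul_assoc, inv_mul_cancel, mul_one]
    exact Subgroup.inv_mem _ (Subgroup.zpow_mem _ (Subgroup.mem_zpowers _) _)
  have hm1 : ∀ q, m (q * π a) = m q + 1 := by
    intro q
    have h1 := hm (q * π a)
    have h2 := hmul q 1
    rw [zpow_one] at h2
    rw [h2] at h1
    have h3 : π a ^ (m (q * π a) - (m q + 1)) = 1 := by
      rw [zpow_sub, zpow_add, zpow_one, mul_inv_eq_one]
      apply mul_left_cancel (a := Quotient.out (mkq q))
      rw [h1, ← mul_assoc, hm]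
    have := hb _ h3
    omega
  let h : Q → M := fun q => (m q : M)
  have hh1 : ∀ q, h (q * π a) = h q + 1 := by
    intro q; simp only [h]; rw [hm1]; push_cast; ring
  let f : X × Q → M := fun p => h (π (ι p.1) * p.2) - h p.2
  have hf : D f a 1 = 1 := by
    have := hD.cob h a 1
    have h2 := hh1 1
    rw [one_mul] at h2
    rw [mul_one, h2] at this
    linear_combination this
  have hfa1 : ∀ x q, f (x, q * π a) = f (x, q) := by
    intro x q
    simp only [f]
    rw [← mul_assoc, hh1, hh1]; ring
  have hfa : ∀ (i : ℤ) x q, f (x, q * π a ^ i) = f (x, q) := by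
    intro i
    induction i using Int.induction_on with
    | zero => intro x q; simp
    | succ i ih => intro x q; rw [zpow_add, zpow_one, ← mul_assoc, hfa1, ih]
    | pred i ih =>
      intro x q
      rw [← hfa1, mul_assoc, ← zpow_add_one, sub_add_cancel, ih]
  obtain ⟨P, hP⟩ := hD.fin a 1
  by_contra hcon
  push Not at hcon
  let I : Finset (X × (Q ⧸ Subgroup.zpowers (π a))) := P.image fun p => (p.1, mkq p.2)
  have h5 := hP f (∑ c ∈ I, f (c.1, Quotient.out c.2) • indc M c.1 (Quotient.out c.2) (π a)) (by
    intro p hp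
    rw [Finset.sum_apply, Finset.sum_eq_single (p.1, mkq p.2)]
    · have e1 : f (p.1, Quotient.out (mkq p.2)) = f p := by
        rw [← hfa (m p.2), hm]
      have e2 : indc M p.1 (Quotient.out (mkq p.2)) (π a) p = 1 := by
        unfold indc
        rw [if_pos]
        refine ⟨rfl, Subgroup.mem_zpowers_iff.2 ⟨m p.2, ?_⟩⟩
        rw [eq_inv_mul_iff_mul_eq, hm]
      simp [e1, e2]
    · rintro ⟨x, c⟩ hc hne
      have e2 : indc M x (Quotient.out c) (π a) p = 0 := by
        unfold indc
        rw [if_neg]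
        rintro ⟨e3, e4⟩
        apply hne
        obtain ⟨j, hj⟩ := Subgroup.mem_zpowers_iff.1 e4
        have : p.2 = Quotient.out c * π a ^ j := by rw [hj]; group
        rw [this, hmul, ← e3]
        exact Prod.ext rfl (QuotientGroup.out_eq' c).symm
      simp [e2]
    · intro h6
      exact absurd (Finset.mem_image_of_mem (fun p : X × Q => (p.1, mkq p.2)) hp) h6)
  rw [hf, hD.sum] at h5
  apply one_ne_zero (α := M)
  rw [h5]
  apply Finset.sum_eq_zero
  rintro c -
  rw [hD.smul, hcon, mul_zero]

theorem FoxD.cosets [Nontrivial M] (hD : FoxD π ι D) (a : G) (hb : ∀ i : ℤ, π a ^ i = 1 → i = 0) :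
    ∃ W : Set Q, W.Finite ∧ ∀ (g : G) (k l : ℤ), k ≠ 0 → l ≠ 0 → g * a ^ k * g⁻¹ = a ^ l →
      ∃ w ∈ W, ∃ i : ℤ, π g = w * π a ^ i := by
  classical
  obtain ⟨x, q, hq⟩ := hD.nonempty a hb
  obtain ⟨P, hP⟩ := hD.fin a 1
  refine ⟨P.image (fun p => q⁻¹ * p.2), Finset.finite_toSet _, ?_⟩
  intro g k l hk hl h
  have h1 := hD.shift a hb x q g⁻¹ l k hl hk (by rw [← h]; group)
  rw [map_inv, inv_inv] at h1
  have h2 : D (indc M x (q * π g) (π a)) a 1 ≠ 0 := fun h3 => hq (h1.2 h3)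
  have h3 : ∃ p ∈ P, indc M x (q * π g) (π a) p ≠ 0 := by
    by_contra hcon
    push Not at hcon
    apply h2
    rw [hP _ (0 : X × Q → M) hcon]
    have := hD.smul (0 : X × Q → M) 0 a 1
    simpa using this
  obtain ⟨p, hp, h4⟩ := h3
  unfold indc at h4
  obtain ⟨-, h5⟩ := (ite_ne_right_iff.1 h4).1
  obtain ⟨i, hi⟩ := Subgroup.mem_zpowers_iff.1 h5
  refine ⟨q⁻¹ * p.2, Finset.mem_coe.2 (Finset.mem_image_of_mem _ hp), -i, ?_⟩
  rw [zpow_neg, hi]; group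

end fox
end OneRel

namespace OneRel
open FreeGroup (of)

section inst
variable {X : Type} (R : FreeGroup X) (n : ℕ)

noncomputable def foxP (f : X × Gq R 1 → ZMod n) (x : X) : Equiv.Perm (Gq R 1 × ZMod n) where
  toFun p := (QuotientGroup.mk (of x) * p.1, p.2 + f (x, p.1))
  invFun p := ((QuotientGroup.mk (of x))⁻¹ * p.1, p.2 - f (x, (QuotientGroup.mk (of x))⁻¹ * p.1))
  left_inv p := by ext <;> simp
  right_inv p := by ext <;> simp

noncomputable def foxF (f : X × Gq R 1 → ZMod n) : FreeGroup X →* Equiv.Perm (Gq R 1 × ZMod n) :=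
  FreeGroup.lift (foxP R n f)

lemma foxF_form (f : X × Gq R 1 → ZMod n) (w : FreeGroup X) :
    ∃ d : Gq R 1 → ZMod n, ∀ q c, foxF R n f w (q, c) = (QuotientGroup.mk w * q, c + d q) := by
  induction w using FreeGroup.induction_on with
  | C1 => exact ⟨0, fun q c => by ext <;> simp⟩
  | of x => exact ⟨fun q => f (x, q), fun q c => by simp [foxF, foxP]⟩
  | inv_of x h =>
    refine ⟨fun q => -f (x, (QuotientGroup.mk (of x))⁻¹ * q), fun q c => ?_⟩
    rw [map_inv, Equiv.Perm.inv_eq_iff_eq]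
    simp [foxF, foxP]
  | mul u v hu hv =>
    obtain ⟨d, hd⟩ := hu
    obtain ⟨d', hd'⟩ := hv
    refine ⟨fun q => d' q + d (QuotientGroup.mk v * q), fun q c => ?_⟩
    rw [map_mul, Equiv.Perm.mul_apply, hd', hd, QuotientGroup.mk_mul, mul_assoc, add_assoc]

lemma foxF_pow (f : X × Gq R 1 → ZMod n) : foxF R n f R ^ n = 1 := by
  obtain ⟨d, hd⟩ := foxF_form R n f R
  have h1 : (QuotientGroup.mk R : Gq R 1) = 1 := by
    have := mk_pow_eq_one R 1
    rwa [pow_one] at this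
  have : ∀ k : ℕ, ∀ q c, (foxF R n f R ^ k) (q, c) = (q, c + k * d q) := by
    intro k
    induction k with
    | zero => intro q c; simp
    | succ k ih =>
      intro q c
      rw [pow_succ', Equiv.Perm.mul_apply, ih, hd, h1, one_mul]
      push_cast
      ext
      · rfl
      · simp only; ring
  ext ⟨q, c⟩ : 1
  rw [this]
  simp

noncomputable def foxG (f : X × Gq R 1 → ZMod n) : Gq R n →* Equiv.Perm (Gq R 1 × ZMod n) :=
  QuotientGroup.lift _ (foxF R n f) (fun _ hw => NN_le_ker _ R n (foxF_pow R n f) hw)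

lemma foxG_mk (f : X × Gq R 1 → ZMod n) (w : FreeGroup X) :
    foxG R n f (QuotientGroup.mk w) = foxF R n f w := rfl

noncomputable def foxD (f : X × Gq R 1 → ZMod n) (g : Gq R n) (q : Gq R 1) : ZMod n :=
  (foxG R n f g (q, 0)).2

lemma closure_gens : Subgroup.closure (Set.range fun x => (QuotientGroup.mk (of x) : Gq R n)) = ⊤ := by
  rw [eq_top_iff]
  rintro g -
  induction g using QuotientGroup.induction_on with
  | H w =>
    induction w using FreeGroup.induction_on with
    | C1 => exact Subgroup.one_mem _
    | of x => exact Subgroup.subset_closure ⟨x, rfl⟩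
    | inv_of x h => exact Subgroup.inv_mem _ h
    | mul u v hu hv => exact Subgroup.mul_mem _ hu hv

lemma foxD_isFox : FoxD (pq R n) (fun x => (QuotientGroup.mk (of x) : Gq R n)) (foxD R n) where
  surj := closure_gens R n
  mul f g h q := by
    induction g using QuotientGroup.induction_on with
    | H u =>
    induction h using QuotientGroup.induction_on with
    | H v =>
    obtain ⟨d, hd⟩ := foxF_form R n f u
    obtain ⟨d', hd'⟩ := foxF_form R n f v
    have e : pq R n (QuotientGroup.mk v) = QuotientGroup.mk v := rfl
    unfold foxD
    rw [map_mul, foxG_mk, foxG_mk, Equiv.Perm.mul_apply, e, hd', hd, hd]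
    simp
  gen f x q := by
    unfold foxD
    rw [foxG_mk]
    simp [foxF, foxP]

end inst

section comm
variable {G Q : Type} [Group G] [Group Q] {π : G →* Q} {r : G}

lemma nc_fin (y : G) (hy : y ∈ Subgroup.normalClosure {r}) :
    ∃ S : Set G, S.Finite ∧ y ∈ Subgroup.closure ((fun g => g * r * g⁻¹) '' S) := by
  unfold Subgroup.normalClosure at hy
  induction hy using Subgroup.closure_induction with
  | mem x hx =>
    obtain ⟨a, ha, hc⟩ := Group.mem_conjugatesOfSet_iff.1 hx
    rw [Set.mem_singleton_iff] at ha
    subst ha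
    obtain ⟨c, rfl⟩ := isConj_iff.1 hc
    exact ⟨{c}, Set.finite_singleton _, Subgroup.subset_closure ⟨c, rfl, rfl⟩⟩
  | one => exact ⟨∅, Set.finite_empty, Subgroup.one_mem _⟩
  | mul x y _ _ hx hy =>
    obtain ⟨S, hS, h1⟩ := hx
    obtain ⟨S', hS', h2⟩ := hy
    refine ⟨S ∪ S', hS.union hS', Subgroup.mul_mem _ ?_ ?_⟩
    · exact Subgroup.closure_mono (Set.image_mono Set.subset_union_left) h1
    · exact Subgroup.closure_mono (Set.image_mono Set.subset_union_right) h2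
  | inv x _ hx =>
    obtain ⟨S, hS, h1⟩ := hx
    exact ⟨S, hS, Subgroup.inv_mem _ h1⟩

/-- commuting with a nontrivial element of the kernel. -/
lemma comm_ker (hS : SProp π r) (hker : π.ker ≤ Subgroup.normalClosure {r})
    (htf : ∀ (q : Q) (m : ℕ), 1 ≤ m → q ^ m = 1 → q = 1) (y g : G) (hy : π y = 1) (hy1 : y ≠ 1)
    (hc : g * y = y * g) : π g = 1 := by
  by_contra hg
  have hinj : ∀ i j : ℕ, π g ^ i = π g ^ j → i = j := by
    have : ∀ i j : ℕ, i ≤ j → π g ^ i = π g ^ j → i = j := by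
      intro i j hij h
      by_contra hne
      apply hg
      apply htf _ (j - i) (by omega)
      have h2 : π g ^ j = π g ^ i * π g ^ (j - i) := by rw [← pow_add]; congr 1; omega
      rw [h2] at h
      exact left_eq_mul.1 h
    intro i j h
    rcases le_total i j with h1 | h1
    · exact this i j h1 h
    · exact (this j i h1 h.symm).symm
  obtain ⟨Φ, hΦ, hn⟩ := hS y hy hy1
  obtain ⟨S, hSf, hyS⟩ := nc_fin y (hker hy)
  -- choose k
  have hfin : {k : ℕ | ∃ s ∈ S, π g ^ k * π s ∈ Φ}.Finite := by
    have : {k : ℕ | ∃ s ∈ S, π g ^ k * π s ∈ Φ} ⊆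
      ⋃ s ∈ S, (fun k : ℕ => π g ^ k * π s) ⁻¹' Φ := by
      rintro k ⟨s, hs, h⟩
      simp only [Set.mem_iUnion]
      exact ⟨s, hs, h⟩
    refine Set.Finite.subset (hSf.biUnion fun s _ => Set.Finite.preimage ?_ hΦ) this
    intro i _ j _ h
    exact hinj i j (mul_right_cancel h)
  obtain ⟨k, hk⟩ := hfin.infinite_compl.nonempty
  apply hn
  have e : g ^ k * y * (g ^ k)⁻¹ = y := by
    have : Commute g y := hc
    rw [(this.pow_left k).eq, mul_inv_cancel_right]
  rw [← e]
  have h1 : Subgroup.closure ((fun g => g * r * g⁻¹) '' S) ≤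
      (Subgroup.closure {x | ∃ g, π g ∉ Φ ∧ x = g * r * g⁻¹}).comap
        (MulAut.conj (g ^ k)).toMonoidHom := by
    rw [Subgroup.closure_le]
    rintro _ ⟨s, hs, rfl⟩
    refine Subgroup.subset_closure ⟨g ^ k * s, ?_, ?_⟩
    · intro h
      exact hk ⟨s, hs, by simpa using h⟩
    · change g ^ k * (s * r * s⁻¹) * (g ^ k)⁻¹ = _
      group
  exact h1 hyS

end comm

section vz
lemma tf_vz (E : Type) [Group E] (tf : ∀ (g : E) (m : ℕ), 1 ≤ m → g ^ m = 1 → g = 1) (a : E) (ha : a ≠ 1)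
    (fi : (Subgroup.zpowers a).FiniteIndex) : Nonempty (E ≃* Multiplicative ℤ) := by
  have tfz : ∀ i : ℤ, a ^ i = 1 → i = 0 := by
    intro i hi
    by_contra h
    apply ha
    apply tf a i.natAbs (by omega)
    rw [← zpow_natCast]
    rcases Int.natAbs_eq i with h1 | h1
    · rw [← h1]; exact hi
    · rw [← inv_inj, ← zpow_neg, ← h1, inv_one]; exact hi
  -- normal core
  set N := (Subgroup.zpowers a).normalCore with hN
  have hNfi : N.FiniteIndex := inferInstance
  have hcen : N ≤ Subgroup.center E := by
    intro x hx
    rw [Subgroup.mem_center_iff]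
    intro g
    have hx1 : x ∈ Subgroup.zpowers a := Subgroup.normalCore_le _ hx
    have hx2 : g * x * g⁻¹ ∈ Subgroup.zpowers a :=
      Subgroup.normalCore_le _ ((inferInstance : N.Normal).conj_mem x hx g)
    obtain ⟨k, rfl⟩ := Subgroup.mem_zpowers_iff.1 hx1
    obtain ⟨l, hl⟩ := Subgroup.mem_zpowers_iff.1 hx2
    suffices hkl : k = l by
      subst hkl
      exact (mul_inv_eq_iff_eq_mul.1 hl.symm)
    obtain ⟨m, hm0, -, hm⟩ := (Subgroup.zpowers a).exists_pow_mem_of_index_ne_zero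
      fi.index_ne_zero g
    obtain ⟨i, hi⟩ := Subgroup.mem_zpowers_iff.1 hm
    have hit : ∀ j : ℕ, g ^ j * a ^ (k ^ j) * (g ^ j)⁻¹ = a ^ (l ^ j) := by
      intro j
      induction j with
      | zero => simp
      | succ j ih =>
        have e1 : g ^ (j + 1) * a ^ (k ^ (j + 1)) * (g ^ (j + 1))⁻¹ =
            g * ((g ^ j * a ^ (k ^ j) * (g ^ j)⁻¹) ^ k) * g⁻¹ := by
          rw [conj_zpow, pow_succ' g, pow_succ k, zpow_mul]; group
        rw [e1, ih, ← zpow_mul, mul_comm, zpow_mul, ← conj_zpow, ← hl, ← zpow_mul, pow_succ, mul_comm]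
    have h3 := hit m
    rw [← hi, ← zpow_neg, ← zpow_add, ← zpow_add] at h3
    have h4 : k ^ m = l ^ m := by
      have : a ^ (k ^ m - l ^ m) = 1 := by
        rw [zpow_sub, ← h3]; group
      have := tfz _ this
      omega
    have h5 : k.natAbs = l.natAbs := by
      have := congrArg Int.natAbs h4
      rw [Int.natAbs_pow, Int.natAbs_pow] at this
      exact Nat.pow_left_injective (by omega) this
    rcases Int.natAbs_eq_natAbs_iff.1 h5 with h6 | h6
    · exact h6
    · have h7 : g * a ^ i * g⁻¹ = a ^ i := by
        rw [hi, ← pow_succ', pow_succ]; group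
      have h8 : a ^ (i * k) = a ^ (i * l) := by
        rw [zpow_mul, ← h7, conj_zpow, ← zpow_mul, mul_comm i k, zpow_mul, ← conj_zpow, ← hl,
          ← zpow_mul, mul_comm]
      have h9 : i * k - i * l = 0 := by
        apply tfz
        rw [zpow_sub, h8, mul_inv_cancel]
      rw [h6] at h9 ⊢
      have h10 : i * l = 0 := by linarith
      rcases mul_eq_zero.1 h10 with h11 | h11
      · rw [h11, zpow_zero] at hi
        have hg := tf g m hm0 hi.symm
        rw [hg] at hl
        have : a ^ (l - k) = 1 := by rw [zpow_sub, hl]; group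
        have := tfz _ this
        omega
      · omega
  have hcfi : (Subgroup.center E).FiniteIndex := Subgroup.finiteIndex_of_le hcen
  have hcom : ∀ x y : E, x * y = y * x := by
    have hinj : Function.Injective (MonoidHom.transferCenterPow E) := by
      rw [injective_iff_map_eq_one]
      intro g hg
      have := congrArg Subtype.val hg
      rw [MonoidHom.transferCenterPow_apply] at this
      exact tf g _ (Nat.one_le_iff_ne_zero.2 hcfi.index_ne_zero) this
    intro x y
    apply hinj
    rw [map_mul, map_mul]
    exact Subtype.ext (Subgroup.mem_center_iff.1 (MonoidHom.transferCenterPow E y).2 _)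
  have hnorm : (Subgroup.zpowers a).Normal := ⟨fun x hx g => by
    rw [hcom g x, mul_inv_cancel_right]; exact hx⟩
  let f : E →* Subgroup.zpowers a :=
    { toFun := fun g => ⟨g ^ (Subgroup.zpowers a).index, Subgroup.pow_index_mem _ g⟩
      map_one' := Subtype.ext (one_pow _)
      map_mul' := fun x y => Subtype.ext ((show Commute x y from hcom x y).mul_pow _) }
  have hf : Function.Injective f := by
    rw [injective_iff_map_eq_one]
    intro g hg
    exact tf g _ (Nat.one_le_iff_ne_zero.2 fi.index_ne_zero) (congrArg Subtype.val hg)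
  have : IsCyclic E := isCyclic_of_injective f hf
  have : Infinite E := Infinite.of_injective (fun i : ℤ => a ^ i) (by
    intro i j hij
    have : a ^ (i - j) = 1 := by
      simp only at hij
      rw [zpow_sub, hij, mul_inv_cancel]
    have := tfz _ this
    omega)
  exact ⟨(intCyclicMulEquiv (G := E)).symm⟩
end vz
end OneRel

namespace OneRel
open FreeGroup (of)

/-- The commensurator of `⟨a⟩`. -/
def Ecom {G : Type} [Group G] (a : G) : Subgroup G where
  carrier := {g | ∃ k l : ℤ, k ≠ 0 ∧ l ≠ 0 ∧ g * a ^ k * g⁻¹ = a ^ l}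
  one_mem' := ⟨1, 1, one_ne_zero, one_ne_zero, by simp⟩
  mul_mem' := by
    rintro g h ⟨k, l, hk, hl, e⟩ ⟨k', l', hk', hl', e'⟩
    refine ⟨k' * k, l * l', mul_ne_zero hk' hk, mul_ne_zero hl hl', ?_⟩
    have : g * h * a ^ (k' * k) * (g * h)⁻¹ = g * ((h * a ^ k' * h⁻¹) ^ k) * g⁻¹ := by
      rw [conj_zpow, zpow_mul]; group
    rw [this, e', ← zpow_mul, mul_comm, zpow_mul, ← conj_zpow, e, ← zpow_mul]
  inv_mem' := by
    rintro g ⟨k, l, hk, hl, e⟩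
    refine ⟨l, k, hl, hk, ?_⟩
    rw [← e]; group

lemma mem_Ecom {G : Type} [Group G] {a g : G} :
    g ∈ Ecom a ↔ ∃ k l : ℤ, k ≠ 0 ∧ l ≠ 0 ∧ g * a ^ k * g⁻¹ = a ^ l := Iff.rfl

lemma self_mem_Ecom {G : Type} [Group G] (a : G) : a ∈ Ecom a :=
  ⟨1, 1, one_ne_zero, one_ne_zero, by simp⟩

lemma quot_tf {X : Type} (R : FreeGroup X) (hR1 : R ≠ 1) (hR : NonPow R)
    (q : Gq R 1) (m : ℕ) (hm : 1 ≤ m) (h : q ^ m = 1) : q = 1 := by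
  induction q using QuotientGroup.induction_on with
  | H w =>
    rw [← QuotientGroup.mk_pow, QuotientGroup.eq_one_iff] at h
    rw [QuotientGroup.eq_one_iff]
    exact (main_thm R hR1).tf hR w m hm h

lemma ker_pq_le {X : Type} (R : FreeGroup X) (n : ℕ) :
    (pq R n).ker ≤ Subgroup.normalClosure {(QuotientGroup.mk R : Gq R n)} := by
  intro g hg
  induction g using QuotientGroup.induction_on with
  | H w =>
    have h1 : w ∈ NN R 1 := (QuotientGroup.eq_one_iff w).1 hg
    have h2 : NN R 1 ≤ (Subgroup.normalClosure {(QuotientGroup.mk R : Gq R n)}).comap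
        (QuotientGroup.mk' _) := by
      apply Subgroup.normalClosure_le_normal
      rw [Set.singleton_subset_iff, pow_one]
      exact Subgroup.subset_normalClosure (Set.mem_singleton _)
    exact h2 h1

lemma ker_pq {X : Type} (R : FreeGroup X) (n : ℕ) :
    (pq R n).ker = Subgroup.normalClosure {(QuotientGroup.mk R : Gq R n)} := by
  refine le_antisymm (ker_pq_le R n) ?_
  apply Subgroup.normalClosure_le_normal
  rw [Set.singleton_subset_iff]
  exact (QuotientGroup.eq_one_iff R).2 (mem_NN1 R)

theorem malnormal_part {X : Type} (R : FreeGroup X) (hR1 : R ≠ 1) (hR : NonPow R) (n : ℕ) (hn : 1 < n)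
    (A : Subgroup (Gq R n)) (hA : VirtuallyZ A) (hAT : ¬ A ≤ (pq R n).ker) :
    ∃ M : Subgroup (Gq R n), M.IsMalnormal ∧ Nonempty (M ≃* Multiplicative ℤ) ∧ A ≤ M := by
  have : Fact (1 < n) := ⟨hn⟩
  set π := pq R n with hπ
  have tfQ := quot_tf R hR1 hR
  have hC : ∀ y g, π y = 1 → y ≠ 1 → g * y = y * g → π g = 1 := fun y g h1 h2 h3 =>
    comm_ker ((main_thm R hR1).sep n (by omega)) (ker_pq_le R n) tfQ y g h1 h2 h3
  -- the element `a`
  obtain ⟨a, haA, hpow⟩ : ∃ a ∈ A, ∀ g ∈ A, ∃ m : ℕ, 1 ≤ m ∧ ∃ j : ℤ, g ^ m = a ^ j := by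
    obtain ⟨H0, hfi, ⟨e⟩⟩ := hA
    refine ⟨((e.symm (Multiplicative.ofAdd 1) : H0) : A), (((e.symm (Multiplicative.ofAdd 1) : H0) : A)).2, ?_⟩
    intro g hg
    obtain ⟨m, hm, -, h1⟩ := H0.exists_pow_mem_of_index_ne_zero hfi.index_ne_zero ⟨g, hg⟩
    refine ⟨m, hm, Multiplicative.toAdd (e ⟨_, h1⟩), ?_⟩
    have h2 : e.symm (Multiplicative.ofAdd 1) ^ (Multiplicative.toAdd (e ⟨_, h1⟩)) =
        (⟨_, h1⟩ : H0) := by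
      rw [← map_zpow, ← ofAdd_zsmul, smul_eq_mul, mul_one, ofAdd_toAdd, MulEquiv.symm_apply_apply]
    have h3 := congrArg (fun z : H0 => ((z : A) : Gq R n)) h2
    simpa using h3.symm
  obtain ⟨g0, hg0, hg0T⟩ := Set.not_subset.1 hAT
  have hpa : π a ≠ 1 := by
    intro h
    obtain ⟨m, hm, j, hj⟩ := hpow g0 hg0
    apply hg0T
    rw [SetLike.mem_coe, MonoidHom.mem_ker]
    apply tfQ _ m hm
    rw [← map_pow, hj, map_zpow, h, one_zpow]
  have hb : ∀ i : ℤ, π a ^ i = 1 → i = 0 := by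
    intro i hi
    by_contra h
    apply hpa
    apply tfQ _ i.natAbs (by omega)
    rw [← zpow_natCast]
    rcases Int.natAbs_eq i with h1 | h1
    · rw [← h1]; exact hi
    · rw [← inv_inj, ← zpow_neg, ← h1, inv_one]; exact hi
  have hb' : ∀ i j : ℤ, a ^ i = a ^ j → i = j := by
    intro i j h
    have := hb (i - j) (by rw [← map_zpow, zpow_sub, h, mul_inv_cancel, map_one])
    omega
  have hET : ∀ g ∈ Ecom a, π g = 1 → g = 1 := by
    rintro g ⟨k, l, hk, hl, e⟩ hg
    by_contra hg1
    have h1 : π a ^ k = π a ^ l := by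
      rw [← map_zpow, ← map_zpow, ← e, map_mul, map_mul, map_inv, hg]; simp
    have h2 : k = l := by
      have := hb (k - l) (by rw [zpow_sub, h1, mul_inv_cancel])
      omega
    subst h2
    have h3 := hC g (a ^ k) hg hg1 (mul_inv_eq_iff_eq_mul.1 e).symm
    rw [map_zpow] at h3
    exact hk (hb k h3)
  have hEinj : ∀ g ∈ Ecom a, ∀ h ∈ Ecom a, π g = π h → g = h := by
    intro g hg h hh e
    have := hET (g * h⁻¹) (Subgroup.mul_mem _ hg (Subgroup.inv_mem _ hh)) (by
      rw [map_mul, map_inv, e, mul_inv_cancel])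
    exact mul_inv_eq_one.1 this
  have tfE : ∀ (g : Ecom a) (m : ℕ), 1 ≤ m → g ^ m = 1 → g = 1 := by
    intro g m hm h
    apply Subtype.ext
    apply hET _ g.2
    apply tfQ _ m hm
    rw [← map_pow, ← Subgroup.coe_pow, h, Subgroup.coe_one, map_one]
  let a' : Ecom a := ⟨a, self_mem_Ecom a⟩
  have ha' : a' ≠ 1 := fun h => hpa (by rw [show a = 1 from congrArg Subtype.val h, map_one])
  have hfi : (Subgroup.zpowers a').FiniteIndex := by
    obtain ⟨W, hW, hcos⟩ := (foxD_isFox R n).cosets a hb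
    have h1 : ∀ g : Ecom a, ∃ w : W, ∃ i : ℤ, π g = w * π a ^ i := by
      rintro ⟨g, k, l, hk, hl, e⟩
      obtain ⟨w, hw, i, hi⟩ := hcos g k l hk hl e
      exact ⟨⟨w, hw⟩, i, hi⟩
    choose w i hwi using h1
    have : Finite W := hW.to_subtype
    have : Finite (Ecom a ⧸ Subgroup.zpowers a') := by
      refine Finite.of_injective (fun c => w (Quotient.out c)) ?_
      intro c d hcd
      simp only at hcd
      rw [← QuotientGroup.out_eq' c, ← QuotientGroup.out_eq' d]
      set g := Quotient.out c
      set h := Quotient.out d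
      rw [QuotientGroup.eq, Subgroup.mem_zpowers_iff]
      refine ⟨i h - i g, ?_⟩
      apply Subtype.ext
      apply hEinj _ (Subtype.property _) _ (Subtype.property _)
      rw [Subgroup.coe_mul, map_mul, Subgroup.coe_inv, map_inv, hwi g, hwi h, hcd, Subgroup.coe_zpow,
        map_zpow, mul_inv_rev, mul_assoc, inv_mul_cancel_left, ← zpow_neg, ← zpow_add]
      congr 1
      ring
    exact Subgroup.finiteIndex_of_finite_quotient
  refine ⟨Ecom a, ?_, tf_vz _ tfE a' ha' hfi, ?_⟩
  · rintro g ⟨x, hx1, hx, hgx⟩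
    have key : ∀ x ∈ Ecom a, x ≠ 1 → ∃ m : ℕ, 1 ≤ m ∧ ∃ j : ℤ, j ≠ 0 ∧ x ^ m = a ^ j := by
      intro x hx hx1
      obtain ⟨m, hm, -, h1⟩ := (Subgroup.zpowers a').exists_pow_mem_of_index_ne_zero
        hfi.index_ne_zero ⟨x, hx⟩
      obtain ⟨j, hj⟩ := Subgroup.mem_zpowers_iff.1 h1
      refine ⟨m, hm, j, ?_, (congrArg Subtype.val hj).symm⟩
      rintro rfl
      rw [zpow_zero] at hj
      exact hx1 (congrArg Subtype.val (tfE _ m hm hj.symm))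
    obtain ⟨m, hm, j, hj, e1⟩ := key x hx hx1
    obtain ⟨m', hm', j', hj', e2⟩ := key _ hgx (by
      intro h
      apply hx1
      have := mul_inv_eq_one.1 h
      simpa using this)
    refine ⟨j * m', j' * m, mul_ne_zero hj (by omega), mul_ne_zero hj' (by omega), ?_⟩
    rw [zpow_mul, ← e1, zpow_mul, ← e2, zpow_natCast, zpow_natCast, conj_pow, conj_pow, ← pow_mul, ← pow_mul, mul_comm]
  · intro g hg
    obtain ⟨m, hm, j, hj⟩ := hpow (g * a * g⁻¹) (A.mul_mem (A.mul_mem hg haA) (A.inv_mem hg))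
    refine ⟨m, j, by omega, ?_, ?_⟩
    · rintro rfl
      rw [conj_pow, zpow_zero] at hj
      have h1 : a ^ m = 1 := by
        have := mul_inv_eq_one.1 hj
        simpa using this
      have := hb' m 0 (by rw [zpow_natCast, h1, zpow_zero])
      omega
    · rw [zpow_natCast, ← conj_pow, hj]

end OneRel

namespace OneRel
open FreeGroup (of)

noncomputable def decEquiv {X : Type} (x : X) (R0 : FreeGroup ({x}ᶜ : Set X)) (n : ℕ) :
    Gq (incl {x}ᶜ R0) n ≃* Monoid.Coprod (Gq R0 n) (Multiplicative ℤ) := by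
  classical
  let f0 : FreeGroup X →* Monoid.Coprod (Gq R0 n) (Multiplicative ℤ) :=
    FreeGroup.lift fun y => if h : y ∈ ({x}ᶜ : Set X) then
      Monoid.Coprod.inl (QuotientGroup.mk (of ⟨y, h⟩)) else Monoid.Coprod.inr (Multiplicative.ofAdd 1)
  have hf0 : ∀ w, f0 (incl {x}ᶜ w) = Monoid.Coprod.inl (QuotientGroup.mk w) := by
    intro w
    have : f0.comp (incl {x}ᶜ) = Monoid.Coprod.inl.comp (QuotientGroup.mk' _) := by
      ext ⟨y, hy⟩
      have hy' : ¬ y = x := hy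
      simp [f0, incl, hy']
    exact DFunLike.congr_fun this w
  have hf1 : f0 (of x) = Monoid.Coprod.inr (Multiplicative.ofAdd 1) := by simp [f0]
  let f : Gq (incl {x}ᶜ R0) n →* Monoid.Coprod (Gq R0 n) (Multiplicative ℤ) :=
    QuotientGroup.lift _ f0 (fun w hw => NN_le_ker f0 _ n (by
      rw [hf0, ← map_pow, mk_pow_eq_one, map_one]) hw)
  let g1 : Gq R0 n →* Gq (incl {x}ᶜ R0) n :=
    QuotientGroup.map _ _ (incl {x}ᶜ) (NN_map_le _ R0 n)
  let g : Monoid.Coprod (Gq R0 n) (Multiplicative ℤ) →* Gq (incl {x}ᶜ R0) n :=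
    Monoid.Coprod.lift g1 (zpowersHom _ (QuotientGroup.mk (of x)))
  refine MonoidHom.toMulEquiv f g ?_ ?_
  · apply QuotientGroup.monoidHom_ext
    ext y
    simp only [MonoidHom.comp_apply, QuotientGroup.mk'_apply, MonoidHom.id_apply]
    change g (f0 (of y)) = _
    by_cases hy : y = x
    · subst hy
      rw [hf1]
      simp [g]
    · have : of y = incl {x}ᶜ (of (⟨y, hy⟩ : ({x}ᶜ : Set X))) :=
        (incl_of {x}ᶜ (⟨y, hy⟩ : ({x}ᶜ : Set X))).symm
      rw [this, hf0]
      simp [g, g1]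
  · apply Monoid.Coprod.hom_ext
    · apply QuotientGroup.monoidHom_ext
      ext y
      simp only [MonoidHom.comp_apply, QuotientGroup.mk'_apply, MonoidHom.id_apply, g,
        Monoid.Coprod.lift_apply_inl]
      exact hf0 (of y)
    · ext
      simp only [MonoidHom.comp_apply, MonoidHom.id_apply, g, Monoid.Coprod.lift_apply_inr,
        zpowersHom_apply, toAdd_ofAdd, zpow_one]
      exact hf1

lemma Gq_nontrivial {X : Type} [Nonempty X] (R : FreeGroup X) (n : ℕ) (hn : 1 < n) :
    Nontrivial (Gq R n) := by
  have : Fact (1 < n) := ⟨hn⟩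
  obtain ⟨x⟩ := ‹Nonempty X›
  let f0 : FreeGroup X →* Multiplicative (ZMod n) := FreeGroup.lift fun _ => Multiplicative.ofAdd 1
  let f : Gq R n →* Multiplicative (ZMod n) := QuotientGroup.lift _ f0
    (fun w hw => NN_le_ker f0 _ n (by
      apply Multiplicative.toAdd.injective
      rw [toAdd_pow]
      simp) hw)
  refine ⟨QuotientGroup.mk (of x), 1, fun h => ?_⟩
  have h1 := congrArg f h
  rw [map_one] at h1
  have h2 : f (QuotientGroup.mk (of x)) = Multiplicative.ofAdd 1 := by
    change f0 (of x) = _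
    simp [f0]
  rw [h2] at h1
  simp at h1

lemma decomp {X : Type} [Nontrivial X] (R : FreeGroup X) (n : ℕ) (hn : 1 < n) (x : X)
    (h : CI {x}ᶜ R) : FreelyDecomposable (Gq R n) := by
  have h1 := h.isConj_proj
  have h2 := NN_conj h1 n
  have e : Gq R n ≃* Gq (incl {x}ᶜ (proj {x}ᶜ R)) n := QuotientGroup.quotientMulEquivOfEq h2
  obtain ⟨y, hy⟩ := exists_ne x
  have : Nonempty ({x}ᶜ : Set X) := ⟨⟨y, hy⟩⟩
  exact ⟨Gq (proj {x}ᶜ R) n, Multiplicative ℤ, inferInstance, inferInstance,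
    Gq_nontrivial _ n hn, inferInstance, ⟨e.trans (decEquiv x _ n)⟩⟩

lemma FreelyDecomposable.of_equiv {G G' : Type} [Group G] [Group G'] (e : G ≃* G')
    (h : FreelyDecomposable G') : FreelyDecomposable G := by
  obtain ⟨H, K, gH, gK, h1, h2, ⟨f⟩⟩ := h
  exact ⟨H, K, gH, gK, h1, h2, ⟨e.trans f⟩⟩

lemma NN_mulEquiv {X Y : Type} (j : FreeGroup X ≃* FreeGroup Y) (R : FreeGroup X) (n : ℕ) :
    (NN R n).map j.toMonoidHom = NN (j R) n := by
  apply le_antisymm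
  · rw [Subgroup.map_le_iff_le_comap]
    exact NN_map_le j.toMonoidHom R n
  · intro w hw
    refine ⟨j.symm w, ?_, by simp⟩
    have := NN_map_le j.symm.toMonoidHom (j R) n hw
    simpa using this

noncomputable def Gq_equiv {X Y : Type} (j : FreeGroup X ≃* FreeGroup Y) (R : FreeGroup X) (n : ℕ) :
    Gq R n ≃* Gq (j R) n :=
  QuotientGroup.congr _ _ j (NN_mulEquiv j R n)

lemma finite_of_not_CI {X : Type} (R : FreeGroup X) (h : ∀ x, ¬ CI {x}ᶜ R) : Finite X := by
  classical
  obtain ⟨L, hL, -, hc⟩ := exists_cycred R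
  have : (Set.univ : Set X) ⊆ (L.map Prod.fst).toFinset := by
    intro x _
    by_contra hcon
    apply h x
    refine ⟨FreeGroup.mk L, mk_mem_gen _ _ ?_, hc⟩
    rintro l hl rfl
    exact hcon (List.mem_toFinset.2 (List.mem_map.2 ⟨l, hl, rfl⟩))
  exact Set.finite_univ_iff.1 ((Finset.finite_toSet _).subset this)

end OneRel

namespace OneRel
open FreeGroup (of)

section paths
variable {V E : Type}

/-- group elements represented by edge paths using edges satisfying `ok` -/
inductive Pth (o τ : E → V) (ok : E → Prop) : V → V → FreeGroup E → Prop
  | one (a : V) : Pth o τ ok a a 1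
  | edge (e : E) (h : ok e) : Pth o τ ok (o e) (τ e) (of e)
  | mul {a b c : V} {g h : FreeGroup E} : Pth o τ ok a b g → Pth o τ ok b c h → Pth o τ ok a c (g * h)
  | inv {a b : V} {g : FreeGroup E} : Pth o τ ok a b g → Pth o τ ok b a g⁻¹

variable {o τ : E → V} {ok ok' : E → Prop}

lemma Pth.mono (h : ∀ e, ok e → ok' e) {a b : V} {g : FreeGroup E} (hp : Pth o τ ok a b g) :
    Pth o τ ok' a b g := by
  induction hp with
  | one a => exact .one a
  | edge e he => exact .edge e (h e he)
  | mul _ _ h1 h2 => exact h1.mul h2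
  | inv _ h1 => exact h1.inv

open Classical in
/-- conditional element -/
noncomputable def pw {G : Type} [Group G] (x : G) (p : Prop) : G := if p then x else 1

lemma pw_pos {G : Type} [Group G] (x : G) {p : Prop} (h : p) : pw x p = x := by
  unfold pw; rw [if_pos h]
lemma pw_neg {G : Type} [Group G] (x : G) {p : Prop} (h : ¬ p) : pw x p = 1 := by
  unfold pw; rw [if_neg h]
lemma map_pw {G H : Type} [Group G] [Group H] (f : G →* H) (x : G) (p : Prop) :
    f (pw x p) = pw (f x) p := by
  by_cases h : p
  · rw [pw_pos _ h, pw_pos _ h]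
  · rw [pw_neg _ h, pw_neg _ h, map_one]
lemma pw_mul {G : Type} [Group G] (x y : G) (p : Prop) : pw (x * y) p = pw x p * pw y p := by
  by_cases h : p
  · simp only [pw_pos _ h]
  · simp only [pw_neg _ h, mul_one]
lemma pw_inv {G : Type} [Group G] (x : G) (p : Prop) : pw (x⁻¹) p = (pw x p)⁻¹ := by
  by_cases h : p
  · simp only [pw_pos _ h]
  · simp only [pw_neg _ h, inv_one]
lemma pw_one {G : Type} [Group G] (p : Prop) : pw (1 : G) p = 1 := by
  unfold pw; split_ifs <;> rfl

/-- homs which are, on edges, twisted by an element at the vertex `v` are twisted on all paths -/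
lemma Pth.twist {G : Type} [Group G] {Q1 Q2 : FreeGroup E →* G} {x : G} {v : V}
    (h : ∀ e, ok e → Q1 (of e) = (pw x (o e = v))⁻¹ * Q2 (of e) * pw x (τ e = v))
    {a b : V} {g : FreeGroup E} (hp : Pth o τ ok a b g) :
    Q1 g = (pw x (a = v))⁻¹ * Q2 g * pw x (b = v) := by
  induction hp with
  | one a => simp
  | edge e he => exact h e he
  | mul _ _ h1 h2 => rw [map_mul, h1, h2, map_mul]; group
  | inv _ h1 => rw [map_inv, h1, map_inv]; group

lemma Pth.exists_edge {v a b : V} {g : FreeGroup E} (hp : Pth o τ ok a b g) (ha : a = v) (hb : b ≠ v) :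
    ∃ e, ok e ∧ ((o e = v ∧ τ e ≠ v) ∨ (τ e = v ∧ o e ≠ v)) := by
  by_contra hcon
  push Not at hcon
  have : ∀ {a b : V} {g : FreeGroup E}, Pth o τ ok a b g → (a = v ↔ b = v) := by
    intro a b g hp
    induction hp with
    | one a => rfl
    | edge e he =>
      have h1 := hcon e he
      tauto
    | mul _ _ h1 h2 => exact h1.trans h2
    | inv _ h1 => exact h1.symm
  exact hb ((this hp).1 ha)

end paths

section elim
variable {V E : Type} (o τ : E → V) (ok : E → Prop) (v u w : V) (e0 : E) (c κ : FreeGroup E)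

open Classical in
noncomputable def eo (f : E → V) : ({e0}ᶜ : Set E) → V := fun e =>
  if f e = v then (if ok e then u else w) else f e

open Classical in
noncomputable def Sg0 : FreeGroup E →* FreeGroup E := FreeGroup.lift fun e =>
  if ok e then (pw c (o e = v))⁻¹ * of e * pw c (τ e = v) else
    (pw κ (o e = v))⁻¹ * of e * pw κ (τ e = v)

noncomputable def Sg : FreeGroup ({e0}ᶜ : Set E) →* FreeGroup E := (Sg0 o τ ok v c κ).comp (incl {e0}ᶜ)

open Classical in
noncomputable def Pg : FreeGroup E →* FreeGroup ({e0}ᶜ : Set E) := FreeGroup.lift fun e =>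
  if ok e then (pw (proj {e0}ᶜ κ) (o e = v))⁻¹ * proj {e0}ᶜ (of e) * pw (proj {e0}ᶜ κ) (τ e = v) else
    proj {e0}ᶜ (of e)

lemma Sg0_ok (e : E) (h : ok e) :
    Sg0 o τ ok v c κ (of e) = (pw c (o e = v))⁻¹ * of e * pw c (τ e = v) := by simp [Sg0, h]
lemma Sg0_not (e : E) (h : ¬ ok e) :
    Sg0 o τ ok v c κ (of e) = (pw κ (o e = v))⁻¹ * of e * pw κ (τ e = v) := by simp [Sg0, h]
lemma Pg_ok (e : E) (h : ok e) : Pg o τ ok v e0 κ (of e) =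
    (pw (proj {e0}ᶜ κ) (o e = v))⁻¹ * proj {e0}ᶜ (of e) * pw (proj {e0}ᶜ κ) (τ e = v) := by
  simp [Pg, h]
lemma Pg_not (e : E) (h : ¬ ok e) : Pg o τ ok v e0 κ (of e) = proj {e0}ᶜ (of e) := by
  simp [Pg, h]

structure ElimH : Prop where
  uv : u ≠ v
  wv : w ≠ v
  ok0 : ok e0
  hc : (c = of e0 ∧ o e0 = v ∧ τ e0 = u) ∨ (c = (of e0)⁻¹ ∧ τ e0 = v ∧ o e0 = u)
  hκ : Pth o τ ok v w κ

variable {o τ ok v u w e0 c κ}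

lemma proj_e0 : proj {e0}ᶜ (of e0) = 1 := by simp [proj]

lemma proj_ne (e : ({e0}ᶜ : Set E)) : proj {e0}ᶜ (of (e : E)) = of e := by
  rw [← incl_of, proj_incl]

namespace ElimH
lemma pc (H : ElimH o τ ok v u w e0 c κ) : Pth o τ ok v u c := by
  rcases H.hc with ⟨rfl, h1, h2⟩ | ⟨rfl, h1, h2⟩
  · have := Pth.edge (o := o) (τ := τ) e0 H.ok0
    rwa [h1, h2] at this
  · have := (Pth.edge (o := o) (τ := τ) e0 H.ok0).inv
    rwa [h1, h2] at this

lemma proj_c (H : ElimH o τ ok v u w e0 c κ) : proj {e0}ᶜ c = 1 := by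
  rcases H.hc with ⟨rfl, -, -⟩ | ⟨rfl, -, -⟩
  · exact proj_e0
  · rw [map_inv, proj_e0, inv_one]

lemma Sg0_e0 (H : ElimH o τ ok v u w e0 c κ) : Sg0 o τ ok v c κ (of e0) = 1 := by
  rw [Sg0_ok _ _ _ _ _ _ _ H.ok0]
  rcases H.hc with ⟨rfl, h1, h2⟩ | ⟨rfl, h1, h2⟩
  · rw [h1, h2, pw_pos _ rfl, pw_neg _ H.uv]; group
  · rw [h1, h2, pw_pos _ rfl, pw_neg _ H.uv]; group

lemma Sg_proj (H : ElimH o τ ok v u w e0 c κ) (g : FreeGroup E) :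
    Sg o τ ok v e0 c κ (proj {e0}ᶜ g) = Sg0 o τ ok v c κ g := by
  have : (Sg o τ ok v e0 c κ).comp (proj {e0}ᶜ) = Sg0 o τ ok v c κ := by
    ext e
    by_cases he : e = e0
    · subst he
      rw [MonoidHom.comp_apply, proj_e0, H.Sg0_e0, map_one]
    · rw [MonoidHom.comp_apply, proj_ne ⟨e, he⟩, Sg, MonoidHom.comp_apply, incl_of]
  exact DFunLike.congr_fun this g

lemma L1 (H : ElimH o τ ok v u w e0 c κ) {a b : V} {g : FreeGroup E} (hp : Pth o τ ok a b g) :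
    Sg o τ ok v e0 c κ (proj {e0}ᶜ g) = (pw c (a = v))⁻¹ * g * pw c (b = v) := by
  rw [H.Sg_proj]
  exact hp.twist (Q2 := MonoidHom.id _) fun e he => Sg0_ok _ _ _ _ _ _ _ he

lemma Sg_ghat (H : ElimH o τ ok v u w e0 c κ) :
    Sg o τ ok v e0 c κ (proj {e0}ᶜ κ) = c⁻¹ * κ := by
  rw [H.L1 H.hκ, pw_pos _ rfl, pw_neg _ H.wv, mul_one]

lemma L2 {a b : V} {g : FreeGroup E} (hp : Pth o τ ok a b g) : Pg o τ ok v e0 κ g =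
    (pw (proj {e0}ᶜ κ) (a = v))⁻¹ * proj {e0}ᶜ g * pw (proj {e0}ᶜ κ) (b = v) :=
  hp.twist fun e he => Pg_ok _ _ _ _ _ _ e he

lemma Pg_κ (H : ElimH o τ ok v u w e0 c κ) : Pg o τ ok v e0 κ κ = 1 := by
  rw [L2 H.hκ, pw_pos _ rfl, pw_neg _ H.wv]; group

lemma Pg_c (H : ElimH o τ ok v u w e0 c κ) : Pg o τ ok v e0 κ c = (proj {e0}ᶜ κ)⁻¹ := by
  rw [L2 H.pc, pw_pos _ rfl, pw_neg _ H.uv, H.proj_c]; group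

lemma L3 (H : ElimH o τ ok v u w e0 c κ) (g : FreeGroup ({e0}ᶜ : Set E)) :
    Pg o τ ok v e0 κ (Sg o τ ok v e0 c κ g) = g := by
  have : (Pg o τ ok v e0 κ).comp (Sg o τ ok v e0 c κ) = MonoidHom.id _ := by
    ext e
    rw [MonoidHom.comp_apply, Sg, MonoidHom.comp_apply, incl_of, MonoidHom.id_apply]
    by_cases he : ok e
    · rw [Sg0_ok _ _ _ _ _ _ _ he, map_mul, map_mul, map_inv, map_pw, map_pw, H.Pg_c, Pg_ok _ _ _ _ _ _ _ he,
        proj_ne, pw_inv, pw_inv]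
      group
    · rw [Sg0_not _ _ _ _ _ _ _ he, map_mul, map_mul, map_inv, map_pw, map_pw, H.Pg_κ, Pg_not _ _ _ _ _ _ _ he,
        proj_ne, pw_one, pw_one]
      group
  exact DFunLike.congr_fun this g

lemma L4 (H : ElimH o τ ok v u w e0 c κ) {ok' : E → Prop} {a b : V} {g : FreeGroup E}
    (hp : Pth o τ ok' a b g) :
    Sg o τ ok v e0 c κ (Pg o τ ok v e0 κ g) = (pw κ (a = v))⁻¹ * g * pw κ (b = v) := by
  refine hp.twist (Q1 := (Sg o τ ok v e0 c κ).comp (Pg o τ ok v e0 κ)) (Q2 := MonoidHom.id _) ?_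
  intro e _
  rw [MonoidHom.comp_apply, MonoidHom.id_apply]
  by_cases he : ok e
  · rw [Pg_ok _ _ _ _ _ _ _ he, map_mul, map_mul, map_inv, map_pw, map_pw, H.Sg_ghat, H.Sg_proj,
      Sg0_ok _ _ _ _ _ _ _ he, pw_mul, pw_mul, pw_inv, pw_inv]
    group
  · rw [Pg_not _ _ _ _ _ _ _ he, H.Sg_proj, Sg0_not _ _ _ _ _ _ _ he]

/-- replace `v` by `u` -/
noncomputable def _root_.OneRel.st {V : Type} (v u a : V) : V := by
  classical exact if a = v then u else a

lemma _root_.OneRel.st_pos {V : Type} {v u a : V} (h : a = v) : st v u a = u := by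
  unfold st; rw [if_pos h]

lemma _root_.OneRel.st_neg {V : Type} {v u a : V} (h : a ≠ v) : st v u a = a := by
  unfold st; rw [if_neg h]

/-- path with the twist at one vertex -/
lemma tw_path {V E : Type} {o τ : E → V} {ok : E → Prop} {a b a' b' v u : V} {g c : FreeGroup E}
    (hg : Pth o τ ok a b g) (hc : Pth o τ ok v u c) (ha : a' = st v u a)
    (hb : b' = st v u b) :
    Pth o τ ok a' b' ((pw c (a = v))⁻¹ * g * pw c (b = v)) := by
  subst ha hb
  refine (Pth.mul ?_ hg).mul ?_
  · by_cases h : a = v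
    · rw [st_pos h, pw_pos _ h, h]; exact hc.inv
    · rw [st_neg h, pw_neg _ h, inv_one]; exact .one _
  · by_cases h : b = v
    · rw [st_pos h, pw_pos _ h, h]; exact hc
    · rw [st_neg h, pw_neg _ h]; exact .one _

lemma tw2 {V E : Type} {o τ : E → V} {ok : E → Prop} {a b v u w : V} {g k : FreeGroup E}
    (hg : Pth o τ ok (st v u a) (st v u b) g) (hk : Pth o τ ok u w k) :
    Pth o τ ok (st v w a) (st v w b) ((pw k (a = v))⁻¹ * g * pw k (b = v)) := by
  refine (Pth.mul ?_ hg).mul ?_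
  · by_cases h : a = v
    · rw [st_pos h, st_pos h, pw_pos _ h]; exact hk.inv
    · rw [st_neg h, st_neg h, pw_neg _ h, inv_one]; exact .one _
  · by_cases h : b = v
    · rw [st_pos h, st_pos h, pw_pos _ h]; exact hk
    · rw [st_neg h, st_neg h, pw_neg _ h]; exact .one _

lemma eo_ok {f : E → V} (e : ({e0}ᶜ : Set E)) (h : ok e) : eo ok v u w e0 f e = st v u (f e) := by
  by_cases hv : f e = v
  · rw [st_pos hv]; simp [eo, hv, h]
  · rw [st_neg hv]; simp [eo, hv]

lemma eo_not {f : E → V} (e : ({e0}ᶜ : Set E)) (h : ¬ ok e) :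
    eo ok v u w e0 f e = st v w (f e) := by
  by_cases hv : f e = v
  · rw [st_pos hv]; simp [eo, hv, h]
  · rw [st_neg hv]; simp [eo, hv]

lemma eo_ne (H : ElimH o τ ok v u w e0 c κ) {f : E → V} (e : ({e0}ᶜ : Set E)) :
    eo ok v u w e0 f e ≠ v := by
  by_cases h : ok e
  · rw [eo_ok e h]
    by_cases hv : f e = v
    · rw [st_pos hv]; exact H.uv
    · rw [st_neg hv]; exact hv
  · rw [eo_not e h]
    by_cases hv : f e = v
    · rw [st_pos hv]; exact H.wv
    · rw [st_neg hv]; exact hv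

lemma L5 (H : ElimH o τ ok v u w e0 c κ) {a b : V} {g : FreeGroup ({e0}ᶜ : Set E)}
    (hp : Pth (eo ok v u w e0 o) (eo ok v u w e0 τ) (fun _ => True) a b g) :
    Pth o τ (fun _ => True) a b (Sg o τ ok v e0 c κ g) := by
  induction hp with
  | one a => rw [map_one]; exact .one a
  | edge e _ =>
    rw [Sg, MonoidHom.comp_apply, incl_of]
    by_cases he : ok e
    · rw [Sg0_ok _ _ _ _ _ _ _ he]
      exact tw_path (.edge (e : E) trivial) (H.pc.mono fun _ _ => trivial) (eo_ok e he) (eo_ok e he)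
    · rw [Sg0_not _ _ _ _ _ _ _ he]
      exact tw_path (.edge (e : E) trivial) (H.hκ.mono fun _ _ => trivial) (eo_not e he) (eo_not e he)
  | mul _ _ h1 h2 => rw [map_mul]; exact h1.mul h2
  | inv _ h1 => rw [map_inv]; exact h1.inv

lemma L5a (H : ElimH o τ ok v u w e0 c κ) {a b : V} {g : FreeGroup E} (hp : Pth o τ ok a b g) :
    Pth (eo ok v u w e0 o) (eo ok v u w e0 τ) (fun _ => True) (st v u a) (st v u b)
      (proj {e0}ᶜ g) := by
  induction hp with
  | one a => rw [map_one]; exact .one _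
  | edge e he =>
    by_cases h0 : e = e0
    · subst h0
      rw [proj_e0]
      have : st v u (o e) = st v u (τ e) := by
        rcases H.hc with ⟨-, h1, h2⟩ | ⟨-, h1, h2⟩
        · rw [h1, h2, st_pos rfl, st_neg H.uv]
        · rw [h1, h2, st_pos rfl, st_neg H.uv]
      rw [this]
      exact .one _
    · have h1 := Pth.edge (o := eo ok v u w e0 o) (τ := eo ok v u w e0 τ) (ok := fun _ => True)
        ⟨e, h0⟩ trivial
      rw [eo_ok _ he, eo_ok _ he] at h1
      rw [proj_ne ⟨e, h0⟩]
      exact h1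
  | mul _ _ h1 h2 => rw [map_mul]; exact h1.mul h2
  | inv _ h1 => rw [map_inv]; exact h1.inv

lemma L6 (H : ElimH o τ ok v u w e0 c κ) {ok' : E → Prop} {a b : V} {g : FreeGroup E}
    (hp : Pth o τ ok' a b g) :
    Pth (eo ok v u w e0 o) (eo ok v u w e0 τ) (fun _ => True) (st v w a) (st v w b)
      (Pg o τ ok v e0 κ g) := by
  have hk := H.L5a H.hκ
  rw [st_pos rfl, st_neg H.wv] at hk
  induction hp with
  | one a => rw [map_one]; exact .one _
  | edge e _ =>
    by_cases he : ok e
    · rw [Pg_ok _ _ _ _ _ _ _ he]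
      exact tw2 (H.L5a (.edge e he)) hk
    · have h0 : e ≠ e0 := fun h => he (h ▸ H.ok0)
      have h1 := Pth.edge (o := eo ok v u w e0 o) (τ := eo ok v u w e0 τ) (ok := fun _ => True)
        ⟨e, h0⟩ trivial
      rw [eo_not _ he, eo_not _ he] at h1
      rw [Pg_not _ _ _ _ _ _ _ he, proj_ne ⟨e, h0⟩]
      exact h1
  | mul _ _ h1 h2 => rw [map_mul]; exact h1.mul h2
  | inv _ h1 => rw [map_inv]; exact h1.inv

end ElimH
end elim
end OneRel

namespace OneRel
open FreeGroup (of)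
open Monoid (CoprodI)

section chains
variable {V E ι : Type} {M : ι → Type} [∀ i, Group (M i)]
  (o τ : E → V) (typ : E → ι) (χh : FreeGroup E →* CoprodI M)

/-- chains of monochromatic paths -/
inductive Ch : V → V → List (Σ i, M i) → Prop
  | nil (a : V) : Ch a a []
  | cons {a b c : V} {i : ι} {m : M i} {κ : FreeGroup E} {l : List (Σ i, M i)}
    (hp : Pth o τ (fun e => typ e = i) a b κ) (hm : χh κ = CoprodI.of m) (hl : Ch b c l) :
    Ch a c (⟨i, m⟩ :: l)

/-- product of a list of syllables -/
def lpr (l : List (Σ i, M i)) : CoprodI M := (l.map fun s => CoprodI.of s.2).prod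

variable {o τ typ χh}

lemma Ch.append {a b c : V} {l l' : List (Σ i, M i)} (h : Ch o τ typ χh a b l)
    (h' : Ch o τ typ χh b c l') : Ch o τ typ χh a c (l ++ l') := by
  induction h with
  | nil a => exact h'
  | cons hp hm _ ih => exact .cons hp hm (ih h')

lemma lpr_append (l l' : List (Σ i, M i)) : lpr (l ++ l') = lpr l * lpr l' := by
  simp [lpr]

lemma lpr_cons {i : ι} (m : M i) (l : List (Σ i, M i)) :
    lpr (⟨i, m⟩ :: l) = CoprodI.of m * lpr l := by
  simp [lpr]

lemma Ch.rev {a b : V} {l : List (Σ i, M i)} (h : Ch o τ typ χh a b l) :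
    ∃ l', Ch o τ typ χh b a l' ∧ lpr l' = (lpr l)⁻¹ := by
  induction h with
  | nil a => exact ⟨[], .nil a, by simp [lpr]⟩
  | @cons a b c i m κ l hp hm _ ih =>
    obtain ⟨l', h1, h2⟩ := ih
    refine ⟨l' ++ [⟨i, m⁻¹⟩], h1.append (.cons hp.inv (by rw [map_inv, hm, map_inv]) (.nil _)), ?_⟩
    rw [lpr_append, h2, lpr_cons, lpr_cons, mul_inv_rev, map_inv]
    simp [lpr]

lemma Pth.toCh (hmono : ∀ e, χh (of e) ∈ (CoprodI.of (M := M) (i := typ e)).range)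
    {ok : E → Prop} {a b : V} {g : FreeGroup E} (hp : Pth o τ ok a b g) :
    ∃ l, Ch o τ typ χh a b l ∧ lpr l = χh g := by
  induction hp with
  | one a => exact ⟨[], .nil a, by simp [lpr]⟩
  | edge e _ =>
    obtain ⟨m, hm⟩ := hmono e
    exact ⟨[⟨typ e, m⟩], .cons (.edge e rfl) hm.symm (.nil _), by rw [← hm]; simp [lpr]⟩
  | mul _ _ h1 h2 =>
    obtain ⟨l1, h1, e1⟩ := h1
    obtain ⟨l2, h2, e2⟩ := h2
    exact ⟨l1 ++ l2, h1.append h2, by rw [lpr_append, e1, e2, map_mul]⟩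
  | inv _ h1 =>
    obtain ⟨l1, h1, e1⟩ := h1
    obtain ⟨l2, h2, e2⟩ := h1.rev
    exact ⟨l2, h2, by rw [e2, e1, map_inv]⟩

lemma Ch.reduce (hno : ∀ i a b κ, Pth o τ (fun e => typ e = i) a b κ → χh κ = 1 → a = b)
    {a b : V} {l : List (Σ i, M i)} (h : Ch o τ typ χh a b l) :
    ∃ l', Ch o τ typ χh a b l' ∧ lpr l' = lpr l ∧ (∀ s ∈ l', s.2 ≠ 1) ∧
      l'.IsChain (fun s t => s.1 ≠ t.1) := by
  induction h with
  | nil a => exact ⟨[], .nil a, rfl, by simp, by simp⟩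
  | @cons a b c i m κ l hp hm _ ih =>
    obtain ⟨l', h1, h2, h3, h4⟩ := ih
    by_cases hm1 : m = 1
    · subst hm1
      rw [map_one] at hm
      obtain rfl := hno i a b κ hp hm
      exact ⟨l', h1, by rw [h2, lpr_cons, map_one, one_mul], h3, h4⟩
    · cases h1 with
      | nil =>
        refine ⟨[⟨i, m⟩], .cons hp hm (.nil _), ?_, by simpa using hm1, by simp⟩
        rw [lpr_cons, lpr_cons, h2]
      | @cons _ b' _ i' m' κ' l'' hp' hm' hl' =>
        by_cases hi : i = i'
        · subst hi
          have hmm : χh (κ * κ') = CoprodI.of (m * m') := by rw [map_mul, map_mul, hm, hm']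
          rw [lpr_cons] at h2
          by_cases h1 : m * m' = 1
          · rw [h1, map_one] at hmm
            obtain rfl := hno i a b' _ (hp.mul hp') hmm
            refine ⟨l'', hl', ?_, fun s hs => h3 s (List.mem_cons_of_mem _ hs), h4.tail⟩
            rw [lpr_cons, ← h2, ← mul_assoc, ← map_mul, h1, map_one, one_mul]
          · refine ⟨⟨i, m * m'⟩ :: l'', .cons (hp.mul hp') hmm hl', ?_, ?_, ?_⟩
            · rw [lpr_cons, lpr_cons, ← h2, map_mul, mul_assoc]
            · intro s hs
              rcases List.mem_cons.1 hs with rfl | hs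
              · exact h1
              · exact h3 s (List.mem_cons_of_mem _ hs)
            · rw [List.isChain_cons] at h4 ⊢
              exact h4
        · refine ⟨⟨i, m⟩ :: ⟨i', m'⟩ :: l'', .cons hp hm (.cons hp' hm' hl'), ?_, ?_, ?_⟩
          · rw [lpr_cons, h2, lpr_cons]
          · intro s hs
            rcases List.mem_cons.1 hs with rfl | hs
            · exact hm1
            · exact h3 s hs
          · rw [List.isChain_cons_cons]
            exact ⟨hi, h4⟩

lemma exists_mono_path (hmono : ∀ e, χh (of e) ∈ (CoprodI.of (M := M) (i := typ e)).range)
    {ok : E → Prop} {a b : V} {g : FreeGroup E} (hp : Pth o τ ok a b g) (hab : a ≠ b)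
    (hg : χh g = 1) :
    ∃ i a' b' κ, Pth o τ (fun e => typ e = i) a' b' κ ∧ χh κ = 1 ∧ a' ≠ b' := by
  classical
  by_contra hcon
  push Not at hcon
  obtain ⟨l, h1, h2⟩ := hp.toCh hmono
  obtain ⟨l', h3, h4, h5, h6⟩ := h1.reduce hcon
  let W : CoprodI.Word M := ⟨l', h5, h6⟩
  have hW : W.prod = CoprodI.Word.empty.prod := by
    change lpr l' = _
    rw [h4, h2, hg, CoprodI.Word.prod_empty]
  have hW' : W = CoprodI.Word.empty := CoprodI.Word.equiv.symm.injective hW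
  have : l' = [] := congrArg CoprodI.Word.toList hW'
  subst this
  cases h3
  exact hab rfl

end chains

section grushko
variable {X V ι : Type} {M : ι → Type} [∀ i, Group (M i)]

structure GS (χ : FreeGroup X →* CoprodI M) (v0 : V) {E : Type} (o τ : E → V) (typ : E → ι)
    (χh : FreeGroup E →* CoprodI M) (j : FreeGroup X →* FreeGroup E)
    (ret : FreeGroup E →* FreeGroup X) : Prop where
  ret_j : ∀ x, ret (j x) = x
  χ_j : ∀ x, χh (j x) = χ x
  mono : ∀ e, χh (of e) ∈ (CoprodI.of (M := M) (i := typ e)).range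
  loop : ∀ x, Pth o τ (fun _ => True) v0 v0 (j x)
  full : ∀ g, Pth o τ (fun _ => True) v0 v0 g → g ∈ j.range
  reach : ∀ e, ∃ g, Pth o τ (fun _ => True) v0 (o e) g

/-- reachable vertices -/
def rch (v0 : V) {E : Type} (o τ : E → V) : Set V := {v | ∃ g, Pth o τ (fun _ => True) v0 v g}

variable {χ : FreeGroup X →* CoprodI M} {v0 : V} {E : Type} {o τ : E → V} {typ : E → ι}
    {χh : FreeGroup E →* CoprodI M} {j : FreeGroup X →* FreeGroup E}
    {ret : FreeGroup E →* FreeGroup X}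

lemma GS.base (H : GS χ v0 o τ typ χh j ret) (hr : ∀ v ∈ rch v0 o τ, v = v0) :
    ∃ (E : Type) (typ : E → ι) (j : FreeGroup X ≃* FreeGroup E),
      ∀ e, χ (j.symm (of e)) ∈ (CoprodI.of (M := M) (i := typ e)).range := by
  have ho : ∀ e, o e = v0 := fun e => hr _ (H.reach e)
  have ht : ∀ e, τ e = v0 := fun e => by
    obtain ⟨g, hg⟩ := H.reach e
    exact hr _ ⟨_, hg.mul (.edge e trivial)⟩
  have hall : ∀ g : FreeGroup E, Pth o τ (fun _ => True) v0 v0 g := by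
    intro g
    have hed : ∀ e, Pth o τ (fun _ => True) v0 v0 (of e) := fun e => by
      have := Pth.edge (o := o) (τ := τ) (ok := fun _ => True) e trivial
      rwa [ho, ht] at this
    induction g using FreeGroup.induction_on with
    | C1 => exact .one _
    | of e => exact hed e
    | inv_of e _ => exact (hed e).inv
    | mul x y hx hy => exact hx.mul hy
  have hbij : Function.Bijective j := by
    refine ⟨fun a b hab => ?_, fun g => H.full g (hall g)⟩
    rw [← H.ret_j a, hab, H.ret_j]
  refine ⟨E, typ, MulEquiv.ofBijective j hbij, fun e => ?_⟩
  rw [← H.χ_j]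
  have : j ((MulEquiv.ofBijective j hbij).symm (of e)) = of e :=
    (MulEquiv.ofBijective j hbij).apply_symm_apply (of e)
  rw [this]
  exact H.mono e

lemma Pth.mem_range {i : ι} (hmono : ∀ e, χh (of e) ∈ (CoprodI.of (M := M) (i := typ e)).range)
    {a b : V} {g : FreeGroup E} (hp : Pth o τ (fun e => typ e = i) a b g) :
    χh g ∈ (CoprodI.of (M := M) (i := i)).range := by
  induction hp with
  | one a => rw [map_one]; exact one_mem _
  | edge e he => subst he; exact hmono e
  | mul _ _ h1 h2 => rw [map_mul]; exact mul_mem h1 h2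
  | inv _ h1 => rw [map_inv]; exact inv_mem h1

lemma pw_mem {G : Type} [Group G] (K : Subgroup G) {x : G} (h : x ∈ K) (p : Prop) : pw x p ∈ K := by
  by_cases hp : p
  · rwa [pw_pos _ hp]
  · rw [pw_neg _ hp]; exact one_mem _

lemma GS.step (H : GS χ v0 o τ typ χh j ret) (hχ : Function.Surjective χ)
    (hr : ∃ v ∈ rch v0 o τ, v ≠ v0) :
    ∃ (E' : Type) (o' τ' : E' → V) (typ' : E' → ι) (χh' : FreeGroup E' →* CoprodI M)
      (j' : FreeGroup X →* FreeGroup E') (ret' : FreeGroup E' →* FreeGroup X),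
      GS χ v0 o' τ' typ' χh' j' ret' ∧ rch v0 o' τ' ⊂ rch v0 o τ := by
  -- monochromatic path between different vertices
  have h1 : ∃ i a b κ, Pth o τ (fun e => typ e = i) a b κ ∧ χh κ = 1 ∧ a ≠ b := by
    obtain ⟨v, ⟨g, hg⟩, hv⟩ := hr
    obtain ⟨x, hx⟩ := hχ (χh g)
    refine exists_mono_path H.mono (hg.inv.mul (H.loop x)) hv ?_
    rw [map_mul, map_inv, H.χ_j, hx, inv_mul_cancel]
  have h2 : ∃ i v w κ, Pth o τ (fun e => typ e = i) v w κ ∧ χh κ = 1 ∧ w ≠ v ∧ v ≠ v0 := by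
    obtain ⟨i, a, b, κ, hp, hκ, hab⟩ := h1
    by_cases ha : a = v0
    · exact ⟨i, b, a, κ⁻¹, hp.inv, by rw [map_inv, hκ, inv_one], hab, fun h => hab (ha.trans h.symm)⟩
    · exact ⟨i, a, b, κ, hp, hκ, hab.symm, ha⟩
  obtain ⟨i, v, w, κ, hp, hκ, hwv, hv0⟩ := h2
  have h3 : ∃ u e0 c, ElimH o τ (fun e => typ e = i) v u w e0 c κ := by
    obtain ⟨e, he, ⟨h1, h2⟩ | ⟨h1, h2⟩⟩ := hp.exists_edge rfl hwv
    · exact ⟨τ e, e, of e, ⟨h2, hwv, he, Or.inl ⟨rfl, h1, rfl⟩, hp⟩⟩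
    · exact ⟨o e, e, (of e)⁻¹, ⟨h2, hwv, he, Or.inr ⟨rfl, h1, rfl⟩, hp⟩⟩
  obtain ⟨u, e0, c, Z⟩ := h3
  -- reachability
  have hv0' : v0 ≠ v := hv0.symm
  have R1 : ∀ a, a ≠ v → a ∈ rch v0 o τ → a ∈ rch v0 (eo (fun e => typ e = i) v u w e0 o)
      (eo (fun e => typ e = i) v u w e0 τ) := by
    rintro a ha ⟨g, hg⟩
    have := Z.L6 hg
    rw [st_neg hv0', st_neg ha] at this
    exact ⟨_, this⟩
  have R0 : v ∈ rch v0 o τ := by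
    rcases Z.hc with ⟨-, h1, -⟩ | ⟨-, h1, -⟩
    · rw [← h1]; exact H.reach e0
    · rw [← h1]
      obtain ⟨g, hg⟩ := H.reach e0
      exact ⟨_, hg.mul (.edge e0 trivial)⟩
  have Rw : w ∈ rch v0 o τ := by
    obtain ⟨g, hg⟩ := R0
    exact ⟨_, hg.mul (hp.mono fun _ _ => trivial)⟩
  have Ru : u ∈ rch v0 o τ := by
    obtain ⟨g, hg⟩ := R0
    exact ⟨_, hg.mul (Z.pc.mono fun _ _ => trivial)⟩
  have hSP : ∀ x, Sg o τ (fun e => typ e = i) v e0 c κ (Pg o τ (fun e => typ e = i) v e0 κ (j x)) = j x := by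
    intro x
    rw [Z.L4 (H.loop x), pw_neg _ hv0']
    group
  refine ⟨({e0}ᶜ : Set E), eo (fun e => typ e = i) v u w e0 o, eo (fun e => typ e = i) v u w e0 τ,
    fun e => typ e, χh.comp (Sg o τ (fun e => typ e = i) v e0 c κ),
    (Pg o τ (fun e => typ e = i) v e0 κ).comp j,
    ret.comp (Sg o τ (fun e => typ e = i) v e0 c κ), ⟨?_, ?_, ?_, ?_, ?_, ?_⟩, ?_, ?_⟩
  · intro x
    simp only [MonoidHom.comp_apply]
    rw [hSP, H.ret_j]
  · intro x
    simp only [MonoidHom.comp_apply]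
    rw [hSP, H.χ_j]
  · intro e
    rw [MonoidHom.comp_apply, Sg, MonoidHom.comp_apply, incl_of]
    by_cases he : typ e = i
    · rw [Sg0_ok o τ (fun e => typ e = i) v c κ e he, map_mul, map_mul, map_inv, map_pw, map_pw]
      have hc : χh c ∈ (CoprodI.of (M := M) (i := typ e)).range := by
        rw [he]; exact Z.pc.mem_range H.mono
      exact mul_mem (mul_mem (inv_mem (pw_mem _ hc _)) (H.mono e)) (pw_mem _ hc _)
    · rw [Sg0_not o τ (fun e => typ e = i) v c κ e he, map_mul, map_mul, map_inv, map_pw, map_pw, hκ, pw_one, pw_one,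
        inv_one, one_mul, mul_one]
      exact H.mono e
  · intro x
    have := Z.L6 (H.loop x)
    rwa [st_neg hv0'] at this
  · intro g hg
    obtain ⟨x, hx⟩ := H.full _ (Z.L5 hg)
    exact ⟨x, by rw [MonoidHom.comp_apply, hx, Z.L3]⟩
  · intro e
    by_cases he : o e = v
    · by_cases hk : typ e = i
      · rw [ElimH.eo_ok e hk, st_pos he]; exact R1 u Z.uv Ru
      · rw [ElimH.eo_not e hk, st_pos he]; exact R1 w Z.wv Rw
    · have := R1 _ he (H.reach e)
      by_cases hk : typ e = i
      · rw [ElimH.eo_ok e hk, st_neg he]; exact this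
      · rw [ElimH.eo_not e hk, st_neg he]; exact this
  · rintro a ⟨g, hg⟩
    exact ⟨_, Z.L5 hg⟩
  · intro hsub
    obtain ⟨g, hg⟩ := hsub R0
    have key : ∀ {a b : V} {g : FreeGroup ({e0}ᶜ : Set E)},
        Pth (eo (fun e => typ e = i) v u w e0 o) (eo (fun e => typ e = i) v u w e0 τ)
          (fun _ => True) a b g → (a = v ↔ b = v) := by
      intro a b g h
      induction h with
      | one a => rfl
      | edge e _ => exact iff_of_false (Z.eo_ne e) (Z.eo_ne e)
      | mul _ _ h1 h2 => exact h1.trans h2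
      | inv _ h1 => exact h1.symm
    exact hv0' ((key hg).2 rfl)

theorem GS.concl [Finite V] (hχ : Function.Surjective χ) (k : ℕ) :
    ∀ (E : Type) (o τ : E → V) (typ : E → ι)
    (χh : FreeGroup E →* CoprodI M) (j : FreeGroup X →* FreeGroup E)
    (ret : FreeGroup E →* FreeGroup X), GS χ v0 o τ typ χh j ret → (rch v0 o τ).ncard ≤ k →
    ∃ (E : Type) (typ : E → ι) (j : FreeGroup X ≃* FreeGroup E),
      ∀ e, χ (j.symm (of e)) ∈ (CoprodI.of (M := M) (i := typ e)).range := by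
  induction k with
  | zero =>
    intro E o τ typ χh j ret H hk
    refine H.base fun v hv => ?_
    rw [Nat.le_zero, Set.ncard_eq_zero (Set.toFinite _)] at hk
    rw [hk] at hv
    exact hv.elim
  | succ k ih =>
    intro E o τ typ χh j ret H hk
    by_cases hr : ∃ v ∈ rch v0 o τ, v ≠ v0
    · obtain ⟨E', o', τ', typ', χh', j', ret', H', hlt⟩ := H.step hχ hr
      refine ih E' o' τ' typ' χh' j' ret' H' ?_
      have := Set.ncard_lt_ncard hlt (Set.toFinite _)
      omega
    · push Not at hr
      exact H.base hr

end grushko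
end OneRel

namespace OneRel
open FreeGroup (of)
open Monoid (CoprodI)

section petals
variable {X ι : Type} {M : ι → Type} [∀ i, Group (M i)]

lemma exists_lpr (p : CoprodI M) : ∃ l, lpr (M := M) l = p := by
  induction p using CoprodI.induction_on with
  | one => exact ⟨[], rfl⟩
  | of i m => exact ⟨[⟨i, m⟩], by simp [lpr]⟩
  | mul x y hx hy =>
    obtain ⟨l, rfl⟩ := hx
    obtain ⟨l', rfl⟩ := hy
    exact ⟨l ++ l', lpr_append l l'⟩

lemma of_getD (l : List (Σ i, M i)) (k : ℕ) (i0 : ι) :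
    (CoprodI.of (l.getD k ⟨i0, 1⟩).2 : CoprodI M) = lpr (l[k]?.toList) := by
  let f : (Σ i, M i) → CoprodI M := fun s => CoprodI.of s.2
  change f (l.getD k ⟨i0, 1⟩) = _
  rw [List.getD_eq_getElem?_getD]
  cases l[k]? with
  | none => simp [lpr, f]
  | some a => simp [lpr, f]

/-- partial products along a petal -/
def Pp {X : Type} (N : ℕ) (x : X) : ℕ → FreeGroup (X × Fin N)
  | 0 => 1
  | k + 1 => Pp N x k * (if h : k < N then of (x, ⟨k, h⟩) else 1)

/-- vertices on a petal -/
def vert {X : Type} (N : ℕ) (x : X) (k : ℕ) : Option (X × Fin N) :=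
  if h : 0 < k ∧ k < N then some (x, ⟨k, h.2⟩) else none

theorem grushko [Finite X] [Nonempty ι] (χ : FreeGroup X →* CoprodI M)
    (hχ : Function.Surjective χ) :
    ∃ (E : Type) (typ : E → ι) (j : FreeGroup X ≃* FreeGroup E),
      ∀ e, χ (j.symm (of e)) ∈ (CoprodI.of (M := M) (i := typ e)).range := by
  classical
  obtain ⟨i0⟩ := ‹Nonempty ι›
  choose ℓ hℓ using fun x => exists_lpr (χ (of x))
  obtain ⟨N, hN1, hN⟩ : ∃ N, 1 ≤ N ∧ ∀ x, (ℓ x).length ≤ N := by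
    have := Fintype.ofFinite X
    refine ⟨Finset.univ.sup (fun x => (ℓ x).length) + 1, by omega, fun x => ?_⟩
    exact (Finset.le_sup (f := fun x => (ℓ x).length) (Finset.mem_univ x)).trans (Nat.le_succ _)
  let s : X → ℕ → Σ i, M i := fun x k => (ℓ x).getD k ⟨i0, 1⟩
  let o : X × Fin N → Option (X × Fin N) := fun e => vert N e.1 e.2
  let τ : X × Fin N → Option (X × Fin N) := fun e => vert N e.1 (e.2 + 1)
  let typ : X × Fin N → ι := fun e => (s e.1 e.2).1
  let χh : FreeGroup (X × Fin N) →* CoprodI M := FreeGroup.lift fun e => CoprodI.of (s e.1 e.2).2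
  let j : FreeGroup X →* FreeGroup (X × Fin N) := FreeGroup.lift fun x => Pp N x N
  let ret : FreeGroup (X × Fin N) →* FreeGroup X :=
    FreeGroup.lift fun e => if (e.2 : ℕ) = 0 then of e.1 else 1
  let q : Option (X × Fin N) → FreeGroup (X × Fin N) := fun a => match a with
    | none => 1
    | some e => Pp N e.1 e.2
  have hjof : ∀ x, j (of x) = Pp N x N := fun x => by simp [j]
  have hv0 : ∀ x : X, vert N x 0 = none := fun x => by simp [vert]
  have hvN : ∀ x : X, vert N x N = none := fun x => by simp [vert]
  have hpath : ∀ (x : X) k, k ≤ N → Pth o τ (fun _ => True) none (vert N x k) (Pp N x k) := by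
    intro x k
    induction k with
    | zero => intro _; rw [hv0]; exact .one _
    | succ k ih =>
      intro hk
      have hk' : k < N := hk
      rw [Pp, dif_pos hk']
      exact (ih hk'.le).mul (.edge (o := o) (τ := τ) (x, ⟨k, hk'⟩) trivial)
  have hχP : ∀ (x : X) k, k ≤ N → χh (Pp N x k) = lpr ((ℓ x).take k) := by
    intro x k
    induction k with
    | zero => intro _; simp [Pp, lpr]
    | succ k ih =>
      intro hk
      have hk' : k < N := hk
      rw [Pp, dif_pos hk', map_mul, ih hk'.le, List.take_add_one, lpr_append]
      congr 1
      simp only [χh, s, FreeGroup.lift_apply_of]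
      exact of_getD _ _ _
  have hret : ∀ (x : X) k, ret (Pp N x (k + 1)) = of x := by
    intro x k
    induction k with
    | zero =>
      rw [Pp, Pp, dif_pos (show 0 < N from hN1)]
      simp [ret]
    | succ k ih =>
      rw [Pp, map_mul, ih]
      split_ifs with h <;> simp [ret]
  have hfull : ∀ {a b : Option (X × Fin N)} {g}, Pth o τ (fun _ => True) a b g →
      ∃ y, g = (q a)⁻¹ * j y * q b := by
    intro a b g h
    induction h with
    | one a => exact ⟨1, by simp⟩
    | edge e _ =>
      obtain ⟨x, k, hk⟩ := e
      have h1 : (of (x, (⟨k, hk⟩ : Fin N))) = (Pp N x k)⁻¹ * Pp N x (k + 1) := by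
        rw [Pp, dif_pos hk]; group
      have h2 : q (o (x, ⟨k, hk⟩)) = Pp N x k := by
        change q (vert N x k) = _
        by_cases h0 : k = 0
        · subst h0; rw [hv0]; rfl
        · rw [vert, dif_pos ⟨Nat.pos_of_ne_zero h0, hk⟩]
      rw [h2, h1]
      by_cases h3 : k + 1 < N
      · refine ⟨1, ?_⟩
        have : q (τ (x, ⟨k, hk⟩)) = Pp N x (k + 1) := by
          change q (vert N x (k + 1)) = _
          rw [vert, dif_pos ⟨Nat.succ_pos k, h3⟩]
        rw [this, map_one, mul_one]
      · have h4 : k + 1 = N := by omega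
        refine ⟨of x, ?_⟩
        have : q (τ (x, ⟨k, hk⟩)) = 1 := by
          change q (vert N x (k + 1)) = _
          rw [h4, hvN]
        rw [this, mul_one, hjof, h4]
    | mul _ _ h1 h2 =>
      obtain ⟨y1, rfl⟩ := h1
      obtain ⟨y2, rfl⟩ := h2
      exact ⟨y1 * y2, by rw [map_mul]; group⟩
    | inv _ h1 =>
      obtain ⟨y1, rfl⟩ := h1
      exact ⟨y1⁻¹, by rw [map_inv]; group⟩
  have H : GS χ none o τ typ χh j ret := by
    refine ⟨?_, ?_, ?_, ?_, ?_, ?_⟩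
    · have : ret.comp j = MonoidHom.id _ := by
        ext x
        rw [MonoidHom.comp_apply, hjof]
        obtain ⟨m, rfl⟩ : ∃ m, N = m + 1 := ⟨N - 1, by omega⟩
        exact hret x m
      exact fun x => DFunLike.congr_fun this x
    · have : χh.comp j = χ := by
        ext x
        rw [MonoidHom.comp_apply, hjof, hχP x N le_rfl, List.take_of_length_le (hN x), hℓ]
      exact fun x => DFunLike.congr_fun this x
    · intro e
      exact ⟨(s e.1 e.2).2, by simp [χh]⟩
    · intro x
      have hed : ∀ x, Pth o τ (fun _ => True) none none (j (of x)) := fun x => by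
        have := hpath x N le_rfl
        rwa [hvN, ← hjof] at this
      induction x using FreeGroup.induction_on with
      | C1 => rw [map_one]; exact .one _
      | of e => exact hed e
      | inv_of e _ => rw [map_inv]; exact (hed e).inv
      | mul x y hx hy => rw [map_mul]; exact hx.mul hy
    · intro g hg
      obtain ⟨y, hy⟩ := hfull hg
      exact ⟨y, by rw [hy]; simp [q]⟩
    · rintro ⟨x, k⟩
      exact ⟨_, hpath x k k.2.le⟩
  exact GS.concl hχ _ _ _ _ _ _ _ _ H le_rfl

end petals
end OneRel

namespace OneRel
open FreeGroup (of)
open Monoid (CoprodI)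

/-- elementary Nielsen automorphism -/
noncomputable def nielsen {E : Type} (a b : E) (hab : a ≠ b) (k : ℤ) : FreeGroup E ≃* FreeGroup E := by
  classical
  let f : ℤ → FreeGroup E →* FreeGroup E := fun k =>
    FreeGroup.lift fun e => if e = a then of a * of b ^ k else of e
  have h : ∀ k, (f (-k)).comp (f k) = MonoidHom.id _ := by
    intro k
    ext e
    by_cases he : e = a
    · subst he
      simp [f, hab.symm]
    · simp [f, he]
  refine MonoidHom.toMulEquiv (f k) (f (-k)) (h k) ?_
  have := h (-k)
  rwa [neg_neg] at this

lemma nielsen_a {E : Type} (a b : E) (hab : a ≠ b) (k : ℤ) :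
    nielsen a b hab k (of a) = of a * of b ^ k := by
  simp [nielsen, MonoidHom.toMulEquiv]

lemma nielsen_b {E : Type} (a b : E) (hab : a ≠ b) (k : ℤ) :
    nielsen a b hab k (of b) = of b := by
  simp [nielsen, MonoidHom.toMulEquiv, hab.symm]

lemma natAbs_red (x y : ℤ) (hx : x ≠ 0) (hy : y ≠ 0) (h : y.natAbs ≤ x.natAbs) :
    ∃ k : ℤ, (x + k * y).natAbs < x.natAbs := by
  rcases lt_or_gt_of_ne hx with h1 | h1 <;> rcases lt_or_gt_of_ne hy with h2 | h2
  · exact ⟨-1, by omega⟩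
  · exact ⟨1, by omega⟩
  · exact ⟨1, by omega⟩
  · exact ⟨-1, by omega⟩

lemma euclid {E : Type} (a b : E) (hab : a ≠ b) (N : ℕ) : ∀ (ψ : FreeGroup E →* Multiplicative ℤ),
    (ψ (of a)).toAdd.natAbs + (ψ (of b)).toAdd.natAbs ≤ N →
    ∃ α : FreeGroup E ≃* FreeGroup E, ψ (α (of a)) = 1 ∨ ψ (α (of b)) = 1 := by
  induction N with
  | zero =>
    intro ψ h
    refine ⟨MulEquiv.refl _, Or.inl ?_⟩
    apply Multiplicative.toAdd.injective
    change (ψ (of a)).toAdd = 0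
    omega
  | succ N ih =>
    intro ψ h
    by_cases ha : (ψ (of a)).toAdd = 0
    · exact ⟨MulEquiv.refl _, Or.inl (Multiplicative.toAdd.injective ha)⟩
    by_cases hb : (ψ (of b)).toAdd = 0
    · exact ⟨MulEquiv.refl _, Or.inr (Multiplicative.toAdd.injective hb)⟩
    have key : ∃ β : FreeGroup E ≃* FreeGroup E, (ψ (β (of a))).toAdd.natAbs +
        (ψ (β (of b))).toAdd.natAbs ≤ N := by
      rcases le_total (ψ (of b)).toAdd.natAbs (ψ (of a)).toAdd.natAbs with hl | hl
      · obtain ⟨k, hk⟩ := natAbs_red _ _ ha hb hl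
        refine ⟨nielsen a b hab k, ?_⟩
        rw [nielsen_a, nielsen_b, map_mul, map_zpow, toAdd_mul, toAdd_zpow, smul_eq_mul]
        omega
      · obtain ⟨k, hk⟩ := natAbs_red _ _ hb ha hl
        refine ⟨nielsen b a hab.symm k, ?_⟩
        rw [nielsen_a, nielsen_b, map_mul, map_zpow, toAdd_mul, toAdd_zpow, smul_eq_mul]
        omega
    obtain ⟨β, hβ⟩ := key
    obtain ⟨α, hα⟩ := ih (ψ.comp β.toMonoidHom) hβ
    exact ⟨α.trans β, hα⟩

lemma free_comm_of_subsingleton {E : Type} [Subsingleton E] (g h : FreeGroup E) : Commute g h := by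
  have h1 : ∀ (e : E) (h : FreeGroup E), Commute (of e) h := by
    intro e h
    have h0 : ∀ f : E, Commute (of e) (of f) := fun f => by rw [Subsingleton.elim f e]
    induction h using FreeGroup.induction_on with
    | C1 => exact Commute.one_right _
    | of f => exact h0 f
    | inv_of f _ => exact (h0 f).inv_right
    | mul x y hx hy => exact hx.mul_right hy
  induction g using FreeGroup.induction_on with
  | C1 => exact Commute.one_left _
  | of f => exact h1 f h
  | inv_of f _ => exact (h1 f h).inv_left
  | mul x y hx hy => exact hx.mul_left hy

lemma free_not_comm {X : Type} {a b : X} (hab : a ≠ b) : ¬ Commute (of a) (of b) := by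
  classical
  intro h
  let f : FreeGroup X →* Equiv.Perm (Fin 3) := FreeGroup.lift fun x =>
    if x = a then Equiv.swap 0 1 else Equiv.swap 1 2
  have h1 := h.map f
  have ha : f (of a) = Equiv.swap 0 1 := by simp [f]
  have hb : f (of b) = Equiv.swap 1 2 := by simp [f, hab.symm]
  rw [ha, hb] at h1
  have : ¬ (Equiv.swap (0 : Fin 3) 1 * Equiv.swap 1 2 = Equiv.swap 1 2 * Equiv.swap 0 1) := by decide
  exact this h1

section
variable {E : Type} (M : Bool → Type) [∀ b, Group (M b)]

lemma mixed_case (R : FreeGroup E) (hR1 : R ≠ 1) (hCI : ∀ e, ¬ CI {e}ᶜ R)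
    (typ : E → Bool) (χ : FreeGroup E →* CoprodI M) (hker : χ.ker = NN R 1)
    (hmono : ∀ e, χ (of e) ∈ (CoprodI.of (M := M) (i := typ e)).range)
    (hmix : ∀ b, ∃ e, typ e ≠ b) : False := by
  classical
  let S : Bool → Set E := fun b => {e | typ e = b}
  have h1 : ∀ b, ∀ e : S b, ∃ m : M b, CoprodI.of m = χ (of (e : E)) := by
    rintro b ⟨e, rfl⟩
    exact hmono e
  choose m hm using h1
  let ρ : ∀ b, FreeGroup (S b) →* M b := fun b => FreeGroup.lift (m b)
  have hρ : ∀ b w, CoprodI.of (ρ b w) = χ (incl (S b) w) := by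
    intro b w
    have : (CoprodI.of (M := M)).comp (ρ b) = χ.comp (incl (S b)) := by
      ext e
      rw [MonoidHom.comp_apply, MonoidHom.comp_apply, incl_of, ← hm]
      simp [ρ]
    exact DFunLike.congr_fun this w
  have hinj : ∀ b w, ρ b w = 1 → w = 1 := by
    intro b w hw
    obtain ⟨e, he⟩ := hmix b
    have h2 : incl (S b) w ∈ NN R 1 := by
      rw [← hker, MonoidHom.mem_ker, ← hρ, hw, map_one]
    have h3 : incl (S b) w ∈ gen {e}ᶜ := by
      refine gen_mono ?_ (incl_mem (S b) w)
      rintro f hf rfl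
      exact he hf
    have h4 := (main_thm R hR1).frei e (hCI e) _ h3 h2
    exact incl_inj (S b) (h4.trans (map_one _).symm)
  let Λ : FreeGroup E →* CoprodI (fun b => FreeGroup (S b)) :=
    FreeGroup.lift fun e => CoprodI.of (i := typ e) (of (⟨e, rfl⟩ : S (typ e)))
  have hΛ : ∀ w, CoprodI.lift (fun b => incl (S b)) (Λ w) = w := by
    intro w
    have : (CoprodI.lift (fun b => incl (S b))).comp Λ = MonoidHom.id _ := by
      ext e
      simp only [MonoidHom.comp_apply, Λ, FreeGroup.lift_apply_of, CoprodI.lift_of, MonoidHom.id_apply]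
      exact incl_of (S (typ e)) ⟨e, rfl⟩
    exact DFunLike.congr_fun this w
  have hχ : ∀ w, CoprodI.lift (fun b => (CoprodI.of (M := M)).comp (ρ b)) (Λ w) = χ w := by
    intro w
    have : (CoprodI.lift (fun b => (CoprodI.of (M := M)).comp (ρ b))).comp Λ = χ := by
      ext e
      simp only [MonoidHom.comp_apply, Λ, FreeGroup.lift_apply_of, CoprodI.lift_of]
      rw [hρ, incl_of]
    exact DFunLike.congr_fun this w
  have hRχ : χ R = 1 := by
    rw [← MonoidHom.mem_ker, hker]
    have := pow_mem_NN R 1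
    rwa [pow_one] at this
  let W : CoprodI.Word (fun b => FreeGroup (S b)) := CoprodI.Word.equiv (Λ R)
  have hW : W.prod = Λ R := CoprodI.Word.equiv.symm_apply_apply (Λ R)
  have hne : W.toList ≠ [] := by
    intro h
    have h2 : W.prod = 1 := by simp [CoprodI.Word.prod, h]
    rw [hW] at h2
    have h3 := hΛ R
    rw [h2, map_one] at h3
    exact hR1 h3.symm
  refine word_map_ne_one ρ W hne (fun l hl h => W.ne_one l hl (hinj _ _ h)) ?_
  rw [hW]
  exact (hχ R).trans hRχ

/-- projection to the infinite cyclic factor -/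
def pf : CoprodI M →* M false := CoprodI.lift fun b => match b with
  | false => MonoidHom.id _
  | true => 1

lemma pf_false (m : M false) : pf M (CoprodI.of m) = m := by simp [pf]
lemma pf_true (m : M true) : pf M (CoprodI.of m) = 1 := by simp [pf]

theorem no_split_E [Nontrivial E] (R : FreeGroup E) (hR1 : R ≠ 1) (n : ℕ) (hn : 1 < n)
    (hind : ¬ FreelyDecomposable (Gq R n)) (θ : M false ≃* Multiplicative ℤ)
    (typ : E → Bool) (χ : FreeGroup E →* CoprodI M) (hχ : Function.Surjective χ)
    (hker : χ.ker = NN R 1)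
    (hmono : ∀ e, χ (of e) ∈ (CoprodI.of (M := M) (i := typ e)).range) : False := by
  by_cases h1 : ∀ b, ∃ e, typ e ≠ b
  · exact mixed_case M R hR1 (fun e h => hind (decomp R n hn e h)) typ χ hker hmono h1
  push Not at h1
  obtain ⟨b, hb⟩ := h1
  cases b with
  | true =>
    have h2 : ((pf M).comp χ) = 1 := by
      ext e
      obtain ⟨m, hm⟩ : χ (of e) ∈ (CoprodI.of (M := M) (i := true)).range := hb e ▸ hmono e
      rw [MonoidHom.comp_apply, ← hm, pf_true]
      rfl
    obtain ⟨w, hw⟩ := hχ (CoprodI.of (θ.symm (Multiplicative.ofAdd 1)))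
    have h3 := DFunLike.congr_fun h2 w
    rw [MonoidHom.comp_apply, hw, pf_false, MonoidHom.one_apply] at h3
    have h4 := congrArg θ h3
    rw [MulEquiv.apply_symm_apply, map_one θ] at h4
    exact one_ne_zero (α := ℤ) (Multiplicative.ofAdd.injective h4)
  | false =>
    have h2 : (CoprodI.of (M := M) (i := false)).comp ((pf M).comp χ) = χ := by
      ext e
      obtain ⟨m, hm⟩ : χ (of e) ∈ (CoprodI.of (M := M) (i := false)).range := hb e ▸ hmono e
      rw [MonoidHom.comp_apply, MonoidHom.comp_apply, ← hm, pf_false]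
    let ψ : FreeGroup E →* Multiplicative ℤ := θ.toMonoidHom.comp ((pf M).comp χ)
    have hψ : ∀ w, ψ w = 1 → w ∈ NN R 1 := by
      intro w hw
      have h3 : pf M (χ w) = 1 := θ.injective (hw.trans (map_one θ).symm)
      rw [← hker, MonoidHom.mem_ker, ← h2, MonoidHom.comp_apply, MonoidHom.comp_apply, h3, map_one]
    obtain ⟨a, b, hab⟩ := exists_pair_ne E
    have fin : ∀ (α : FreeGroup E ≃* FreeGroup E) (a b : E), a ≠ b → ψ (α (of a)) = 1 → False := by
      intro α a b hab h
      have h3 : of a ∈ NN (α.symm R) 1 := by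
        have := NN_map_le α.symm.toMonoidHom R 1 (hψ _ h)
        simpa using this
      have h4 : ¬ CI {b}ᶜ (α.symm R) := fun hc =>
        hind (FreelyDecomposable.of_equiv (Gq_equiv α.symm R n) (decomp _ n hn b hc))
      have h5 : α.symm R ≠ 1 := fun h => hR1 (α.symm.injective (h.trans (map_one _).symm))
      have h6 := (main_thm _ h5).frei b h4 (of a) (of_mem_gen (by simpa using hab)) h3
      exact FreeGroup.of_ne_one a h6
    obtain ⟨α, hα | hα⟩ := euclid a b hab _ ψ le_rfl
    · exact fin α a b hab hα
    · exact fin α b a hab.symm hα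

theorem no_split {X : Type} [Nontrivial X] (R : FreeGroup X) (hR1 : R ≠ 1) (n : ℕ) (hn : 1 < n)
    (hind : ¬ FreelyDecomposable (Gq R n)) (θ : M false ≃* Multiplicative ℤ)
    (χ : FreeGroup X →* CoprodI M) (hχ : Function.Surjective χ)
    (hker : χ.ker = NN R 1) : False := by
  have hfin : Finite X := finite_of_not_CI R fun x h => hind (decomp R n hn x h)
  obtain ⟨E, typ, j, hj⟩ := grushko χ hχ
  have hE : Nontrivial E := by
    by_contra h
    rw [not_nontrivial_iff_subsingleton] at h
    obtain ⟨a, b, hab⟩ := exists_pair_ne X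
    apply free_not_comm hab
    have := (free_comm_of_subsingleton (j (of a)) (j (of b))).map j.symm.toMonoidHom
    simpa using this
  refine no_split_E M (j R) (fun h => hR1 (j.injective (h.trans (map_one _).symm))) n hn
    (fun h => hind (FreelyDecomposable.of_equiv (Gq_equiv j R n) h)) θ typ (χ.comp j.symm.toMonoidHom)
    (hχ.comp j.symm.surjective) ?_ hj
  rw [← NN_mulEquiv, ← hker]
  ext w
  simp only [MonoidHom.mem_ker, MonoidHom.comp_apply, Subgroup.mem_map]
  constructor
  · intro h
    exact ⟨j.symm w, h, by simp⟩
  · rintro ⟨y, hy, rfl⟩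
    simpa using hy

end
end OneRel

namespace OneRel
open Monoid (CoprodI)

/-- the two free factors -/
abbrev MM (K : Type) : Bool → Type
  | false => Multiplicative ℤ
  | true => K

instance instMM (K : Type) [Group K] : ∀ b, Group (MM K b)
  | false => inferInstanceAs (Group (Multiplicative ℤ))
  | true => inferInstanceAs (Group K)

/-- the two maps back -/
noncomputable def bk {K Q : Type} [Group K] [Group Q] (f : K →* Q) (q : Q) : ∀ b, MM K b →* Q
  | false => zpowersHom Q q
  | true => f

theorem partI {X : Type} [Nontrivial X] (R : FreeGroup X) (hR1 : R ≠ 1) (n : ℕ) (hn : 1 < n)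
    (hind : ¬ FreelyDecomposable (Gq R n)) (H : Type) [Group H] (A B : Subgroup H) (φ : A ≃* B)
    (e : Gq R n ≃* HNNExtension H A B φ)
    (hA : ∀ a : A, pq R n (e.symm (HNNExtension.of (a : H))) = 1) : False := by
  let ψ : H →* Gq R 1 := (pq R n).comp (e.symm.toMonoidHom.comp HNNExtension.of)
  have hψ : ∀ h, ψ h = pq R n (e.symm (HNNExtension.of h)) := fun h => rfl
  have hB : ∀ a : A, ψ (φ a : H) = 1 := by
    intro a
    rw [hψ, HNNExtension.equiv_eq_conj, map_mul, map_mul, map_mul, map_mul, hA, map_inv, map_inv]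
    group
  let K := H ⧸ ψ.ker
  let ft : H →* CoprodI (MM K) := (CoprodI.of (M := MM K) (i := true)).comp (QuotientGroup.mk' ψ.ker)
  have hft : ∀ h, ψ h = 1 → ft h = 1 := by
    intro h hh
    have : (QuotientGroup.mk' ψ.ker) h = 1 := (QuotientGroup.eq_one_iff h).2 hh
    change CoprodI.of (M := MM K) (i := true) ((QuotientGroup.mk' ψ.ker) h) = 1
    rw [this]
    exact map_one _
  let tt : CoprodI (MM K) := CoprodI.of (M := MM K) (i := false) (Multiplicative.ofAdd (1 : ℤ))
  let F : HNNExtension H A B φ →* CoprodI (MM K) := HNNExtension.lift ft tt (by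
    intro a
    rw [hft _ (hA a), hft _ (hB a), one_mul, mul_one])
  have hFof : ∀ h, F (HNNExtension.of h) = ft h := fun h => HNNExtension.lift_of _ _ _ _
  have hFt : F HNNExtension.t = tt := HNNExtension.lift_t _ _ _
  let χ : FreeGroup X →* CoprodI (MM K) := F.comp (e.toMonoidHom.comp (QuotientGroup.mk' (NN R n)))
  have hFs : Function.Surjective F := by
    intro p
    induction p using CoprodI.induction_on with
    | one => exact ⟨1, map_one _⟩
    | mul x y hx hy =>
      obtain ⟨x', rfl⟩ := hx
      obtain ⟨y', rfl⟩ := hy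
      exact ⟨x' * y', map_mul _ _ _⟩
    | of i m =>
      cases i with
      | true =>
        obtain ⟨h, rfl⟩ := QuotientGroup.mk'_surjective ψ.ker m
        exact ⟨HNNExtension.of h, hFof h⟩
      | false =>
        refine ⟨HNNExtension.t ^ (Multiplicative.toAdd (show Multiplicative ℤ from m)), ?_⟩
        rw [map_zpow, hFt]
        change CoprodI.of (M := MM K) (i := false) (Multiplicative.ofAdd (1 : ℤ)) ^ _ = _
        rw [← map_zpow]
        congr 1
        apply Multiplicative.toAdd.injective
        change Multiplicative.toAdd ((Multiplicative.ofAdd (1 : ℤ)) ^ _) = _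
        rw [toAdd_zpow]
        simp
  have hχ : Function.Surjective χ :=
    hFs.comp (e.surjective.comp (QuotientGroup.mk'_surjective _))
  let back : CoprodI (MM K) →* Gq R 1 :=
    CoprodI.lift (bk (QuotientGroup.kerLift ψ) (pq R n (e.symm HNNExtension.t)))
  have hback : back.comp F = (pq R n).comp e.symm.toMonoidHom := by
    apply HNNExtension.hom_ext
    · ext h
      rw [MonoidHom.comp_apply, MonoidHom.comp_apply, hFof]
      change back (CoprodI.of (M := MM K) (i := true) ((QuotientGroup.mk' ψ.ker) h)) = _
      rw [CoprodI.lift_of]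
      rfl
    · rw [MonoidHom.comp_apply, hFt]
      change back (CoprodI.of (M := MM K) (i := false) _) = _
      rw [CoprodI.lift_of]
      change (zpowersHom _ _) (Multiplicative.ofAdd (1 : ℤ)) = _
      simp
  have hker : χ.ker = NN R 1 := by
    apply le_antisymm
    · intro w hw
      have h1 : back (χ w) = pq R n (QuotientGroup.mk w) := by
        have := DFunLike.congr_fun hback (e (QuotientGroup.mk w))
        rw [MonoidHom.comp_apply, MonoidHom.comp_apply] at this
        change back (F (e (QuotientGroup.mk w))) = _
        rw [this]
        simp
      rw [MonoidHom.mem_ker.1 hw, map_one] at h1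
      exact (QuotientGroup.eq_one_iff w).1 h1.symm
    · apply NN_le_ker
      refine (pow_one (χ R)).trans ?_
      have h1 : e (QuotientGroup.mk R) ^ n = 1 := by
        rw [← map_pow, mk_pow_eq_one, map_one]
      obtain ⟨h0, hc⟩ := torsion_elliptic φ _ n (by omega) h1
      have h2 : IsConj (F (e (QuotientGroup.mk R))) (ft h0) := by
        have := F.map_isConj hc
        rwa [hFof] at this
      have h3 : ψ h0 = 1 := by
        have h4 := (pq R n).map_isConj (e.symm.toMonoidHom.map_isConj hc)
        have h5 : pq R n (e.symm.toMonoidHom (e (QuotientGroup.mk R))) = 1 := by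
          simp only [MulEquiv.toMonoidHom_eq_coe, MonoidHom.coe_coe, MulEquiv.symm_apply_apply]
          exact (QuotientGroup.eq_one_iff R).2 (mem_NN1 R)
        rw [h5] at h4
        exact isConj_one_right.1 h4
      rw [hft _ h3] at h2
      exact isConj_one_left.1 h2
  exact no_split (MM K) R hR1 n hn hind (MulEquiv.refl _) χ hχ hker

lemma VirtuallyZ_equiv {G G' : Type} [Group G] [Group G'] (f : G ≃* G') (h : VirtuallyZ G) :
    VirtuallyZ G' := by
  obtain ⟨S, hS, ⟨u⟩⟩ := h
  refine ⟨S.comap f.symm.toMonoidHom, ?_, ⟨?_⟩⟩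
  · refine ⟨?_⟩
    rw [Subgroup.index_comap_of_surjective _ f.symm.surjective]
    exact hS.index_ne_zero
  · refine MulEquiv.trans ?_ u
    have : S.comap f.symm.toMonoidHom = S.map f.toMonoidHom := by
      ext x
      simp only [Subgroup.mem_comap, Subgroup.mem_map]
      constructor
      · intro h; exact ⟨f.symm x, h, by simp⟩
      · rintro ⟨y, hy, rfl⟩; simpa using hy
    rw [this]
    exact (S.equivMapOfInjective f.toMonoidHom f.injective).symm

theorem final {X : Type} [Nontrivial X] (R : FreeGroup X) (n : ℕ)
    (hn : 1 < n) (hR : ∀ (S : FreeGroup X) (k : ℕ), 1 ≤ k → R = S ^ k → k = 1)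
    (hindec : FreelyIndecomposable (Gq R n))
    (H : Type) [Group H] (A B : Subgroup H) (φ : A ≃* B)
    (hA : VirtuallyZ A) (hB : VirtuallyZ B)
    (e : Gq R n ≃* HNNExtension H A B φ) :
    let ψ : H →* Gq R n := e.symm.toMonoidHom.comp HNNExtension.of
    let T : Subgroup (Gq R n) := Subgroup.normalClosure {(QuotientGroup.mk R : Gq R n)}
    ¬ A.map ψ ≤ T ∧ ¬ B.map ψ ≤ T ∧
      (∃ M : Subgroup (Gq R n),
        M.IsMalnormal ∧ Nonempty (M ≃* Multiplicative ℤ) ∧ A.map ψ ≤ M) ∧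
      (∃ M : Subgroup (Gq R n),
        M.IsMalnormal ∧ Nonempty (M ≃* Multiplicative ℤ) ∧ B.map ψ ≤ M) := by
  intro ψ T
  have hR1 : R ≠ 1 := by
    rintro rfl
    have := hR 1 2 (by norm_num) (by simp)
    omega
  have hT : T = (pq R n).ker := (ker_pq R n).symm
  have hψ : Function.Injective ψ := e.symm.injective.comp (HNNExtension.of_injective (φ := φ))
  have h1 : ¬ A.map ψ ≤ (pq R n).ker := by
    intro h
    exact partI R hR1 n hn hindec H A B φ e fun a => h ⟨a, a.2, rfl⟩
  have h2 : ¬ B.map ψ ≤ (pq R n).ker := by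
    intro h
    refine partI R hR1 n hn hindec H A B φ e fun a => ?_
    have h3 : pq R n (e.symm (HNNExtension.of (φ a : H))) = 1 := h ⟨φ a, (φ a).2, rfl⟩
    rw [HNNExtension.equiv_eq_conj, map_mul, map_mul, map_mul, map_mul, map_inv, map_inv] at h3
    rwa [conj_eq_one_iff] at h3
  have hA' : VirtuallyZ (A.map ψ) := VirtuallyZ_equiv (A.equivMapOfInjective ψ hψ) hA
  have hB' : VirtuallyZ (B.map ψ) := VirtuallyZ_equiv (B.equivMapOfInjective ψ hψ) hB
  rw [hT]
  exact ⟨h1, h2, malnormal_part R hR1 hR n hn _ hA' h1, malnormal_part R hR1 hR n hn _ hB' h2⟩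

end OneRel

/-- If a freely indecomposable one-relator group with torsion
`G = ⟨X; Rⁿ⟩` is an HNN-extension of `H` with virtually-ℤ associated subgroups `A` and
`B`, then (identifying `A` and `B` with their images in `G` under the canonical
embedding of `H`) neither `A` nor `B` is contained in `T = ⟪R⟫`, and each of `A` and `B`
is contained in a malnormal infinite cyclic subgroup of `G`. -/
theorem statement_7 {X : Type} [Nontrivial X] (R : FreeGroup X) (n : ℕ)
    (hn : 1 < n) (hR : ∀ (S : FreeGroup X) (k : ℕ), 1 ≤ k → R = S ^ k → k = 1)
    (hindec : FreelyIndecomposable (PresentedGroup {R ^ n}))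
    (H : Type) [Group H] (A B : Subgroup H) (φ : A ≃* B)
    (hA : VirtuallyZ A) (hB : VirtuallyZ B)
    (e : PresentedGroup {R ^ n} ≃* HNNExtension H A B φ) :
    let ψ : H →* PresentedGroup {R ^ n} := e.symm.toMonoidHom.comp HNNExtension.of
    let T : Subgroup (PresentedGroup {R ^ n}) :=
      Subgroup.normalClosure {PresentedGroup.mk {R ^ n} R}
    ¬ A.map ψ ≤ T ∧ ¬ B.map ψ ≤ T ∧
      (∃ M : Subgroup (PresentedGroup {R ^ n}),
        M.IsMalnormal ∧ Nonempty (M ≃* Multiplicative ℤ) ∧ A.map ψ ≤ M) ∧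
      (∃ M : Subgroup (PresentedGroup {R ^ n}),
        M.IsMalnormal ∧ Nonempty (M ≃* Multiplicative ℤ) ∧ B.map ψ ≤ M) := by
  exact OneRel.final R n hn hR hindec H A B φ hA hB e
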